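/- arXiv:2001.02484 — 3 statements merged into one kernel-verified Lean document; each statement's English description precedes it below -/
import Mathlib

section
/- For every odd integer p ≥ 3, setting k = 2p, there exists a (2k+1)-regular class 1 multigraph G with φ_c(G) > 2 + 2/k. In particular, the conjecture that every (2t+1)-regular class 1 graph has circular flow number at most 2 + 2/t is false. -/
/-!
Basic theory of finite multigraphs (parallel edges allowed, no loops),
nowhere-zero `r`-flows, the circular flow number, proper edge colorings,
the chromatic index, class 1 / class 2, perfect matchings, edge cuts,
`r`-bipartitions, and the operation of adding parallel copies of a matching.
-/

/-- A finite multigraph: a finite type of vertices, a finite type of edges,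
each edge having an (ordered, for reference purposes) pair of distinct endpoints.
Parallel edges are allowed; loops are excluded. -/
structure Multigraph : Type 1 where
  V : Type
  E : Type
  vFinite : Finite V
  eFinite : Finite E
  ends : E → V × V
  no_loop : ∀ e, (ends e).1 ≠ (ends e).2

namespace Multigraph

variable (G : Multigraph)

instance : Finite G.V := G.vFinite
instance : Finite G.E := G.eFinite

/-- The first endpoint of an edge (w.r.t. the reference orientation). -/
def tail (e : G.E) : G.V := (G.ends e).1

/-- The second endpoint of an edge (w.r.t. the reference orientation). -/
def head (e : G.E) : G.V := (G.ends e).2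

/-- `v` is an endpoint of the edge `e`. -/
def Inc (v : G.V) (e : G.E) : Prop := G.tail e = v ∨ G.head e = v

open Classical in
/-- The endpoint of `e` other than `v`. -/
noncomputable def otherEnd (e : G.E) (v : G.V) : G.V :=
  if G.tail e = v then G.head e else G.tail e

/-- The degree of a vertex: the number of edges incident with it
(no loops, so no edge is counted twice). -/
noncomputable def degree (v : G.V) : ℕ := Nat.card {e : G.E // G.Inc v e}

/-- `G` is `k`-regular. -/
def IsRegular (k : ℕ) : Prop := ∀ v, G.degree v = k

/-- The maximum degree `Δ(G)`. -/
noncomputable def maxDegree : ℕ := sSup (Set.range G.degree)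

/-- Two distinct edges are adjacent if they share an endpoint. -/
def EAdj (e e' : G.E) : Prop := e ≠ e' ∧ ∃ v, G.Inc v e ∧ G.Inc v e'

/-- A proper edge coloring with `k` colors: adjacent edges get distinct colors. -/
def IsProperEdgeColoring {k : ℕ} (c : G.E → Fin k) : Prop :=
  ∀ e e', G.EAdj e e' → c e ≠ c e'

/-- The chromatic index `χ'(G)`. -/
noncomputable def chromaticIndex : ℕ :=
  sInf {k | ∃ c : G.E → Fin k, G.IsProperEdgeColoring c}

/-- `G` is class 1 if `χ'(G) = Δ(G)`. -/
def IsClass1 : Prop := G.chromaticIndex = G.maxDegree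

/-- `G` is class 2 if it is not class 1. -/
def IsClass2 : Prop := ¬ G.IsClass1

/-- A nowhere-zero `r`-flow: the orientation `D` is encoded by the signs of `f`
(a negative value means the edge is used against its reference direction), every
edge has absolute flow value in `[1, r-1]`, and Kirchhoff's law holds at every
vertex. -/
def IsNZFlow (r : ℝ) (f : G.E → ℝ) : Prop :=
  (∀ e, 1 ≤ |f e| ∧ |f e| ≤ r - 1) ∧
  ∀ v : G.V, ∑ᶠ e ∈ {e | G.tail e = v}, f e = ∑ᶠ e ∈ {e | G.head e = v}, f e

/-- `G` admits a nowhere-zero `r`-flow. -/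
def HasNZFlow (r : ℝ) : Prop := ∃ f, G.IsNZFlow r f

/-- The circular flow number `φ_c(G)`, as an extended real number:
the infimum of all real `r ≥ 2` such that `G` has a nowhere-zero `r`-flow
(`+∞` if there is no such `r`, e.g. if `G` has a bridge). -/
noncomputable def flowNumber : EReal :=
  sInf {x : EReal | ∃ r : ℝ, x = (r : EReal) ∧ 2 ≤ r ∧ G.HasNZFlow r}

/-- A perfect matching: every vertex is incident with exactly one edge of `M`. -/
def IsPerfectMatching (M : Set G.E) : Prop :=
  ∀ v, ∃! e, e ∈ M ∧ G.Inc v e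

/-- `G` is bipartite: the vertices can be 2-colored with every edge bichromatic. -/
def IsBipartite : Prop :=
  ∃ s : Set G.V, ∀ e, ¬ (G.tail e ∈ s ↔ G.head e ∈ s)

/-- The edge cut `∂_G(X)`: edges with exactly one end in `X`. -/
def cut (X : Set G.V) : Set G.E := {e | ¬ (G.tail e ∈ X ↔ G.head e ∈ X)}

/-- Add, for each `i : Fin k`, one new parallel copy of each edge of `M i`. -/
noncomputable def addEdgeFamily {k : ℕ} (M : Fin k → Set G.E) : Multigraph where
  V := G.V
  E := G.E ⊕ ((i : Fin k) × ↥(M i))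
  vFinite := by infer_instance
  eFinite := by infer_instance
  ends := Sum.elim G.ends (fun p => G.ends p.2.1)
  no_loop := by
    rintro (e | ⟨i, e⟩)
    · exact G.no_loop e
    · exact G.no_loop e.1

/-- `G + kM`: add `k` new parallel copies of each edge of `M`. -/
noncomputable def addCopies (M : Set G.E) (k : ℕ) : Multigraph :=
  G.addEdgeFamily (fun _ : Fin k => M)

/-- Delete a set of edges. -/
noncomputable def deleteEdges (M : Set G.E) : Multigraph where
  V := G.V
  E := {e : G.E // e ∉ M}
  vFinite := G.vFinite
  eFinite := by infer_instance
  ends := fun e => G.ends e.1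
  no_loop := fun e => G.no_loop e.1

/-- Vertex adjacency (there is an edge between `u` and `v`). -/
def VAdj (u v : G.V) : Prop := ∃ e, G.ends e = (u, v) ∨ G.ends e = (v, u)

/-- Reachability by walks. -/
def Reach : G.V → G.V → Prop := Relation.ReflTransGen G.VAdj

/-- `G` is connected. -/
def Connected : Prop := ∀ u v, G.Reach u v

/-- An edge is a bridge if its ends are not joined by a walk avoiding it. -/
def IsBridge (e : G.E) : Prop :=
  ¬ (G.deleteEdges {e}).Reach (G.tail e) (G.head e)

/-- `G` is bridgeless. -/
def Bridgeless : Prop := ∀ e, ¬ G.IsBridge e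

/-- An `r`-bipartition of (the vertex set of) a cubic graph. -/
def IsRBipartition (r : ℝ) (B W : Set G.V) : Prop :=
  B ∪ W = Set.univ ∧ B ∩ W = ∅ ∧
  ∀ X : Set G.V,
    (r / (r - 2)) * |((X ∩ B).ncard : ℝ) - ((X ∩ W).ncard : ℝ)| ≤ ((G.cut X).ncard : ℝ)

/-- A cubic graph `G` with a perfect matching `M` has the `M`-class-2 property
if `G + (2t-2)M` is class 2 for every integer `t ≥ 1`. -/
def MClass2Property (M : Set G.E) : Prop :=
  ∀ t : ℕ, 1 ≤ t → (G.addCopies M (2 * t - 2)).IsClass2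

/-- A cubic graph `G` with a perfect matching `M` has the `M`-class-1 property
if `G + (2t-2)M` is class 1 for every integer `t ≥ 2`. -/
def MClass1Property (M : Set G.E) : Prop :=
  ∀ t : ℕ, 2 ≤ t → (G.addCopies M (2 * t - 2)).IsClass1

/-- An `r`-graph: an `r`-regular multigraph in which every odd set of vertices
is left by at least `r` edges. -/
def IsRGraph (r : ℕ) : Prop :=
  G.IsRegular r ∧ ∀ X : Set G.V, Odd X.ncard → r ≤ (G.cut X).ncard

end Multigraph

namespace Ctr

/-- Positions (pairs of core vertices). -/
abbrev Pos (h : ℕ) := (Fin h × Fin 4) ⊕ Fin 2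
/-- Core vertices of a gadget. -/
abbrev U (h : ℕ) := Pos h × Bool
/-- Positions of stub vertices. -/
abbrev SI (h : ℕ) := Fin h ⊕ Fin 2
/-- Local colors. -/
abbrev Gam (h : ℕ) := Fin 3 ⊕ (ZMod (4 * h + 1) × Bool)

def sp {h : ℕ} : SI h → Pos h
  | .inl j => .inl (j, 0)
  | .inr i => .inr i

lemma sp_inj {h : ℕ} : Function.Injective (sp (h := h)) := by
  rintro (a | a) (b | b) hab <;> simp_all [sp]

/-- position number; the last position is the point at infinity -/
def num {h : ℕ} : Pos h → Option (ZMod (4 * h + 1))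
  | .inl (j, c) => some ((c.val * h + j.val : ℕ) : ZMod (4 * h + 1))
  | .inr i => if i = 0 then some ((4 * h : ℕ) : ZMod (4 * h + 1)) else none

lemma cast_inj {m a b : ℕ} (ha : a < m) (hb : b < m) (hab : (a : ZMod m) = b) : a = b := by
  rw [ZMod.natCast_eq_natCast_iff'] at hab
  rwa [Nat.mod_eq_of_lt ha, Nat.mod_eq_of_lt hb] at hab

lemma lin_lt {h : ℕ} (j : Fin h) (c : Fin 4) : c.val * h + j.val < 4 * h := by
  have h1 := j.isLt
  have h2 := c.isLt
  have : (c.val + 1) * h ≤ 4 * h := Nat.mul_le_mul_right h (by omega)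
  nlinarith

lemma num_inj {h : ℕ} : Function.Injective (num (h := h)) := by
  rintro (⟨j, c⟩ | a) (⟨j', c'⟩ | b) hab
  · simp only [num, Option.some.injEq] at hab
    have h1 := lin_lt j c
    have h2 := lin_lt j' c'
    have h3 := cast_inj (by omega) (by omega) hab
    have hj := j.isLt
    have hj' := j'.isLt
    have hc : c.val = c'.val := by
      rcases lt_trichotomy c.val c'.val with hl | hl | hl
      · have : (c.val + 1) * h ≤ c'.val * h := Nat.mul_le_mul_right h hl
        nlinarith
      · exact hl
      · have : (c'.val + 1) * h ≤ c.val * h := Nat.mul_le_mul_right h hl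
        nlinarith
    rw [hc] at h3
    have hjj : j.val = j'.val := by omega
    simp [Fin.ext_iff, hc, hjj]
  · fin_cases b
    · simp only [num, Fin.zero_eta, if_true, Option.some.injEq] at hab
      have h1 := lin_lt j c
      have h3 := cast_inj (by omega) (by omega) hab
      omega
    · simp [num] at hab
  · fin_cases a
    · simp only [num, Fin.zero_eta, if_true, Option.some.injEq] at hab
      have h1 := lin_lt j' c'
      have h3 := cast_inj (by omega) (by omega) hab
      omega
    · simp [num] at hab
  · fin_cases a <;> fin_cases b <;> simp_all [num]

/-- one-factorization of the complete graph on `Option (ZMod m)` -/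
def ff {m : ℕ} : Option (ZMod m) → Option (ZMod m) → ZMod m
  | some a, some b => a + b
  | some a, none => a + a
  | none, some b => b + b
  | none, none => 0

lemma ff_comm {m : ℕ} (x y : Option (ZMod m)) : ff x y = ff y x := by
  rcases x with _ | x <;> rcases y with _ | y <;> simp [ff, add_comm]

lemma dbl_inj {k : ℕ} {a b : ZMod (4 * k + 1)} (hab : a + a = b + b) : a = b := by
  have h4 : (4 * k + 1 : ZMod (4 * k + 1)) = 0 := by
    have := ZMod.natCast_self (4 * k + 1)
    push_cast at this
    exact this
  have h5 : ∀ z : ZMod (4 * k + 1), z = -(2 * k) * (z + z) := by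
    intro z
    linear_combination z * h4
  rw [h5 a, h5 b, hab]

lemma ff_inj {k : ℕ} (x y z : Option (ZMod (4 * k + 1))) (hy : x ≠ y) (hz : x ≠ z)
    (hf : ff x y = ff x z) : y = z := by
  rcases x with _ | x <;> rcases y with _ | y <;> rcases z with _ | z <;>
    simp_all [ff]
  exact dbl_inj hf

def f {h : ℕ} (x y : Pos h) : ZMod (4 * h + 1) := ff (num x) (num y)

lemma f_comm {h : ℕ} (x y : Pos h) : f x y = f y x := ff_comm _ _

lemma f_inj {h : ℕ} {x y z : Pos h} (hy : x ≠ y) (hz : x ≠ z) (hf : f x y = f x z) : y = z :=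
  num_inj (ff_inj _ _ _ (fun e => hy (num_inj e)) (fun e => hz (num_inj e)) hf)

/-- links used for the Kempe swaps -/
def q {h : ℕ} [NeZero h] : Fin 3 → Pos h → Pos h
  | 0, .inl (j, 1) => if j = 0 then .inr 1 else .inl (j, 1)
  | 0, .inr 1 => .inl (0, 1)
  | 1, .inl (j, 0) => .inl (j, 2)
  | 1, .inl (j, 2) => .inl (j, 0)
  | 2, .inl (j, 0) => .inl (j, 3)
  | 2, .inl (j, 3) => .inl (j, 0)
  | _, x => x

lemma q_q {h : ℕ} [NeZero h] (c : Fin 3) (x : Pos h) : q c (q c x) = x := by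
  rcases x with ⟨j, d⟩ | d
  · fin_cases c <;> fin_cases d <;> simp [q]
    split_ifs with hj
    · simp [hj]
    · simp [hj]
  · fin_cases c <;> fin_cases d <;> simp [q]

lemma q_iff {h : ℕ} [NeZero h] (c : Fin 3) (x y : Pos h) : q c x = y ↔ q c y = x := by
  constructor <;> (rintro rfl; exact q_q _ _)

def eps (c : Fin 3) : Bool := c ≠ 1

def sw {h : ℕ} [NeZero h] (c : Fin 3) (x : Pos h) : Equiv.Perm (Gam h) :=
  if q c x = x then 1 else Equiv.swap (.inl c) (.inr (f x (q c x), eps c))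

lemma sw_inl {h : ℕ} [NeZero h] (c d : Fin 3) (x : Pos h) (hd : d ≠ c) :
    sw c x (.inl d) = .inl d := by
  unfold sw
  split_ifs
  · rfl
  · exact Equiv.swap_apply_of_ne_of_ne (by simpa using hd) (by simp)

lemma sw_inl_self {h : ℕ} [NeZero h] (c : Fin 3) (x : Pos h) (hx : q c x ≠ x) :
    sw c x (.inl c) = .inr (f x (q c x), eps c) := by
  unfold sw
  rw [if_neg hx, Equiv.swap_apply_left]

lemma sw_inr {h : ℕ} [NeZero h] (c : Fin 3) (x y : Pos h) (hxy : x ≠ y) (e : Bool) :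
    sw c x (.inr (f x y, e)) =
      if q c x = y ∧ e = eps c then .inl c else .inr (f x y, e) := by
  unfold sw
  by_cases hx : q c x = x
  · rw [if_pos hx, if_neg]
    · rfl
    · rintro ⟨h1, _⟩
      exact hxy (hx.symm.trans h1)
  · rw [if_neg hx]
    split_ifs with hc
    · obtain ⟨h1, h2⟩ := hc
      subst h1 h2
      exact Equiv.swap_apply_right _ _
    · refine Equiv.swap_apply_of_ne_of_ne (by simp) ?_
      intro he
      simp only [Sum.inr.injEq, Prod.mk.injEq] at he
      exact hc ⟨(f_inj hxy (Ne.symm hx) he.1).symm, he.2⟩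

def pi {h : ℕ} [NeZero h] (x : Pos h) : Equiv.Perm (Gam h) := sw 0 x * (sw 1 x * sw 2 x)

lemma pi_cons {h : ℕ} [NeZero h] (x y : Pos h) (hxy : x ≠ y) (e : Bool) :
    pi x (.inr (f x y, e)) = pi y (.inr (f x y, e)) := by
  have key : ∀ c, sw c y (.inr (f x y, e)) =
      if q c x = y ∧ e = eps c then .inl c else .inr (f x y, e) := by
    intro c
    rw [f_comm x y, sw_inr c y x hxy.symm]
    simp only [q_iff c x y]
  simp only [pi, Equiv.Perm.mul_apply]
  rw [sw_inr 2 x y hxy, key 2]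
  split_ifs
  · rw [sw_inl 1 2 _ (by decide), sw_inl 0 2 _ (by decide), sw_inl 1 2 _ (by decide),
      sw_inl 0 2 _ (by decide)]
  · rw [sw_inr 1 x y hxy, key 1]
    split_ifs
    · rw [sw_inl 0 1 _ (by decide), sw_inl 0 1 _ (by decide)]
    · rw [sw_inr 0 x y hxy, key 0]

lemma pi_inl {h : ℕ} [NeZero h] (x : Pos h) (c : Fin 3) (hx : q c x = x) :
    pi x (.inl c) = .inl c := by
  have h0 : sw c x = 1 := by simp [sw, hx]
  fin_cases c <;> simp only [Fin.zero_eta, Fin.mk_one, Fin.reduceFinMk] at h0 ⊢ <;> 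
    simp only [pi, Equiv.Perm.mul_apply]
  · rw [sw_inl 2 0 _ (by decide), sw_inl 1 0 _ (by decide), h0]; rfl
  · rw [sw_inl 2 1 _ (by decide), h0]
    exact sw_inl 0 1 _ (by decide)
  · rw [h0]
    exact (congrArg _ (sw_inl 1 2 _ (by decide))).trans (sw_inl 0 2 _ (by decide))

/-- default vertical color -/
def vert {h : ℕ} : Pos h → Fin 3
  | .inl (_, 0) => 0
  | .inl (_, 1) => 0
  | .inl (_, 2) => 1
  | .inl (_, 3) => 2
  | .inr 0 => 2
  | .inr 1 => 1

/-- default stub colors -/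
def sA {h : ℕ} : SI h → Bool → Fin 3
  | .inl _, false => 1
  | .inl _, true => 2
  | .inr 0, false => 0
  | .inr 0, true => 1
  | .inr 1, false => 0
  | .inr 1, true => 2

lemma sA_vert {h : ℕ} (s : SI h) (b : Bool) : sA s b ≠ vert (sp s) := by
  rcases s with j | i
  · cases b <;> simp [sA, vert, sp]
  · fin_cases i <;> cases b <;> simp [sA, vert, sp]

lemma sA_inj {h : ℕ} (s : SI h) : Function.Injective (sA s) := by
  rcases s with j | i
  · rintro (_|_) (_|_) <;> simp [sA]
  · fin_cases i <;> rintro (_|_) (_|_) <;> simp [sA]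

/-- final stub color -/
def gam {h : ℕ} [NeZero h] (s : SI h × Bool) : Gam h := pi (sp s.1) (.inl (sA s.1 s.2))

lemma gam_inl_false {h : ℕ} [NeZero h] (j : Fin h) :
    gam (.inl j, false) = .inr (f (.inl (j, 0)) (.inl (j, 2)), false) := by
  simp only [gam, sp, sA, pi, Equiv.Perm.mul_apply]
  rw [sw_inl 2 1 _ (by decide), sw_inl_self 1 _ (by simp [q])]
  simp [sw, q, eps]

lemma gam_inl_true {h : ℕ} [NeZero h] (j : Fin h) :
    gam (.inl j, true) = .inr (f (.inl (j, 0)) (.inl (j, 3)), true) := by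
  simp only [gam, sp, sA, pi, Equiv.Perm.mul_apply]
  rw [sw_inl_self 2 _ (by simp [q])]
  simp only [q]
  rw [sw_inr 1 _ _ (by simp), if_neg (by simp [eps])]
  simp [sw, q, eps]

lemma gam_i0 {h : ℕ} [NeZero h] (b : Bool) : gam (h := h) (.inr 0, b) = .inl (sA (h := h) (.inr 0) b) := by
  simp only [gam, sp]
  apply pi_inl
  cases b <;> simp [sA, q]

lemma gam_i1t {h : ℕ} [NeZero h] : gam (h := h) (.inr 1, true) = .inl 2 := by
  simp only [gam, sp]
  apply pi_inl
  simp [sA, q]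

lemma gam_i1f {h : ℕ} [NeZero h] :
    gam (h := h) (.inr 1, false) = .inr (f (.inr 1) (.inl (0, 1)), true) := by
  simp only [gam, sp, sA, pi, Equiv.Perm.mul_apply]
  rw [sw_inl 2 0 _ (by decide), sw_inl 1 0 _ (by decide), sw_inl_self 0 _ (by simp [q])]
  simp [q, eps]

lemma a1_inj {h : ℕ} {j j' : Fin h}
    (hj : f (.inl (j, 0)) (.inl (j, 2)) = f (.inl (j', 0)) (.inl (j', 2))) : j = j' := by
  simp only [f, num, ff] at hj
  have : ((j.val : ℕ) : ZMod (4 * h + 1)) = (j'.val : ℕ) := by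
    apply dbl_inj
    push_cast at hj
    linear_combination hj
  exact Fin.ext (cast_inj (by omega) (by omega) this)

lemma a2_inj {h : ℕ} {j j' : Fin h}
    (hj : f (.inl (j, 0)) (.inl (j, 3)) = f (.inl (j', 0)) (.inl (j', 3))) : j = j' := by
  simp only [f, num, ff] at hj
  have : ((j.val : ℕ) : ZMod (4 * h + 1)) = (j'.val : ℕ) := by
    apply dbl_inj
    push_cast at hj
    linear_combination hj
  exact Fin.ext (cast_inj (by omega) (by omega) this)

lemma a3_ne {h : ℕ} [NeZero h] {j : Fin h} :
    f (.inr 1) (.inl ((0 : Fin h), 1)) ≠ f (.inl (j, 0)) (.inl (j, 3)) := by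
  intro hj
  simp only [f, num, ff] at hj
  norm_num at hj
  have h1 : ((h + h : ℕ) : ZMod (4 * h + 1)) = ((j.val + (3 * h + j.val) : ℕ)) := by
    push_cast; exact hj
  have hh := j.isLt
  rcases Nat.lt_or_ge (j.val + (3 * h + j.val)) (4 * h + 1) with hl | hl
  · have := cast_inj (by omega) hl h1
    omega
  · have h2 : ((j.val + (3 * h + j.val) : ℕ) : ZMod (4 * h + 1))
        = ((j.val + (3 * h + j.val) - (4 * h + 1) : ℕ)) := by
      rw [Nat.cast_sub hl, ZMod.natCast_self, sub_zero]
    rw [h2] at h1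
    have := cast_inj (by omega) (by omega) h1
    omega

lemma gam_inj {h : ℕ} [NeZero h] : Function.Injective (gam (h := h)) := by
  rintro ⟨s, b⟩ ⟨s', b'⟩ hab
  by_cases hs : s = s'
  · subst hs
    have : sA s b = sA s b' := by
      have := (pi (sp s)).injective hab
      simpa using this
    rw [sA_inj s this]
  exfalso
  rcases s with j | i <;> rcases s' with j' | i'
  · cases b <;> cases b' <;> simp only [gam_inl_true, gam_inl_false, Sum.inr.injEq, Prod.mk.injEq,
      and_true, and_false, Bool.false_eq_true, Bool.true_eq_false] at hab
    · exact hs (by rw [a1_inj hab])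
    · exact hs (by rw [a2_inj hab])
  · fin_cases i' <;> cases b <;> cases b' <;>
      simp [gam_inl_true, gam_inl_false, gam_i0, gam_i1f, gam_i1t] at hab
    exact a3_ne hab.symm
  · fin_cases i <;> cases b <;> cases b' <;>
      simp [gam_inl_true, gam_inl_false, gam_i0, gam_i1f, gam_i1t] at hab
    exact a3_ne hab
  · fin_cases i <;> fin_cases i' <;> cases b <;> cases b' <;>
      simp [gam_i0, gam_i1f, gam_i1t, sA] at hab hs

/-- complete-graph edges -/
abbrev KE (h : ℕ) := {e : Sym2 (U h) // ¬ e.IsDiag}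
/-- triangle edges -/
abbrev TE (h : ℕ) := (Fin h × Bool) × Fin 3
/-- core edges: complete graph, triangles, stubs to the left, stubs to the right -/
abbrev CE (h : ℕ) := (KE h ⊕ TE h) ⊕ ((SI h × Bool) ⊕ (SI h × Bool))

def rho {h : ℕ} (j : Fin h) (c : Fin 3) : Pos h := .inl (j, c.succ)

def stubV {h : ℕ} (s : SI h × Bool) : U h := (sp s.1, s.2)

lemma rho_ne_sp {h : ℕ} (j : Fin h) (c : Fin 3) (s : SI h) : rho j c ≠ sp s := by
  rcases s with s | s
  · simp only [rho, sp, ne_eq, Sum.inl.injEq, Prod.mk.injEq, not_and]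
    intro _ h0
    exact Fin.succ_ne_zero _ h0
  · simp [rho, sp]

lemma vert_rho {h : ℕ} (j : Fin h) (c : Fin 3) : vert (rho j c) = c := by
  fin_cases c <;> rfl

lemma q_rho {h : ℕ} [NeZero h] (j : Fin h) (c d : Fin 3) (hd : d ≠ c) :
    q c (rho j d) = rho j d := by
  fin_cases c <;> fin_cases d <;> first | exact absurd rfl hd | rfl

def dK {h : ℕ} (u v : U h) : Gam h :=
  if u.1 = v.1 then .inl (vert u.1) else .inr (f u.1 v.1, xor u.2 v.2)

lemma pdK_symm {h : ℕ} [NeZero h] (u v : U h) : pi u.1 (dK u v) = pi v.1 (dK v u) := by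
  unfold dK
  by_cases huv : u.1 = v.1
  · rw [if_pos huv, if_pos huv.symm, huv]
  · rw [if_neg huv, if_neg (Ne.symm huv), pi_cons _ _ huv, f_comm, Bool.xor_comm]

lemma dK_inj {h : ℕ} {u v w : U h} (hv : u ≠ v) (hw : u ≠ w) (he : dK u v = dK u w) : v = w := by
  obtain ⟨x, a⟩ := u
  obtain ⟨y, b⟩ := v
  obtain ⟨z, c⟩ := w
  unfold dK at he
  dsimp only at he
  split_ifs at he with h1 h2 h2
  · subst h1 h2
    cases a <;> cases b <;> cases c <;> simp_all
  · simp only [Sum.inr.injEq, Prod.mk.injEq] at he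
    have := f_inj h1 h2 he.1
    have h3 := he.2
    subst this
    simp at h3
    rw [h3]

def cK {h : ℕ} [NeZero h] : Sym2 (U h) → Gam h :=
  Sym2.lift ⟨fun u v => pi u.1 (dK u v), pdK_symm⟩

def cc0 {h : ℕ} [NeZero h] : CE h → Gam h
  | .inl (.inl e) => cK e.1
  | .inl (.inr t) => .inl t.2
  | .inr (.inl s) => gam s
  | .inr (.inr s) => gam (s.1, !s.2)

/-- incidence inside a gadget -/
def cinc {h : ℕ} (u : U h) : CE h → Prop
  | .inl (.inl e) => u ∈ e.1
  | .inl (.inr t) => u = (rho t.1.1 (t.2 + 1), t.1.2) ∨ u = (rho t.1.1 (t.2 + 2), t.1.2)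
  | .inr (.inl s) => u = stubV s
  | .inr (.inr s) => u = stubV s

lemma rho_inj {h : ℕ} {j j' : Fin h} {c c' : Fin 3} (he : rho j c = rho j' c') :
    j = j' ∧ c = c' := by
  simpa [rho] using he

/-- default color of an edge seen from a vertex -/
lemma cc0_eq {h : ℕ} [NeZero h] (u : U h) (e : CE h) (he : cinc u e) :
    (∃ k v, e = .inl (.inl k) ∧ u ≠ v ∧ k.1 = s(u, v) ∧ cc0 e = pi u.1 (dK u v)) ∨
    (∃ j c d, e = .inl (.inr ((j, u.2), c)) ∧ u.1 = rho j d ∧ d ≠ c ∧ 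
      cc0 e = pi u.1 (.inl c)) ∨
    (∃ s, e = .inr (.inl (s, u.2)) ∧ u.1 = sp s ∧ cc0 e = pi u.1 (.inl (sA s u.2))) ∨
    (∃ s, e = .inr (.inr (s, u.2)) ∧ u.1 = sp s ∧ cc0 e = pi u.1 (.inl (sA s (!u.2)))) := by
  rcases e with (k | ⟨⟨j, b⟩, c⟩) | (⟨s, b⟩ | ⟨s, b⟩)
  · left
    obtain ⟨v, hv⟩ := Sym2.mem_iff_exists.1 he
    refine ⟨k, v, rfl, ?_, hv, ?_⟩
    · rintro rfl
      exact k.2 (by rw [hv]; simp)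
    · simp only [cc0, hv, cK, Sym2.lift_mk]
  · right; left
    have hne1 : ∀ c : Fin 3, c + 1 ≠ c := by decide
    have hne2 : ∀ c : Fin 3, c + 2 ≠ c := by decide
    rcases he with he | he
    · subst he
      refine ⟨j, c, c + 1, rfl, rfl, hne1 c, ?_⟩
      exact (pi_inl _ _ (q_rho _ _ _ (hne1 c))).symm
    · subst he
      refine ⟨j, c, c + 2, rfl, rfl, hne2 c, ?_⟩
      exact (pi_inl _ _ (q_rho _ _ _ (hne2 c))).symm
  · right; right; left
    have he' : u = (sp s, b) := he
    subst he'
    exact ⟨s, rfl, rfl, rfl⟩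
  · right; right; right
    have he' : u = (sp s, b) := he
    subst he'
    exact ⟨s, rfl, rfl, rfl⟩

lemma dK_inl {h : ℕ} {u v : U h} {c : Fin 3} (he : dK u v = .inl c) : vert u.1 = c := by
  unfold dK at he
  split_ifs at he
  simpa using he

lemma cc0_proper {h : ℕ} [NeZero h] (u : U h) (e e' : CE h) (he : cinc u e) (he' : cinc u e')
    (hc : cc0 e = cc0 e') : e = e' := by
  rcases cc0_eq u e he with ⟨k, v, h1, h2, h3, h4⟩ | ⟨j, c, d, h1, h2, h3, h4⟩ |
    ⟨s, h1, h2, h4⟩ | ⟨s, h1, h2, h4⟩ <;>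
  rcases cc0_eq u e' he' with ⟨k', v', g1, g2, g3, g4⟩ | ⟨j', c', d', g1, g2, g3, g4⟩ |
    ⟨s', g1, g2, g4⟩ | ⟨s', g1, g2, g4⟩ <;>
  have hp := (pi u.1).injective (h4.symm.trans (hc.trans g4))
  · have := dK_inj h2 g2 hp
    have hk : k = k' := Subtype.ext (by rw [h3, g3, this])
    rw [h1, g1, hk]
  · have := dK_inl hp
    rw [g2, vert_rho] at this
    exact absurd this g3
  · have := dK_inl hp
    rw [g2] at this
    exact absurd this.symm (sA_vert _ _)
  · have := dK_inl hp
    rw [g2] at this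
    exact absurd this.symm (sA_vert _ _)
  · have := dK_inl hp.symm
    rw [h2, vert_rho] at this
    exact absurd this h3
  · have hj := (rho_inj (h2.symm.trans g2)).1
    simp only [Sum.inl.injEq] at hp
    rw [h1, g1, hj, hp]
  · exact absurd (h2.symm.trans g2) (rho_ne_sp _ _ _)
  · exact absurd (h2.symm.trans g2) (rho_ne_sp _ _ _)
  · have := dK_inl hp.symm
    rw [h2] at this
    exact absurd this.symm (sA_vert _ _)
  · exact absurd (g2.symm.trans h2) (rho_ne_sp _ _ _)
  · rw [h1, g1, sp_inj (h2.symm.trans g2)]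
  · have hs := sp_inj (h2.symm.trans g2)
    subst hs
    simp only [Sum.inl.injEq] at hp
    have := sA_inj _ hp
    simp at this
  · have := dK_inl hp.symm
    rw [h2] at this
    exact absurd this.symm (sA_vert _ _)
  · exact absurd (g2.symm.trans h2) (rho_ne_sp _ _ _)
  · have hs := sp_inj (h2.symm.trans g2)
    subst hs
    simp only [Sum.inl.injEq] at hp
    have := sA_inj _ hp
    simp at this
  · rw [h1, g1, sp_inj (h2.symm.trans g2)]

open Classical in
lemma class1_of {G : Multigraph} [Fintype G.V] [Fintype G.E] {Z : Type} [Fintype Z] (d : ℕ)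
    (hZ : Fintype.card Z = d) (col : G.E → Z)
    (hcol : ∀ v e e', G.Inc v e → G.Inc v e' → col e = col e' → e = e')
    (hcard : 2 * Fintype.card G.E = d * Fintype.card G.V) (v0 : G.V) :
    G.IsRegular d ∧ G.IsClass1 := by
  have hle : ∀ v, G.degree v ≤ d := by
    intro v
    unfold Multigraph.degree
    rw [Nat.card_eq_fintype_card, ← hZ]
    apply Fintype.card_le_of_injective (fun e : {e : G.E // G.Inc v e} => col e.1)
    intro e e' he
    exact Subtype.ext (hcol v _ _ e.2 e'.2 he)
  have hsum : ∑ v, G.degree v = 2 * Fintype.card G.E := by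
    have h1 : ∀ v, G.degree v = ∑ e, if G.Inc v e then 1 else 0 := by
      intro v
      unfold Multigraph.degree
      rw [Nat.card_eq_fintype_card, Fintype.card_subtype, Finset.card_filter]
    simp_rw [h1]
    rw [Finset.sum_comm]
    have h2 : ∀ e, (∑ v, if G.Inc v e then 1 else 0) = 2 := by
      intro e
      rw [← Finset.card_filter]
      have : (Finset.univ.filter fun v => G.Inc v e) = {G.tail e, G.head e} := by
        ext v
        simp [Multigraph.Inc, eq_comm]
      rw [this]
      exact Finset.card_pair (G.no_loop e)
    simp [h2, mul_comm]
  have hreg : G.IsRegular d := by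
    have : ∑ v, G.degree v = ∑ _v : G.V, d := by
      rw [hsum, hcard]; simp [mul_comm]
    have h3 := (Finset.sum_eq_sum_iff_of_le (fun v _ => hle v)).1 this
    exact fun v => h3 v (Finset.mem_univ v)
  refine ⟨hreg, ?_⟩
  have hmax : G.maxDegree = d := by
    unfold Multigraph.maxDegree
    have : Set.range G.degree = {d} := by
      ext x
      simp only [Set.mem_range, Set.mem_singleton_iff]
      constructor
      · rintro ⟨v, rfl⟩; exact hreg v
      · rintro rfl; exact ⟨v0, hreg v0⟩
    rw [this]; simp
  unfold Multigraph.IsClass1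
  rw [hmax]
  unfold Multigraph.chromaticIndex
  apply le_antisymm
  · apply Nat.sInf_le
    refine ⟨fun e => (Fintype.equivFinOfCardEq hZ) (col e), ?_⟩
    rintro e e' ⟨hne, v, h1, h2⟩ heq
    exact hne (hcol v e e' h1 h2 ((Fintype.equivFinOfCardEq hZ).injective heq))
  · apply le_csInf
    · refine ⟨d, fun e => (Fintype.equivFinOfCardEq hZ) (col e), ?_⟩
      rintro e e' ⟨hne, v, h1, h2⟩ heq
      exact hne (hcol v e e' h1 h2 ((Fintype.equivFinOfCardEq hZ).injective heq))
    · rintro k ⟨c, hc⟩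
      rw [← hreg v0]
      unfold Multigraph.degree
      rw [Nat.card_eq_fintype_card]
      calc Fintype.card {e : G.E // G.Inc v0 e} ≤ Fintype.card (Fin k) := by
            apply Fintype.card_le_of_injective (fun e : {e : G.E // G.Inc v0 e} => c e.1)
            intro e e' he
            by_contra hne
            exact hc e.1 e'.1 ⟨fun h => hne (Subtype.ext h), v0, e.2, e'.2⟩ he
        _ = k := Fintype.card_fin k

abbrev ZZ (h : ℕ) := ZMod (8 * h + 5)
abbrev VV (h : ℕ) := Option (ZZ h ⊕ (ZZ h × U h))
abbrev EE (h : ℕ) := ZZ h ⊕ ((ZZ h × Fin (2 * h - 2)) ⊕ (ZZ h × CE h))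

def ring {h : ℕ} (i : ZZ h) : VV h := some (.inl i)
def gad {h : ℕ} (j : ZZ h) (u : U h) : VV h := some (.inr (j, u))

lemma ring_inj {h : ℕ} {i j : ZZ h} : ring i = ring j ↔ i = j := by simp [ring]
lemma gad_inj {h : ℕ} {i j : ZZ h} {u v : U h} : gad i u = gad j v ↔ i = j ∧ u = v := by
  simp [gad]
lemma ring_ne_gad {h : ℕ} {i j : ZZ h} {u : U h} : ring i ≠ gad j u := by simp [ring, gad]
lemma gad_ne_ring {h : ℕ} {i j : ZZ h} {u : U h} : gad j u ≠ ring i := by simp [ring, gad]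

noncomputable def cends {h : ℕ} (j : ZZ h) : CE h → VV h × VV h
  | .inl (.inl k) => (gad j k.1.out.1, gad j k.1.out.2)
  | .inl (.inr t) => (gad j (rho t.1.1 (t.2 + 1), t.1.2), gad j (rho t.1.1 (t.2 + 2), t.1.2))
  | .inr (.inl s) => (ring j, gad j (stubV s))
  | .inr (.inr s) => (gad j (stubV s), ring (j + 1))

noncomputable def gends {h : ℕ} : EE h → VV h × VV h
  | .inl i => (none, ring i)
  | .inr (.inl (j, _)) => (ring j, ring (j + 1))
  | .inr (.inr (j, e)) => cends j e

lemma out_eq {h : ℕ} (e : Sym2 (U h)) : s(e.out.1, e.out.2) = e := Quot.out_eq e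

lemma zcast_ne {h a b : ℕ} (ha : a < 8 * h + 5) (hb : b < 8 * h + 5) (hab : a ≠ b) :
    (a : ZZ h) ≠ (b : ZZ h) := fun e => hab (cast_inj ha hb e)

lemma zone_ne {h : ℕ} : (1 : ZZ h) ≠ 0 := by
  have := zcast_ne (h := h) (a := 1) (b := 0) (by omega) (by omega) (by omega)
  simpa using this

lemma gends_ne {h : ℕ} (e : EE h) : (gends e).1 ≠ (gends e).2 := by
  rcases e with i | ⟨j, k⟩ | ⟨j, (k | t) | (s | s)⟩
  · simp [gends, ring]
  · simp [gends, ring, zone_ne]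
  · simp only [gends, cends, ne_eq, gad_inj, not_and]
    intro _ h2
    apply k.2
    rw [← out_eq k.1, h2]
    simp
  · simp only [gends, cends, ne_eq, gad_inj, not_and, Prod.mk.injEq]
    intro _ h2
    exact absurd (rho_inj h2).2 ((by decide : ∀ c : Fin 3, c + 1 ≠ c + 2) _)
  · exact ring_ne_gad
  · exact gad_ne_ring

/-- The counterexample graph. -/
noncomputable def GG (h : ℕ) : Multigraph where
  V := VV h
  E := EE h
  vFinite := by infer_instance
  eFinite := by infer_instance
  ends := gends
  no_loop := gends_ne

def InD {h : ℕ} (x : ZZ h) : Prop := ∃ d : ℕ, d < 4 * h + 2 ∧ x = ((2 * (d + 1) : ℕ) : ZZ h)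

lemma InD.ne_zero {h : ℕ} {x : ZZ h} (hx : InD x) : x ≠ 0 := by
  obtain ⟨d, hd, rfl⟩ := hx
  have := zcast_ne (h := h) (a := 2 * (d + 1)) (b := 0) (by omega) (by omega) (by omega)
  simpa using this

lemma InD.ne_one {h : ℕ} {x : ZZ h} (hx : InD x) : x ≠ 1 := by
  obtain ⟨d, hd, rfl⟩ := hx
  have := zcast_ne (h := h) (a := 2 * (d + 1)) (b := 1) (by omega) (by omega) (by omega)
  simpa using this

lemma InD.ne_succ {h : ℕ} {x y : ZZ h} (hx : InD x) (hy : InD y) : x ≠ y + 1 := by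
  intro he
  obtain ⟨d', hd', rfl⟩ := hy
  by_cases hlast : 2 * (d' + 1) + 1 = 8 * h + 5
  · apply hx.ne_zero
    rw [he]
    have := ZMod.natCast_self (8 * h + 5)
    rw [← hlast] at this
    push_cast at this ⊢
    have h5 : ((2 * (d' + 1) + 1 : ℕ) : ZZ h) = 0 := by
      rw [hlast]; exact ZMod.natCast_self _
    push_cast at h5
    exact h5
  · obtain ⟨d, hd, rfl⟩ := hx
    have := zcast_ne (h := h) (a := 2 * (d + 1)) (b := 2 * (d' + 1) + 1)
      (by omega) (by omega) (by omega)
    apply this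
    rw [he]; push_cast; ring

abbrev Bd (h : ℕ) := (SI h × Bool) ⊕ Fin (2 * h - 2)

lemma exists_colors (h : ℕ) [NeZero h] : ∃ (g : Bd h → ZZ h) (Φ : Gam h ≃ ZZ h),
    Function.Injective g ∧ (∀ b, InD (g b)) ∧ ∀ s, Φ (gam s) = g (.inl s) := by
  have hpos : 0 < h := Nat.pos_of_ne_zero (NeZero.ne h)
  have hc : Fintype.card (Bd h) = 4 * h + 2 := by
    simp; omega
  let e := Fintype.equivFinOfCardEq hc
  let g : Bd h → ZZ h := fun b => ((2 * ((e b).val + 1) : ℕ) : ZZ h)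
  have hg : Function.Injective g := by
    intro a b hab
    have := cast_inj (by have := (e a).isLt; omega) (by have := (e b).isLt; omega) hab
    exact e.injective (Fin.ext (by omega))
  have hcard : Fintype.card (Gam h) = (Finset.univ : Finset (ZZ h)).card := by
    rw [Finset.card_univ, ZMod.card]
    simp [ZMod.card]; ring
  obtain ⟨Φ, hΦ⟩ := Finset.exists_equiv_extend_of_card_eq hcard
    (s := Finset.univ.image gam)
    (f := Function.extend gam (fun s => g (.inl s)) (fun _ => 0))
    (Finset.subset_univ _) (by
      intro a ha b hb hab
      simp only [Finset.coe_image, Finset.coe_univ, Set.image_univ, Set.mem_range] at ha hb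
      obtain ⟨a, rfl⟩ := ha
      obtain ⟨b, rfl⟩ := hb
      rw [gam_inj.extend_apply, gam_inj.extend_apply] at hab
      have := hg hab
      simp only [Sum.inl.injEq] at this
      rw [this])
  refine ⟨g, Φ.trans (Equiv.subtypeUnivEquiv (fun x => Finset.mem_univ x)), hg,
    fun b => ⟨(e b).val, (e b).isLt, rfl⟩, ?_⟩
  intro s
  have := hΦ (gam s) (by simp)
  rw [gam_inj.extend_apply] at this
  exact this

def eL {h : ℕ} (j : ZZ h) : Bd h → EE h
  | .inl s => .inr (.inr (j, .inr (.inl s)))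
  | .inr k => .inr (.inl (j, k))
def eR {h : ℕ} (j : ZZ h) : Bd h → EE h
  | .inl s => .inr (.inr (j, .inr (.inr (s.1, !s.2))))
  | .inr k => .inr (.inl (j, k))

def col {h : ℕ} [NeZero h] (g : Bd h → ZZ h) (Φ : Gam h ≃ ZZ h) : EE h → ZZ h
  | .inl i => i
  | .inr (.inl (j, k)) => j + g (.inr k)
  | .inr (.inr (j, e)) => j + Φ (cc0 e)

def inc {h : ℕ} (v : VV h) (e : EE h) : Prop := (gends e).1 = v ∨ (gends e).2 = v

lemma inc_none {h : ℕ} (e : EE h) (he : inc none e) : ∃ i, e = .inl i := by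
  rcases e with i | ⟨j, k⟩ | ⟨j, (k | t) | (s | s)⟩
  · exact ⟨i, rfl⟩
  all_goals simp [inc, gends, cends, ring, gad] at he

lemma inc_ring {h : ℕ} (i : ZZ h) (e : EE h) (he : inc (ring i) e) :
    e = .inl i ∨ (∃ b, e = eL i b) ∨ ∃ j b, j + 1 = i ∧ e = eR j b := by
  rcases e with i' | ⟨j, k⟩ | ⟨j, (k | t) | (s | s)⟩
  · left
    simpa [inc, gends, ring] using he
  · right
    simp only [inc, gends, ring_inj] at he
    rcases he with rfl | he
    · left; exact ⟨.inr k, rfl⟩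
    · right; exact ⟨j, .inr k, he, rfl⟩
  · simp [inc, gends, cends, ring, gad] at he
  · simp [inc, gends, cends, ring, gad] at he
  · right; left
    simp only [inc, gends, cends, ring_inj, gad_ne_ring, or_false] at he
    subst he
    exact ⟨.inl s, rfl⟩
  · right; right
    simp only [inc, gends, cends, ring_inj, gad_ne_ring, false_or] at he
    exact ⟨j, .inl (s.1, !s.2), he, by simp [eR]⟩

lemma inc_gad {h : ℕ} (j : ZZ h) (u : U h) (e : EE h) (he : inc (gad j u) e) :
    ∃ c, e = .inr (.inr (j, c)) ∧ cinc u c := by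
  rcases e with i' | ⟨j', k⟩ | ⟨j', (k | t) | (s | s)⟩
  · simp [inc, gends, ring, gad] at he
  · simp [inc, gends, ring, gad] at he
  · simp only [inc, gends, cends, gad_inj] at he
    rcases he with ⟨rfl, he⟩ | ⟨rfl, he⟩
    · exact ⟨_, rfl, he ▸ Sym2.out_fst_mem _⟩
    · exact ⟨_, rfl, he ▸ Sym2.out_snd_mem _⟩
  · simp only [inc, gends, cends, gad_inj] at he
    rcases he with ⟨rfl, he⟩ | ⟨rfl, he⟩
    · exact ⟨_, rfl, Or.inl he.symm⟩
    · exact ⟨_, rfl, Or.inr he.symm⟩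
  · simp only [inc, gends, cends, gad_inj, ring_ne_gad, false_or] at he
    obtain ⟨rfl, he⟩ := he
    exact ⟨_, rfl, he.symm⟩
  · simp only [inc, gends, cends, gad_inj, ring_ne_gad, or_false] at he
    obtain ⟨rfl, he⟩ := he
    exact ⟨_, rfl, he.symm⟩

lemma col_proper {h : ℕ} [NeZero h] (g : Bd h → ZZ h) (Φ : Gam h ≃ ZZ h)
    (hg : Function.Injective g) (hD : ∀ b, InD (g b)) (hΦ : ∀ s, Φ (gam s) = g (.inl s))
    (v : VV h) (e e' : EE h) (he : inc v e) (he' : inc v e')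
    (hc : col g Φ e = col g Φ e') : e = e' := by
  have cL : ∀ j b, col g Φ (eL j b) = j + g b := by
    rintro j (s | k)
    · simp [eL, col, cc0, hΦ]
    · rfl
  have cR : ∀ j b, col g Φ (eR j b) = j + g b := by
    rintro j (s | k)
    · simp [eR, col, cc0, hΦ]
    · rfl
  rcases v with _ | i | ⟨j, u⟩
  · obtain ⟨i, rfl⟩ := inc_none e he
    obtain ⟨i', rfl⟩ := inc_none e' he'
    have : i = i' := hc
    rw [this]
  · rcases inc_ring i e he with rfl | ⟨b, rfl⟩ | ⟨j, b, rfl, rfl⟩ <;>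
    rcases inc_ring _ e' he' with rfl | ⟨b', rfl⟩ | ⟨j', b', hj', rfl⟩
    · rfl
    · rw [cL] at hc
      exact absurd (by simpa [col] using hc) (hD b').ne_zero
    · rw [cR, ← hj'] at hc
      simp only [col, add_right_inj] at hc
      exact absurd hc.symm (hD b').ne_one
    · rw [cL] at hc
      exact absurd (by simpa [col] using hc) (hD b).ne_zero
    · rw [cL, cL] at hc
      rw [hg (add_left_cancel hc)]
    · rw [cL, cR, ← hj', add_assoc] at hc
      have := add_left_cancel hc
      rw [add_comm] at this
      exact absurd this.symm ((hD b').ne_succ (hD b))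
    · rw [cR] at hc
      simp only [col, add_right_inj] at hc
      exact absurd hc (hD b).ne_one
    · rw [cR, cL, add_assoc] at hc
      have := add_left_cancel hc
      rw [add_comm] at this
      exact absurd this ((hD b).ne_succ (hD b'))
    · have hj : j' = j := add_right_cancel hj'
      subst hj
      rw [cR, cR] at hc
      rw [hg (add_left_cancel hc)]
  · obtain ⟨c, rfl, h1⟩ := inc_gad j u e he
    obtain ⟨c', rfl, h2⟩ := inc_gad j u e' he'
    have h3 : cc0 c = cc0 c' := Φ.injective (add_left_cancel hc)
    rw [cc0_proper u c c' h1 h2 h3]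

lemma card_U (h : ℕ) : Fintype.card (U h) = 8 * h + 4 := by
  simp; ring

lemma card_KE (h : ℕ) : Fintype.card (KE h) = (4 * h + 2) * (8 * h + 3) := by
  rw [Sym2.card_subtype_not_diag, card_U, Nat.choose_two_right]
  have : (8 * h + 4) * (8 * h + 4 - 1) = 2 * ((4 * h + 2) * (8 * h + 3)) := by
    rw [show 8 * h + 4 - 1 = 8 * h + 3 from rfl]; ring
  rw [this]; simp

lemma card_VV (h : ℕ) : Fintype.card (VV h) = (8 * h + 5) * (8 * h + 5) + 1 := by
  rw [Fintype.card_option, Fintype.card_sum, Fintype.card_prod, card_U, ZMod.card]; ring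

lemma card_EE (h : ℕ) (hpos : 1 ≤ h) : 2 * Fintype.card (EE h) = (8 * h + 5) * Fintype.card (VV h) := by
  rw [card_VV]
  obtain ⟨k, rfl⟩ : ∃ k, h = k + 1 := ⟨h - 1, by omega⟩
  rw [Fintype.card_sum, Fintype.card_sum, Fintype.card_prod, Fintype.card_prod, Fintype.card_sum,
    Fintype.card_sum, Fintype.card_sum, card_KE, ZMod.card, Fintype.card_fin]
  rw [show 2 * (k + 1) - 2 = 2 * k by omega]
  simp only [Fintype.card_prod, Fintype.card_sum, Fintype.card_fin, Fintype.card_bool]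
  ring

noncomputable instance (h : ℕ) : Fintype (GG h).V := inferInstanceAs (Fintype (VV h))
noncomputable instance (h : ℕ) : Fintype (GG h).E := inferInstanceAs (Fintype (EE h))

lemma GG_class1 (h : ℕ) (hpos : 1 ≤ h) : (GG h).IsRegular (8 * h + 5) ∧ (GG h).IsClass1 := by
  have : NeZero h := ⟨by omega⟩
  obtain ⟨g, Φ, hg, hD, hΦ⟩ := exists_colors h
  exact class1_of (G := GG h) (Z := ZZ h) (8 * h + 5) (ZMod.card _) (col g Φ)
    (fun v e e' he he' hc => col_proper g Φ hg hD hΦ v e e' he he' hc)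
    (card_EE h hpos) (none : VV h)

/-- signed incidence of the edge `e` with the vertex set `X` -/
noncomputable def xx {G : Multigraph} (X : G.V → Prop) (e : G.E) : ℤ :=
  open Classical in (if X (G.tail e) then 1 else 0) - (if X (G.head e) then 1 else 0)

noncomputable def cutc (G : Multigraph) [Fintype G.E] (X : G.V → Prop) : ℤ :=
  open Classical in ∑ e : G.E, if (X (G.tail e) ↔ X (G.head e)) then 0 else 1

lemma cutc_eq {G : Multigraph} [Fintype G.E] (X : G.V → Prop) :
    cutc G X = ∑ e : G.E, |xx X e| := by
  unfold cutc
  apply Finset.sum_congr rfl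
  intro e _
  unfold xx
  by_cases h1 : X (G.tail e) <;> by_cases h2 : X (G.head e) <;> simp [h1, h2]

lemma xx_sum {G : Multigraph} [Fintype G.V] (X : Finset G.V) (e : G.E) :
    xx (fun v => v ∈ X) e = ∑ v ∈ X, xx (fun w => w = v) e := by
  classical
  unfold xx
  rw [Finset.sum_sub_distrib, Finset.sum_ite_eq, Finset.sum_ite_eq]
  congr

lemma flow_zero {G : Multigraph} [Fintype G.V] [Fintype G.E] {r : ℝ} {f : G.E → ℝ}
    (hf : G.IsNZFlow r f) (X : Finset G.V) :
    ∑ e, f e * (xx (fun v => v ∈ X) e : ℝ) = 0 := by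
  classical
  simp_rw [xx_sum]
  push_cast
  simp_rw [Finset.mul_sum]
  rw [Finset.sum_comm]
  apply Finset.sum_eq_zero
  intro v _
  have := hf.2 v
  rw [finsum_mem_def, finsum_mem_def, finsum_eq_sum_of_fintype, finsum_eq_sum_of_fintype] at this
  rw [← sub_eq_zero, ← Finset.sum_sub_distrib] at this
  rw [← this]
  apply Finset.sum_congr rfl
  intro e _
  unfold xx
  simp only [Set.indicator, Set.mem_ofPred_eq]
  by_cases h1 : G.tail e = v <;> by_cases h2 : G.head e = v <;> simp [h1, h2]

lemma xx_cases {G : Multigraph} (X : G.V → Prop) (e : G.E) :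
    xx X e = 1 ∨ xx X e = 0 ∨ xx X e = -1 := by
  unfold xx
  by_cases h1 : X (G.tail e) <;> by_cases h2 : X (G.head e) <;> simp [h1, h2]

lemma edge_bound (M a : ℝ) (y : ℤ) (h1 : 1 ≤ a) (h2 : a ≤ M) (hy : y = 1 ∨ y = 0 ∨ y = -1) :
    (1 + M) * (y : ℝ) - (M - 1) * ((|y| : ℤ) : ℝ) ≤ 2 * (a * y) := by
  rcases hy with rfl | rfl | rfl <;> norm_num <;> linarith

lemma int_conc (p N c E : ℕ) (hp : 1 ≤ p) (M : ℝ) (hNc : N ≤ c) (hcE : c ≤ E)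
    (hM : M < 1 + 1 / (p : ℝ) + 1 / ((p : ℝ) * (2 * E + 1)))
    (h : (1 + M) * (N : ℝ) ≤ (M - 1) * c) : (2 * p + 1) * N ≤ c := by
  have hp' : (1 : ℝ) ≤ p := by exact_mod_cast hp
  have hN' : (N : ℝ) ≤ c := by exact_mod_cast hNc
  have hc' : (c : ℝ) ≤ E := by exact_mod_cast hcE
  have hN0 : (0 : ℝ) ≤ N := by positivity
  have hE0 : (0 : ℝ) < 2 * E + 1 := by positivity
  have h1 : 2 * (N : ℝ) ≤ (M - 1) * (c - N) := by linarith
  have h2 : (M - 1) * (c - N) ≤ (1 / (p : ℝ) + 1 / ((p : ℝ) * (2 * E + 1))) * (c - N) :=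
    mul_le_mul_of_nonneg_right (by linarith) (by linarith)
  have h3 : p * (2 * (N : ℝ)) ≤ p * ((1 / (p : ℝ) + 1 / ((p : ℝ) * (2 * E + 1))) * (c - N)) :=
    mul_le_mul_of_nonneg_left (h1.trans h2) (by linarith)
  have h4 : p * ((1 / (p : ℝ) + 1 / ((p : ℝ) * (2 * E + 1))) * (c - N))
      = (c - N) + (c - N) / (2 * E + 1) := by
    field_simp
  have h5 : ((c : ℝ) - N) / (2 * E + 1) < 1 := by
    rw [div_lt_one hE0]; linarith
  have h6 : (((2 * p + 1) * N : ℕ) : ℝ) < ((c + 1 : ℕ) : ℝ) := by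
    push_cast; linarith
  have := Nat.cast_lt.1 h6
  omega

lemma flow_cut {G : Multigraph} [Fintype G.V] [Fintype G.E] (p : ℕ) (hp : 1 ≤ p) (r : ℝ)
    (f : G.E → ℝ) (hf : G.IsNZFlow r f)
    (hr : r < 2 + 1 / (p : ℝ) + 1 / ((p : ℝ) * (2 * (Fintype.card G.E : ℝ) + 1))) :
    ∃ σ : G.E → ℤ, (∀ e, σ e = 1 ∨ σ e = -1) ∧ ∀ X : Finset G.V,
      (2 * (p : ℤ) + 1) * |∑ e, σ e * xx (fun v => v ∈ X) e| ≤ cutc G (fun v => v ∈ X) := by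
  classical
  have hσ : ∀ e, ∃ s : ℤ, (s = 1 ∨ s = -1) ∧ f e = |f e| * s := by
    intro e
    rcases abs_cases (f e) with h | h
    · exact ⟨1, Or.inl rfl, by rw [h.1]; simp⟩
    · exact ⟨-1, Or.inr rfl, by rw [h.1]; simp⟩
  choose σ h1 h2 using hσ
  have main : ∀ (τ : G.E → ℤ), (∀ e, τ e = 1 ∨ τ e = -1) →
      ∀ X : Finset G.V, (∑ e, |f e| * ((τ e * xx (fun v => v ∈ X) e : ℤ) : ℝ) = 0) →
      (2 * (p : ℤ) + 1) * (∑ e, τ e * xx (fun v => v ∈ X) e) ≤ cutc G (fun v => v ∈ X) := by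
    intro τ hτ X h0
    have hy : ∀ e, τ e * xx (fun v => v ∈ X) e = 1 ∨ τ e * xx (fun v => v ∈ X) e = 0 ∨
        τ e * xx (fun v => v ∈ X) e = -1 := by
      intro e
      rcases hτ e with h | h <;> rcases xx_cases (fun v => v ∈ X) e with h' | h' | h' <;>
        rw [h, h'] <;> simp
    have habs : ∀ e, |τ e * xx (fun v => v ∈ X) e| = |xx (fun v => v ∈ X) e| := by
      intro e
      rcases hτ e with h | h <;> rw [h] <;> simp
    rw [cutc_eq]
    set y : G.E → ℤ := fun e => τ e * xx (fun v => v ∈ X) e with hydef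
    have hc : ∑ e, |xx (fun v => v ∈ X) e| = ∑ e, |y e| :=
      Finset.sum_congr rfl fun e _ => (habs e).symm
    rw [hc]
    have hsum : (1 + (r - 1)) * ((∑ e, y e : ℤ) : ℝ) - ((r - 1) - 1) * ((∑ e, |y e| : ℤ) : ℝ) ≤ 0 := by
      have : ∑ e, ((1 + (r - 1)) * (y e : ℝ) - ((r - 1) - 1) * ((|y e| : ℤ) : ℝ)) ≤
          ∑ e, 2 * (|f e| * (y e : ℝ)) :=
        Finset.sum_le_sum fun e _ => edge_bound (r - 1) |f e| (y e) (hf.1 e).1 (hf.1 e).2 (hy e)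
      rw [← Finset.mul_sum, h0, Finset.sum_sub_distrib, ← Finset.mul_sum, ← Finset.mul_sum] at this
      push_cast at this ⊢
      linarith
    by_cases hneg : ∑ e, y e ≤ 0
    · have : 0 ≤ ∑ e, |y e| := Finset.sum_nonneg fun e _ => abs_nonneg _
      nlinarith
    · have hNc : ∑ e, y e ≤ ∑ e, |y e| := Finset.sum_le_sum fun e _ => le_abs_self _
      have hcE : ∑ e, |y e| ≤ (Fintype.card G.E : ℤ) := by
        calc ∑ e, |y e| ≤ ∑ _e : G.E, (1 : ℤ) := by
              apply Finset.sum_le_sum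
              intro e _
              rcases hy e with h | h | h <;> simp only [hydef, h] <;> norm_num
          _ = _ := by simp
      obtain ⟨N, hN⟩ := Int.eq_ofNat_of_zero_le (show 0 ≤ ∑ e, y e by omega)
      obtain ⟨c, hc⟩ := Int.eq_ofNat_of_zero_le (show 0 ≤ ∑ e, |y e| by omega)
      rw [hN, hc] at hsum hNc
      rw [hc] at hcE
      rw [hN, hc]
      have := int_conc p N c (Fintype.card G.E) hp (r - 1) (by exact_mod_cast hNc)
        (by exact_mod_cast hcE) (by linarith) (by push_cast at hsum; linarith)
      exact_mod_cast this
  refine ⟨σ, h1, fun X => ?_⟩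
  have hz := flow_zero hf X
  have hz1 : ∑ e, |f e| * ((σ e * xx (fun v => v ∈ X) e : ℤ) : ℝ) = 0 := by
    rw [← hz]
    apply Finset.sum_congr rfl
    intro e _
    nth_rewrite 2 [h2 e]
    push_cast; ring
  rcases abs_cases (∑ e, σ e * xx (fun v => v ∈ X) e) with h | h
  · rw [h.1]
    exact main σ h1 X hz1
  · rw [h.1]
    have := main (fun e => - σ e) (fun e => by rcases h1 e with h | h <;> simp [h]) X (by
      rw [← neg_zero, ← hz1, ← Finset.sum_neg_distrib]
      apply Finset.sum_congr rfl
      intro e _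
      push_cast; ring)
    simpa [neg_mul, Finset.sum_neg_distrib] using this

/-- The net-outdegree potential extracted from a flow. -/
lemma flow_delta {G : Multigraph} [Fintype G.V] [Fintype G.E] (p : ℕ) (hp : 1 ≤ p) (r : ℝ)
    (f : G.E → ℝ) (hf : G.IsNZFlow r f)
    (hr : r < 2 + 1 / (p : ℝ) + 1 / ((p : ℝ) * (2 * (Fintype.card G.E : ℝ) + 1)))
    (hreg : G.IsRegular (4 * p + 1)) :
    ∃ δ : G.V → ℤ, (∀ v, δ v = 1 ∨ δ v = -1) ∧ ∀ (X : G.V → Prop) [DecidablePred X],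
      (2 * (p : ℤ) + 1) * |∑ v ∈ Finset.univ.filter X, δ v| ≤ cutc G X := by
  classical
  obtain ⟨σ, hσ, hX⟩ := flow_cut p hp r f hf hr
  have hsum : ∀ X : Finset G.V, ∑ v ∈ X, ∑ e, σ e * xx (fun w => w = v) e
      = ∑ e, σ e * xx (fun v => v ∈ X) e := by
    intro X
    rw [Finset.sum_comm]
    apply Finset.sum_congr rfl
    intro e _
    rw [xx_sum, Finset.mul_sum]
  refine ⟨fun v => ∑ e, σ e * xx (fun w => w = v) e, ?_, fun X _ => by
    rw [hsum]
    simpa using hX (Finset.univ.filter X)⟩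
  intro v
  have h1 := hX {v}
  rw [← hsum, Finset.sum_singleton] at h1
  have hcut : cutc G (fun w => w ∈ ({v} : Finset G.V)) = 4 * p + 1 := by
    have := hreg v
    unfold Multigraph.degree at this
    rw [Nat.card_eq_fintype_card, Fintype.card_subtype, Finset.card_filter] at this
    have h2 : ((4 * p + 1 : ℕ) : ℤ) = 4 * p + 1 := by push_cast; ring
    rw [← h2, ← this]
    unfold cutc
    push_cast
    apply Finset.sum_congr rfl
    intro e _
    have := G.no_loop e
    have h3 : G.tail e ≠ G.head e := this
    simp only [Finset.mem_singleton, Multigraph.Inc]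
    by_cases ha : G.tail e = v <;> by_cases hb : G.head e = v <;> simp [ha, hb]
    exact h3 (ha.trans hb.symm)
  rw [hcut] at h1
  have hpar : (2 : ℤ) ∣ (∑ e, σ e * xx (fun w => w = v) e) - (4 * p + 1) := by
    have hc2 : cutc G (fun w => w = v) = 4 * p + 1 := by simpa using hcut
    rw [← hc2, cutc_eq, ← Finset.sum_sub_distrib]
    apply Finset.dvd_sum
    intro e _
    rcases hσ e with h | h <;> rcases xx_cases (fun w => w = v) e with h' | h' | h' <;>
      rw [h, h'] <;> norm_num
  have h5 : |∑ e, σ e * xx (fun w => w = v) e| < 2 := by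
    by_contra hcon
    push Not at hcon
    nlinarith
  rw [abs_lt] at h5
  have : (∑ e, σ e * xx (fun w => w = v) e) ≠ 0 := by
    intro h0
    rw [h0] at hpar
    omega
  change (∑ e, σ e * xx (fun w => w = v) e) = 1 ∨ (∑ e, σ e * xx (fun w => w = v) e) = -1
  omega

noncomputable def ch (x y : Prop) : ℤ := open Classical in if (x ↔ y) then 0 else 1

lemma ch_self (x : Prop) : ch x x = 0 := by simp [ch]
lemma ch_le (x y : Prop) : ch x y ≤ 1 := by unfold ch; split_ifs <;> norm_num
lemma ch_nonneg (x y : Prop) : 0 ≤ ch x y := by unfold ch; split_ifs <;> norm_num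
lemma ch_ft : ch False True = 1 := by simp [ch]
lemma ch_tf : ch True False = 1 := by simp [ch]

/-- contribution of the core edges of one gadget -/
noncomputable def coreK {h : ℕ} (B : U h → Prop) : ℤ :=
  ∑ k : KE h, ch (B k.1.out.1) (B k.1.out.2)
noncomputable def coreT {h : ℕ} (B : U h → Prop) : ℤ :=
  ∑ t : TE h, ch (B (rho t.1.1 (t.2 + 1), t.1.2)) (B (rho t.1.1 (t.2 + 2), t.1.2))

lemma cut_formula {h : ℕ} (X : VV h → Prop) :
    cutc (GG h) X = ∑ i : ZZ h, ch (X none) (X (ring i)) +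
      ∑ j : ZZ h, (((2 * h - 2 : ℕ) : ℤ) * ch (X (ring j)) (X (ring (j + 1))) +
        (coreK (fun u => X (gad j u)) + coreT (fun u => X (gad j u)) +
          (∑ s : SI h × Bool, ch (X (ring j)) (X (gad j (stubV s))) +
           ∑ s : SI h × Bool, ch (X (gad j (stubV s))) (X (ring (j + 1)))))) := by
  have h1 : cutc (GG h) X = ∑ e : EE h, ch (X (gends e).1) (X (gends e).2) := rfl
  rw [h1, Fintype.sum_sum_type, Fintype.sum_sum_type, Fintype.sum_prod_type,
    Fintype.sum_prod_type, ← Finset.sum_add_distrib]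
  congr 1
  apply Finset.sum_congr rfl
  intro j _
  rw [Fintype.sum_sum_type, Fintype.sum_sum_type, Fintype.sum_sum_type]
  congr 1
  simp [gends]

lemma coreK_self {h : ℕ} (x : Prop) : coreK (h := h) (fun _ => x) = 0 := by
  simp [coreK, ch_self]
lemma coreT_self {h : ℕ} (x : Prop) : coreT (h := h) (fun _ => x) = 0 := by
  simp [coreT, ch_self]

lemma tri_le (a b c : Prop) : ch b c + ch c a + ch a b ≤ 2 := by
  unfold ch
  by_cases a <;> by_cases b <;> by_cases c <;> simp_all

lemma coreT_le {h : ℕ} (B : U h → Prop) : coreT B ≤ 4 * h := by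
  unfold coreT
  rw [Fintype.sum_prod_type]
  calc _ ≤ ∑ _x : Fin h × Bool, (2 : ℤ) := by
        apply Finset.sum_le_sum
        intro x _
        rw [Fin.sum_univ_three]
        exact tri_le (B (rho x.1 0, x.2)) (B (rho x.1 1, x.2)) (B (rho x.1 2, x.2))
    _ = 4 * h := by simp; ring

lemma coreK_le {h : ℕ} (B : U h → Prop) [DecidablePred B] :
    coreK B ≤ (Finset.univ.filter B).card * (Finset.univ.filter fun u => ¬ B u).card := by
  classical
  unfold coreK
  have h1 : (∑ k : KE h, ch (B k.1.out.1) (B k.1.out.2))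
      = ((Finset.univ.filter fun k : KE h => ¬ (B k.1.out.1 ↔ B k.1.out.2)).card : ℤ) := by
    rw [Finset.card_filter]
    push_cast
    apply Finset.sum_congr rfl
    intro k _
    unfold ch
    split_ifs <;> simp_all
  rw [h1]
  have h2 : (Finset.univ.filter fun k : KE h => ¬ (B k.1.out.1 ↔ B k.1.out.2)).card ≤
      ((Finset.univ.filter B) ×ˢ (Finset.univ.filter fun u => ¬ B u)).card := by
    apply Finset.card_le_card_of_injOn
      (fun k => if B k.1.out.1 then (k.1.out.1, k.1.out.2) else (k.1.out.2, k.1.out.1))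
    · intro k hk
      simp only [Finset.coe_filter, Finset.mem_univ, true_and, Set.mem_ofPred_eq] at hk
      simp only [Finset.coe_product, Finset.coe_filter, Finset.mem_univ, true_and, Set.mem_prod,
        Set.mem_ofPred_eq]
      split_ifs with hb
      · exact ⟨hb, by tauto⟩
      · exact ⟨by tauto, hb⟩
    · intro k _ k' _ hkk
      apply Subtype.ext
      rw [← out_eq k.1, ← out_eq k'.1]
      simp only at hkk
      split_ifs at hkk <;> simp only [Prod.mk.injEq] at hkk <;> simp [hkk.1, hkk.2, Sym2.eq_swap]
  rw [Finset.card_product] at h2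
  exact_mod_cast h2

lemma sum_filter_VV {h : ℕ} (X : VV h → Prop) [DecidablePred X] (δ : VV h → ℤ) (h0 : ¬ X none) :
    ∑ v ∈ Finset.univ.filter X, δ v = ∑ i : ZZ h, (if X (ring i) then δ (ring i) else 0) +
      ∑ j : ZZ h, ∑ u : U h, (if X (gad j u) then δ (gad j u) else 0) := by
  rw [Finset.sum_filter, Fintype.sum_option, if_neg h0, zero_add, Fintype.sum_sum_type,
    Fintype.sum_prod_type]
  rfl

lemma card_stub (h : ℕ) : Fintype.card (SI h × Bool) = 2 * h + 4 := by
  simp; ring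

def Good {h : ℕ} (δ : VV h → ℤ) : Prop :=
  (∀ v, δ v = 1 ∨ δ v = -1) ∧ ∀ (X : VV h → Prop) [DecidablePred X],
    (4 * (h : ℤ) + 3) * |∑ v ∈ Finset.univ.filter X, δ v| ≤ cutc (GG h) X

lemma Good.neg {h : ℕ} {δ : VV h → ℤ} (hδ : Good δ) : Good (fun v => - δ v) := by
  refine ⟨fun v => ?_, fun X _ => ?_⟩
  · rcases hδ.1 v with h | h <;> simp [h]
  · rw [Finset.sum_neg_distrib, abs_neg]
    exact hδ.2 X

lemma Good.gadget {h : ℕ} (hpos : 1 ≤ h) {δ : VV h → ℤ} (hδ : Good δ) (j : ZZ h) :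
    ∑ u : U h, δ (gad j u) = 0 := by
  classical
  let X : VV h → Prop := fun v => ∃ u, v = gad j u
  have hX0 : X none ↔ False := by simp [X, gad]
  have hXr : ∀ i, X (ring i) ↔ False := by intro i; simp [X, ring_ne_gad]
  have hXg : ∀ i u, X (gad i u) ↔ i = j := by intro i u; simp only [X, gad_inj, exists_and_left, exists_eq', and_true]
  have h1 := hδ.2 X
  rw [cut_formula] at h1
  simp only [hX0, hXr, hXg, ch_self, coreK_self, coreT_self] at h1
  have h2 := sum_filter_VV X δ (by simp [hX0])
  simp only [hXr, hXg, if_false, Finset.sum_const_zero, zero_add] at h2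
  rw [Finset.sum_eq_single j (by intro b _ hb; simp [hb]) (by simp)] at h2
  simp only [if_true] at h2
  have h3 : ∑ v ∈ Finset.univ.filter X, δ v = ∑ u : U h, δ (gad j u) := by
    rw [← h2]
  rw [h3] at h1
  simp only [mul_zero, Finset.sum_const_zero, zero_add, Finset.sum_const, Finset.card_univ,
    card_stub, nsmul_eq_mul] at h1
  rw [Finset.sum_eq_single j (by
    intro b _ hb
    simp only [hb, ch_self]
    simp) (by simp)] at h1
  simp only [ch_ft, ch_tf, mul_one] at h1
  push_cast at h1
  have hpar : (2 : ℤ) ∣ ∑ u : U h, δ (gad j u) := by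
    have : (2 : ℤ) ∣ ∑ u : U h, (δ (gad j u) - 1) := by
      apply Finset.dvd_sum
      intro u _
      rcases hδ.1 (gad j u) with h | h <;> rw [h] <;> norm_num
    rw [Finset.sum_sub_distrib, Finset.sum_const, Finset.card_univ, card_U] at this
    simp only [nsmul_eq_mul] at this
    push_cast at this
    omega
  have h5 : |∑ u : U h, δ (gad j u)| < 2 := by
    by_contra hcon
    push Not at hcon
    have : (1 : ℤ) ≤ h := by exact_mod_cast hpos
    nlinarith
  rw [abs_lt] at h5
  omega

lemma Good.half {h : ℕ} (hpos : 1 ≤ h) {δ : VV h → ℤ} (hδ : Good δ) (j : ZZ h) :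
    (Finset.univ.filter fun u : U h => δ (gad j u) = 1).card = 4 * h + 2 ∧
    (Finset.univ.filter fun u : U h => ¬ δ (gad j u) = 1).card = 4 * h + 2 := by
  have h1 := hδ.gadget hpos j
  have h2 := Finset.card_filter_add_card_filter_not (s := (Finset.univ : Finset (U h)))
    (fun u : U h => δ (gad j u) = 1)
  rw [Finset.card_univ, card_U] at h2
  have h3 : ∑ u : U h, (δ (gad j u) + 1) =
      ∑ u : U h, 2 * (if δ (gad j u) = 1 then (1 : ℤ) else 0) := by
    apply Finset.sum_congr rfl
    intro u _
    rcases hδ.1 (gad j u) with h | h <;> rw [h] <;> norm_num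
  rw [Finset.sum_add_distrib, h1, ← Finset.mul_sum, Finset.sum_const, Finset.card_univ,
    card_U, ← Finset.natCast_card_filter] at h3
  simp only [nsmul_eq_mul] at h3
  push_cast at h3
  omega

lemma znat {h : ℕ} (j : ZZ h) {a b : ℕ} (ha : a < 8 * h + 5) (hb : b < 8 * h + 5) (hab : a ≠ b) :
    j + (a : ZZ h) ≠ j + (b : ZZ h) := fun e => zcast_ne ha hb hab (add_left_cancel e)

lemma no_pair {h : ℕ} (hpos : 1 ≤ h) {δ : VV h → ℤ} (hδ : Good δ) (j : ZZ h)
    (ha : δ (ring (j + 1)) = 1) (hb : δ (ring (j + 2)) = 1) : False := by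
  classical
  have n01 : j ≠ j + 1 := by
    simpa using znat j (a := 0) (b := 1) (by omega) (by omega) (by omega)
  have n02 : j ≠ j + 2 := by
    simpa using znat j (a := 0) (b := 2) (by omega) (by omega) (by omega)
  have n12 : j + 1 ≠ j + 2 := by
    simpa using znat j (a := 1) (b := 2) (by omega) (by omega) (by omega)
  have n13 : j + 1 ≠ j + 3 := by
    simpa using znat j (a := 1) (b := 3) (by omega) (by omega) (by omega)
  have n23 : j + 2 ≠ j + 3 := by
    simpa using znat j (a := 2) (b := 3) (by omega) (by omega) (by omega)
  have e2 : j + 1 + 1 = j + 2 := by ring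
  have e3 : j + 2 + 1 = j + 3 := by ring
  let X : VV h → Prop := fun v => v = ring (j + 1) ∨ v = ring (j + 2) ∨ (∃ u, v = gad (j + 1) u) ∨
    ∃ u, v = gad j u ∧ δ (gad j u) = 1
  have hX0 : X none ↔ False := by simp [X, gad, ring]
  have hXr : ∀ i, X (ring i) ↔ (i = j + 1 ∨ i = j + 2) := by
    intro i; simp [X, ring_ne_gad, ring_inj]
  have hXg : ∀ i u, X (gad i u) ↔ (i = j + 1 ∨ (i = j ∧ δ (gad j u) = 1)) := by
    intro i u
    simp only [X, gad_ne_ring, gad_inj, false_or]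
    constructor
    · rintro (⟨u', h1, -⟩ | ⟨u', ⟨h1, rfl⟩, h2⟩)
      · exact Or.inl h1
      · exact Or.inr ⟨h1, h2⟩
    · rintro (h1 | ⟨h1, h2⟩)
      · exact Or.inl ⟨u, h1, rfl⟩
      · exact Or.inr ⟨u, ⟨h1, rfl⟩, h2⟩
  have h1 := hδ.2 X
  have hsum : ∑ v ∈ Finset.univ.filter X, δ v = 4 * h + 4 := by
    have h2 := sum_filter_VV X δ (by simp [hX0])
    simp only [hXr, hXg] at h2
    have r1 : ∑ i : ZZ h, (if i = j + 1 ∨ i = j + 2 then δ (ring i) else 0) = 2 := by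
      have : ∀ i : ZZ h, (if i = j + 1 ∨ i = j + 2 then δ (ring i) else 0) =
          (if i = j + 1 then 1 else 0) + (if i = j + 2 then 1 else 0) := by
        intro i
        by_cases h1 : i = j + 1
        · subst h1; simp [ha, n12]
        · by_cases h2 : i = j + 2
          · subst h2; simp [hb, n12.symm]
          · simp [h1, h2]
      simp_rw [this]
      rw [Finset.sum_add_distrib]
      simp
    have r2 : ∑ i : ZZ h, ∑ u : U h,
        (if i = j + 1 ∨ (i = j ∧ δ (gad j u) = 1) then δ (gad i u) else 0) = 4 * h + 2 := by
      have : ∀ i : ZZ h, ∑ u : U h,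
          (if i = j + 1 ∨ (i = j ∧ δ (gad j u) = 1) then δ (gad i u) else 0) =
          (if i = j then (4 * h + 2 : ℤ) else 0) := by
        intro i
        by_cases h1 : i = j + 1
        · subst h1
          simp only [true_or, if_true, n01.symm, if_false]
          exact hδ.gadget hpos _
        · by_cases h2 : i = j
          · subst h2
            simp only [n01, true_and, false_or, if_true]
            have : ∀ u : U h, (if δ (gad i u) = 1 then δ (gad i u) else 0) =
                (if δ (gad i u) = 1 then (1 : ℤ) else 0) := by
              intro u; split_ifs with hh
              · exact hh
              · rfl
            simp_rw [this]
            rw [← Finset.natCast_card_filter, (hδ.half hpos i).1]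
            push_cast; ring
          · simp [h1, h2]
      simp_rw [this]
      simp
    have h3 : ∑ v ∈ Finset.univ.filter X, δ v = 2 + (4 * h + 2) := by
      rw [r1, r2] at h2
      exact h2
    rw [h3]; ring
  have hcut : cutc (GG h) X ≤ 16 * h ^ 2 + 28 * h + 10 := by
    rw [cut_formula]
    simp only [hX0, hXr, hXg]
    have s1 : ∑ i : ZZ h, ch False (i = j + 1 ∨ i = j + 2) ≤ 2 := by
      calc _ ≤ ∑ i : ZZ h, ((if i = j + 1 then (1 : ℤ) else 0) + (if i = j + 2 then 1 else 0)) := by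
            apply Finset.sum_le_sum
            intro i _
            have := ch_le False (i = j + 1 ∨ i = j + 2)
            by_cases h1 : i = j + 1
            · rw [if_pos h1]; split_ifs <;> linarith
            · by_cases h2 : i = j + 2
              · rw [if_pos h2, if_neg h1]; linarith
              · simp [h1, h2, ch]
        _ = 2 := by rw [Finset.sum_add_distrib]; simp
    have s2 : ∑ i : ZZ h, (((2 * h - 2 : ℕ) : ℤ) *
          ch (i = j + 1 ∨ i = j + 2) (i + 1 = j + 1 ∨ i + 1 = j + 2) +
        (coreK (h := h) (fun u => (i = j + 1 ∨ (i = j ∧ δ (gad j u) = 1))) +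
          coreT (h := h) (fun u => (i = j + 1 ∨ (i = j ∧ δ (gad j u) = 1))) +
          (∑ s : SI h × Bool, ch (i = j + 1 ∨ i = j + 2)
              (i = j + 1 ∨ (i = j ∧ δ (gad j (stubV s)) = 1)) +
           ∑ s : SI h × Bool, ch (i = j + 1 ∨ (i = j ∧ δ (gad j (stubV s)) = 1))
              (i + 1 = j + 1 ∨ i + 1 = j + 2)))) ≤
        ∑ i : ZZ h, ((if i = j then ((2 * h - 2 : ℤ) + ((4 * h + 2) * (4 * h + 2) + 4 * h
            + (2 * h + 4))) else 0) +
          (if i = j + 2 then ((2 * h - 2 : ℤ) + (2 * h + 4)) else 0)) := by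
      apply Finset.sum_le_sum
      intro i _
      have hc : ((2 * h - 2 : ℕ) : ℤ) = 2 * h - 2 := by omega
      rw [hc]
      by_cases i0 : i = j
      · subst i0
        have k1 : coreK (h := h) (fun u => δ (gad i u) = 1) ≤ (4 * h + 2) * (4 * h + 2) := by
          have := coreK_le (h := h) (fun u => δ (gad i u) = 1)
          rw [(hδ.half hpos i).1, (hδ.half hpos i).2] at this
          push_cast at this
          exact this
        have k2 := coreT_le (h := h) (fun u => δ (gad i u) = 1)
        have k3 : ∑ s : SI h × Bool, ch False (δ (gad i (stubV s)) = 1) +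
           ∑ s : SI h × Bool, ch (δ (gad i (stubV s)) = 1) True = 2 * h + 4 := by
          rw [← Finset.sum_add_distrib]
          have : ∀ s : SI h × Bool, ch False (δ (gad i (stubV s)) = 1) +
              ch (δ (gad i (stubV s)) = 1) True = 1 := by
            intro s
            by_cases hs : δ (gad i (stubV s)) = 1 <;> simp [ch, hs]
          simp_rw [this]
          rw [Finset.sum_const, Finset.card_univ, card_stub]
          simp
        simp only [n01, n02, or_self, true_and, false_or, true_or, if_true, if_false, ch_ft]
        linarith
      · by_cases i1 : i = j + 1
        · subst i1
          simp [n01.symm, n12, e2, ch_self, coreK_self, coreT_self]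
        · by_cases i2 : i = j + 2
          · subst i2
            simp [n02.symm, n12.symm, e3, n13.symm, n23.symm, ch_self, ch_tf, coreK_self,
              coreT_self]
            linarith
          · have i3 : ¬ i + 1 = j + 1 := fun e => i0 (add_right_cancel e)
            have i4 : ¬ i + 1 = j + 2 := fun e => i1 (add_right_cancel (e.trans e2.symm))
            simp [i0, i1, i2, i4, ch_self, coreK_self, coreT_self]
    have s3 : ∑ i : ZZ h, ((if i = j then ((2 * h - 2 : ℤ) + ((4 * h + 2) * (4 * h + 2) + 4 * h
            + (2 * h + 4))) else 0) +
          (if i = j + 2 then ((2 * h - 2 : ℤ) + (2 * h + 4)) else 0)) =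
        16 * h ^ 2 + 28 * h + 8 := by
      rw [Finset.sum_add_distrib]
      simp only [Finset.sum_ite_eq', Finset.mem_univ, if_true]
      ring
    rw [s3] at s2
    linarith
  rw [hsum] at h1
  rw [abs_of_nonneg (by positivity)] at h1
  nlinarith

lemma exists_pair {h : ℕ} {δ : VV h → ℤ} (hδ : ∀ v, δ v = 1 ∨ δ v = -1) :
    ∃ i : ZZ h, δ (ring i) = δ (ring (i + 1)) := by
  by_contra hcon
  push Not at hcon
  have hflip : ∀ i : ZZ h, δ (ring (i + 1)) = - δ (ring i) := by
    intro i
    have := hcon i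
    rcases hδ (ring i) with h1 | h1 <;> rcases hδ (ring (i + 1)) with h2 | h2 <;> simp_all
  have hm : ∀ m : ℕ, δ (ring ((m : ℕ) : ZZ h)) = (-1) ^ m * δ (ring (0 : ZZ h)) := by
    intro m
    induction m with
    | zero => simp
    | succ m ih =>
      push_cast
      rw [hflip, ih]; ring
  have h1 := hm (8 * h + 5)
  rw [ZMod.natCast_self] at h1
  have h2 : (-1 : ℤ) ^ (8 * h + 5) = -1 := Odd.neg_one_pow ⟨4 * h + 2, by ring⟩
  rw [h2] at h1
  rcases hδ (ring (0 : ZZ h)) with h3 | h3 <;> omega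

lemma not_good {h : ℕ} (hpos : 1 ≤ h) {δ : VV h → ℤ} (hδ : Good δ) : False := by
  obtain ⟨i, hi⟩ := exists_pair hδ.1
  have e1 : i - 1 + 1 = i := by ring
  have e2 : i - 1 + 2 = i + 1 := by ring
  rcases hδ.1 (ring i) with h1 | h1
  · exact no_pair hpos hδ (i - 1) (by rw [e1, h1]) (by rw [e2, ← hi, h1])
  · exact no_pair hpos hδ.neg (i - 1) (by simp only [e1, h1]; norm_num)
      (by simp only [e2, ← hi, h1]; norm_num)

lemma GG_flow (h : ℕ) (hpos : 1 ≤ h) :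
    ((2 + 2 / (2 * ((2 * h + 1 : ℕ) : ℝ)) : ℝ) : EReal) < (GG h).flowNumber := by
  classical
  set p := 2 * h + 1 with hp
  have hp0 : (0 : ℝ) < p := by rw [hp]; positivity
  set r0 : ℝ := 2 + 1 / (p : ℝ) + 1 / ((p : ℝ) * (2 * (Fintype.card (GG h).E : ℝ) + 1)) with hr0
  have hlt : (2 + 2 / (2 * (p : ℝ)) : ℝ) < r0 := by
    have h1 : (2 : ℝ) / (2 * (p : ℝ)) = 1 / p := by field_simp
    have h2 : (0 : ℝ) < 1 / ((p : ℝ) * (2 * (Fintype.card (GG h).E : ℝ) + 1)) := by positivity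
    rw [h1, hr0]; linarith
  refine lt_of_lt_of_le (EReal.coe_lt_coe_iff.2 hlt) ?_
  unfold Multigraph.flowNumber
  apply le_sInf
  rintro x ⟨r, rfl, -, f, hf⟩
  rw [EReal.coe_le_coe_iff]
  by_contra hcon
  push Not at hcon
  have hreg : (GG h).IsRegular (4 * p + 1) := by
    have := (GG_class1 h hpos).1
    rwa [show 8 * h + 5 = 4 * p + 1 by omega] at this
  obtain ⟨δ, h1, h2⟩ := flow_delta p (by omega) r f hf hcon hreg
  apply not_good hpos (δ := δ)
  refine ⟨h1, fun X hX => ?_⟩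
  have h3 := @h2 X hX
  have h4 : (2 * (p : ℤ) + 1) = 4 * h + 3 := by rw [hp]; push_cast; ring
  rw [h4] at h3
  exact h3

end Ctr

/-- For every odd integer `p ≥ 3`, with `k = 2p`, there exists a
`(2k+1)`-regular class 1 multigraph `G` with `φ_c(G) > 2 + 2/k`.  (In particular
the conjecture that every `(2t+1)`-regular class 1 graph has circular flow
number at most `2 + 2/t` is false.) -/
theorem statement_5 (p : ℕ) (hp : 3 ≤ p) (hodd : Odd p) :
    ∃ G : Multigraph, G.IsRegular (2 * (2 * p) + 1) ∧ G.IsClass1 ∧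
      ((2 + 2 / (2 * (p : ℝ)) : ℝ) : EReal) < G.flowNumber := by
  obtain ⟨h, rfl⟩ := hodd
  have hpos : 1 ≤ h := by omega
  refine ⟨Ctr.GG h, ?_, (Ctr.GG_class1 h hpos).2, Ctr.GG_flow h hpos⟩
  have := (Ctr.GG_class1 h hpos).1
  rwa [show 8 * h + 5 = 2 * (2 * (2 * h + 1)) + 1 by ring] at this
end

section
/- For every odd integer p ≥ 3, setting k = 2p, there exists a (2k+1)-graph G with φ_c(G) > 2 + 2/k. In particular, the conjecture that every (2t+1)-graph has circular flow number at most 2 + 2/t is false. -/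
namespace Ring

open Finset

/-- The multigraph with prescribed multiplicities `m a b` for `a < b`. -/
noncomputable def mkG (V : Type) [Fintype V] [LinearOrder V] (m : V → V → ℕ) : Multigraph where
  V := V
  E := (q : {q : V × V // q.1 < q.2}) × Fin (m q.1.1 q.1.2)
  vFinite := inferInstance
  eFinite := inferInstance
  ends := fun e => e.1.1
  no_loop := fun e => ne_of_lt e.1.2

section generic
variable {V : Type} [Fintype V] [LinearOrder V] (m : V → V → ℕ)

noncomputable instance : Fintype (mkG V m).E :=
  inferInstanceAs (Fintype ((q : {q : V × V // q.1 < q.2}) × Fin (m q.1.1 q.1.2)))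

lemma sumE (F : (mkG V m).E → ℝ) :
    ∑ e, F e = ∑ a, ∑ b, if h : a < b then ∑ j : Fin (m a b), F ⟨⟨(a, b), h⟩, j⟩ else 0 := by
  have h1 : ∑ e, F e = ∑ q : {q : V × V // q.1 < q.2}, ∑ j : Fin (m q.1.1 q.1.2), F ⟨q, j⟩ :=
    Fintype.sum_sigma _
  rw [h1, ← Fintype.sum_prod_type']
  have h2 : ∀ q : V × V, (if h : q.1 < q.2 then ∑ j : Fin (m q.1 q.2), F ⟨⟨(q.1, q.2), h⟩, j⟩ else 0)
      = if h : q.1 < q.2 then (fun q : {q : V × V // q.1 < q.2} =>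
        ∑ j : Fin (m q.1.1 q.1.2), F ⟨q, j⟩) ⟨q, h⟩ else 0 := fun q => rfl
  simp_rw [h2]
  rw [← Finset.sum_filter_add_sum_filter_not univ (fun q : V × V => q.1 < q.2)]
  rw [Finset.sum_eq_zero (s := univ.filter (fun q : V × V => ¬ q.1 < q.2))]
  · rw [add_zero]
    rw [Finset.sum_subtype (p := fun q : V × V => q.1 < q.2) _ (by simp)]
    apply Finset.sum_congr rfl
    rintro ⟨q, hq⟩ _
    rw [dif_pos hq]
  · intro q hq
    rw [dif_neg (by simpa using hq)]

lemma half (H : V → V → ℝ) (hs : ∀ a b, H a b = H b a) (h0 : ∀ a, H a a = 0) :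
    2 * ∑ a, ∑ b, (if a < b then H a b else 0) = ∑ a, ∑ b, H a b := by
  have h1 : ∑ a, ∑ b, (if a < b then H a b else 0) = ∑ a, ∑ b, (if b < a then H a b else 0) := by
    rw [Finset.sum_comm]
    refine Finset.sum_congr rfl fun a _ => Finset.sum_congr rfl fun b _ => ?_
    rw [hs]
  rw [two_mul]
  nth_rewrite 2 [h1]
  rw [← Finset.sum_add_distrib]
  refine Finset.sum_congr rfl fun a _ => ?_
  rw [← Finset.sum_add_distrib]
  refine Finset.sum_congr rfl fun b _ => ?_
  rcases lt_trichotomy a b with h | h | h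
  · simp [h, h.le.not_gt]
  · subst h; simp [h0]
  · simp [h, h.le.not_gt]

lemma cardE (P : (mkG V m).E → Prop) (Q : V → V → Prop) [∀ a b, Decidable (Q a b)]
    (hPQ : ∀ e, P e ↔ Q ((mkG V m).tail e) ((mkG V m).head e))
    (hQ : ∀ a b, Q a b ↔ Q b a) (hm : ∀ a b, m a b = m b a) (h0 : ∀ a, m a a = 0) :
    2 * (Nat.card {e // P e} : ℝ) = ∑ a, ∑ b, if Q a b then (m a b : ℝ) else 0 := by
  classical
  have h1 : (Nat.card {e // P e} : ℝ) = ∑ e : (mkG V m).E, if P e then (1 : ℝ) else 0 := by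
    rw [Nat.card_eq_fintype_card, Fintype.card_subtype]
    simp
  rw [h1, sumE, ← half (fun a b => if Q a b then (m a b : ℝ) else 0)]
  · congr 1
    refine Finset.sum_congr rfl fun a _ => Finset.sum_congr rfl fun b _ => ?_
    by_cases h : a < b
    · rw [dif_pos h, if_pos h]
      have : ∀ j : Fin (m a b), (P ⟨⟨(a, b), h⟩, j⟩ ↔ Q a b) := fun j => hPQ _
      simp only [this]
      by_cases hq : Q a b <;> simp [hq]
    · rw [dif_neg h, if_neg h]
  · intro a b
    simp only [hm a b, hQ a b]
  · intro a; simp [h0]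

lemma degE (hm : ∀ a b, m a b = m b a) (h0 : ∀ a, m a a = 0) (v : V) :
    ((mkG V m).degree v : ℝ) = ∑ b, (m v b : ℝ) := by
  classical
  have h := cardE m (fun e => (mkG V m).Inc v e) (fun a b => a = v ∨ b = v) (fun e => Iff.rfl)
    (fun a b => or_comm) hm h0
  have h2 : ∑ a, ∑ b, (if a = v ∨ b = v then (m a b : ℝ) else 0)
      = ∑ a, ∑ b, ((if a = v then (m a b : ℝ) else 0) + if b = v then (m a b : ℝ) else 0) := by
    refine Finset.sum_congr rfl fun a _ => Finset.sum_congr rfl fun b _ => ?_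
    by_cases ha : a = v
    · by_cases hb : b = v
      · subst ha; subst hb; simp [h0]
      · simp [ha, hb]
    · simp [ha]
  have h3 : ∑ a, ∑ b, ((if a = v then (m a b : ℝ) else 0) + if b = v then (m a b : ℝ) else 0)
      = 2 * ∑ b, (m v b : ℝ) := by
    simp only [Finset.sum_add_distrib]
    rw [Finset.sum_comm]
    simp [hm _ v, two_mul]
  rw [h2, h3] at h
  unfold Multigraph.degree
  linarith

open Classical in
lemma cutE (hm : ∀ a b, m a b = m b a) (h0 : ∀ a, m a a = 0) (X : Set V) :
    2 * (((mkG V m).cut X).ncard : ℝ) = ∑ a, ∑ b, if ¬ (a ∈ X ↔ b ∈ X) then (m a b : ℝ) else 0 := by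
  have h := cardE m (fun e => e ∈ (mkG V m).cut X) (fun a b => ¬ (a ∈ X ↔ b ∈ X)) (fun e => Iff.rfl)
    (fun a b => by tauto) hm h0
  rw [← h]
  rfl

/-- sign -/
noncomputable def sg (x : ℝ) : ℤ := if 0 ≤ x then 1 else -1

lemma flowE {R : ℝ} (hR : 1 < R) (hf : (mkG V m).HasNZFlow (2 + 2 / (R - 1))) :
    ∃ (s : V → ℤ) (φ : V → V → ℝ), (∀ a b, φ a b = - φ b a) ∧ (∀ a b, m a b = m b a → |φ a b| ≤ m a b) ∧
      (∀ a, ∑ b, φ a b = R * s a) ∧ (∀ a, (∀ b, m a b = m b a) → m a a = 0 → Even (s a + ∑ b, (m a b : ℤ))) := by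
  classical
  obtain ⟨f, hf1, hf2⟩ := hf
  -- general net flow
  let net : ((mkG V m).E → ℝ) → V → V → ℝ := fun g a b =>
    (if h : a < b then ∑ j : Fin (m a b), g ⟨⟨(a, b), h⟩, j⟩ else 0)
      - (if h : b < a then ∑ j : Fin (m b a), g ⟨⟨(b, a), h⟩, j⟩ else 0)
  have hnet : ∀ g v, ∑ b, net g v b = ∑ e, ((if (mkG V m).tail e = v then g e else 0)
      - if (mkG V m).head e = v then g e else 0) := by
    intro g v
    have hA : ∑ e, (if (mkG V m).tail e = v then g e else 0)
        = ∑ b, (if h : v < b then ∑ j : Fin (m v b), g ⟨⟨(v, b), h⟩, j⟩ else 0) := by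
      rw [sumE, Finset.sum_eq_single v]
      · refine Finset.sum_congr rfl fun b _ => ?_
        simp [Multigraph.tail, mkG]
      · intro b _ hb
        refine Finset.sum_eq_zero fun a _ => ?_
        simp [Multigraph.tail, mkG, hb]
      · simp
    have hB : ∑ e, (if (mkG V m).head e = v then g e else 0)
        = ∑ b, (if h : b < v then ∑ j : Fin (m b v), g ⟨⟨(b, v), h⟩, j⟩ else 0) := by
      rw [sumE, Finset.sum_comm, Finset.sum_eq_single v]
      · refine Finset.sum_congr rfl fun b _ => ?_
        simp [Multigraph.head, mkG]
      · intro b _ hb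
        refine Finset.sum_eq_zero fun a _ => ?_
        simp [Multigraph.head, mkG, hb]
      · simp
    have hC : ∑ b, net g v b = ∑ e, (if (mkG V m).tail e = v then g e else 0)
        - ∑ e, (if (mkG V m).head e = v then g e else 0) := by
      rw [hA, hB]
      exact Finset.sum_sub_distrib _ _
    rw [hC]
    exact (Finset.sum_sub_distrib _ _).symm
  have hf0 : ∀ v, ∑ b, net f v b = 0 := by
    intro v
    rw [hnet, Finset.sum_sub_distrib]
    have h := hf2 v
    rw [finsum_mem_eq_finite_toFinset_sum _ (Set.toFinite _), finsum_mem_eq_finite_toFinset_sum _ (Set.toFinite _)] at h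
    rw [← Finset.sum_filter, ← Finset.sum_filter, sub_eq_zero]
    convert h using 2 <;> (ext; simp)
  let g : (mkG V m).E → ℝ := fun e => R * sg (f e) - (R - 1) * f e
  have hg : ∀ e, |g e| ≤ 1 := by
    intro e
    obtain ⟨h1, h2⟩ := hf1 e
    have h3 : (R - 1) * |f e| ≤ R + 1 := by
      have : (R - 1) * (2 + 2 / (R - 1) - 1) = R + 1 := by
        have : R - 1 ≠ 0 := by linarith
        field_simp; ring
      rw [← this]
      exact mul_le_mul_of_nonneg_left h2 (by linarith)
    have h4 : R - 1 ≤ (R - 1) * |f e| := by nlinarith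
    simp only [g, sg]
    rw [abs_le]
    split_ifs with h
    · rw [abs_of_nonneg h] at h3 h4
      push_cast
      constructor <;> linarith
    · rw [abs_of_neg (by linarith)] at h3 h4
      push_cast
      constructor <;> linarith
  let t : V → V → ℤ := fun a b =>
    (if h : a < b then ∑ j : Fin (m a b), sg (f ⟨⟨(a, b), h⟩, j⟩) else 0)
      - (if h : b < a then ∑ j : Fin (m b a), sg (f ⟨⟨(b, a), h⟩, j⟩) else 0)
  have hpar : ∀ x, Odd (sg x) := by
    intro x; unfold sg; split_ifs <;> decide
  have hsum : ∀ n (F : Fin n → ℝ), Even (∑ j, sg (F j) + (n : ℤ)) := by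
    intro n F
    have : ∑ j, sg (F j) + (n : ℤ) = ∑ j, (sg (F j) + 1) := by
      simp [Finset.sum_add_distrib]
    rw [this]
    exact Finset.even_sum _ fun j _ => (hpar _).add_odd odd_one
  refine ⟨fun a => ∑ b, t a b, net g, ?_, ?_, ?_, ?_⟩
  · intro a b; simp only [net]; ring
  · intro a b hm
    have key : ∀ n (F : Fin n → ℝ), (∀ j, |F j| ≤ 1) → |∑ j, F j| ≤ n := by
      intro n F hF
      refine (Finset.abs_sum_le_sum_abs _ _).trans ?_
      refine (Finset.sum_le_sum fun j _ => hF j).trans ?_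
      simp
    simp only [net]
    rcases lt_trichotomy a b with h | h | h
    · simp only [h, h.le.not_gt, dif_pos, dif_neg, not_false_eq_true, sub_zero]
      exact key _ _ fun j => hg _
    · subst h; simp
    · simp only [h, h.le.not_gt, dif_pos, dif_neg, not_false_eq_true, zero_sub, abs_neg]
      rw [hm]
      exact key _ _ fun j => hg _
  · intro a
    have h1 : ∀ b, net g a b = R * (t a b) - (R - 1) * net f a b := by
      intro b
      simp only [net, t, g]
      rcases lt_trichotomy a b with h | h | h
      · simp [h, h.le.not_gt, Finset.sum_sub_distrib, Finset.mul_sum]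
      · subst h; simp
      · simp [h, h.le.not_gt, Finset.sum_sub_distrib, Finset.mul_sum]
        ring
    simp only [h1, Finset.sum_sub_distrib, ← Finset.mul_sum, hf0]
    push_cast; ring
  · intro a hm h0
    rw [← Finset.sum_add_distrib]
    refine Finset.even_sum _ fun b _ => ?_
    simp only [t]
    rcases lt_trichotomy a b with h | h | h
    · simp only [h, h.le.not_gt, dif_pos, dif_neg, not_false_eq_true, sub_zero]
      exact hsum _ _
    · subst h; simp [h0]
    · simp only [h, h.le.not_gt, dif_pos, dif_neg, not_false_eq_true, zero_sub]
      rw [hm b]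
      have := hsum (m b a) (fun j => f ⟨⟨(b, a), h⟩, j⟩)
      rw [Int.even_add] at this ⊢
      rwa [even_neg]

end generic

section concrete
variable (p : ℕ)

/-- Vertices of a piece: the first component is `true` for the outer vertices. -/
abbrev Y : Type := Bool × (Bool × ZMod p)

/-- The vertices: the apex `w`, the ring vertices `c j`, the piece vertices `x i y`. -/
abbrev VV : Type := Unit ⊕ (ZMod (4 * p + 1) ⊕ (ZMod (4 * p + 1) × Y p))

variable {p}

/-- the apex -/
abbrev vw : VV p := Sum.inl ()
/-- ring vertex -/
abbrev vc (j : ZMod (4 * p + 1)) : VV p := Sum.inr (Sum.inl j)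
/-- piece vertex -/
abbrev vx (i : ZMod (4 * p + 1)) (y : Y p) : VV p := Sum.inr (Sum.inr (i, y))

/-- clique multiplicities -/
def mK (y y' : Y p) : ℕ := if y = y' then 0 else 1

/-- multiplicities of the two odd cycles -/
def mT (y y' : Y p) : ℕ :=
  if y.1 = false ∧ y'.1 = false ∧ y.2.1 = y'.2.1 then
    (if y'.2.2 = y.2.2 + 1 then 1 else 0) + (if y.2.2 = y'.2.2 + 1 then 1 else 0) else 0

/-- piece to ring multiplicities -/
def mC (i : ZMod (4 * p + 1)) (y : Y p) (j : ZMod (4 * p + 1)) : ℕ :=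
  if y.1 = true then (if j = i then 1 else 0) + (if j = i + 1 then 1 else 0) else 0

/-- multiplicities -/
def mm : VV p → VV p → ℕ
  | Sum.inl _, Sum.inl _ => 0
  | Sum.inl _, Sum.inr (Sum.inl _) => 1
  | Sum.inl _, Sum.inr (Sum.inr _) => 0
  | Sum.inr (Sum.inl _), Sum.inl _ => 1
  | Sum.inr (Sum.inl _), Sum.inr (Sum.inl _) => 0
  | Sum.inr (Sum.inl j), Sum.inr (Sum.inr q) => mC q.1 q.2 j
  | Sum.inr (Sum.inr _), Sum.inl _ => 0
  | Sum.inr (Sum.inr q), Sum.inr (Sum.inl j) => mC q.1 q.2 j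
  | Sum.inr (Sum.inr q), Sum.inr (Sum.inr q') =>
    if q.1 = q'.1 then mK q.2 q'.2 + mT q.2 q'.2 else 0

lemma mK_symm (y y' : Y p) : mK y y' = mK y' y := by
  unfold mK; simp only [eq_comm]

lemma mT_symm (y y' : Y p) : mT y y' = mT y' y := by
  have h : (y.1 = false ∧ y'.1 = false ∧ y.2.1 = y'.2.1) ↔ (y'.1 = false ∧ y.1 = false ∧ y'.2.1 = y.2.1) :=
    ⟨fun h => ⟨h.2.1, h.1, h.2.2.symm⟩, fun h => ⟨h.2.1, h.1, h.2.2.symm⟩⟩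
  unfold mT
  simp only [h]
  rw [add_comm]

lemma mm_symm (a b : VV p) : mm a b = mm b a := by
  rcases a with a | a | a <;> rcases b with b | b | b <;> simp only [mm]
  rw [mK_symm, mT_symm]
  simp only [eq_comm]

lemma mT_self (hp : 3 ≤ p) (y : Y p) : mT y y = 0 := by
  have : Fact (1 < p) := ⟨by omega⟩
  simp [mT]

lemma mm_self (hp : 3 ≤ p) (a : VV p) : mm a a = 0 := by
  rcases a with a | a | a <;> simp [mm, mT_self hp, mK]

variable [NeZero p]

lemma sumV (F : VV p → ℝ) : ∑ a, F a = F vw + (∑ j, F (vc j) + ∑ i, ∑ y, F (vx i y)) := by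
  rw [Fintype.sum_sum_type, Fintype.sum_sum_type, Fintype.sum_prod_type]
  simp

lemma sumT (F : Y p → Y p → ℝ) : ∑ y, ∑ y', (mT y y' : ℝ) * F y y' =
    ∑ b, ∑ x, (F (false, b, x) (false, b, x + 1) + F (false, b, x + 1) (false, b, x)) := by
  simp only [mT, Fintype.sum_prod_type, Fintype.sum_bool]
  simp [add_mul, Finset.sum_add_distrib]
  rw [Finset.sum_comm (f := fun x x' : ZMod p => if x = x' + 1 then F (false, true, x) (false, true, x') else 0)]
  rw [Finset.sum_comm (f := fun x x' : ZMod p => if x = x' + 1 then F (false, false, x) (false, false, x') else 0)]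
  simp

lemma sumT1 (y : Y p) : ∑ y', (mT y y' : ℝ) = if y.1 = true then 0 else 2 := by
  obtain ⟨a, b, x⟩ := y
  have : ∀ x' : ZMod p, (x = x' + 1) ↔ (x' = x - 1) := fun x' => by
    rw [eq_sub_iff_add_eq, eq_comm]
  cases a <;> cases b <;> simp [mT, Fintype.sum_prod_type, Finset.sum_add_distrib, this] <;> norm_num

lemma cardY : (Fintype.card (Y p) : ℝ) = 4 * p := by
  simp [Fintype.card_prod, ZMod.card]; ring

lemma sumK1 (y : Y p) : ∑ y', (mK y y' : ℝ) = 4 * p - 1 := by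
  have : ∀ y', (mK y y' : ℝ) = 1 - if y = y' then 1 else 0 := by
    intro y'; unfold mK; split_ifs <;> simp
  simp only [this, Finset.sum_sub_distrib]
  simp only [Finset.sum_const, Finset.card_univ, nsmul_eq_mul, cardY]
  simp

lemma sumC (i : ZMod (4 * p + 1)) (y : Y p) (F : ZMod (4 * p + 1) → ℝ) :
    ∑ j, (mC i y j : ℝ) * F j = if y.1 = true then F i + F (i + 1) else 0 := by
  unfold mC
  split_ifs <;> simp [add_mul, Finset.sum_add_distrib]

lemma sumC' (j : ZMod (4 * p + 1)) (F : ZMod (4 * p + 1) → Y p → ℝ) :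
    ∑ i, ∑ y, (mC i y j : ℝ) * F i y =
      ∑ z : Bool × ZMod p, F j (true, z) + ∑ z : Bool × ZMod p, F (j - 1) (true, z) := by
  have : ∀ i : ZMod (4 * p + 1), (j = i + 1) ↔ (i = j - 1) := fun x' => by
    rw [eq_sub_iff_add_eq, eq_comm]
  unfold mC
  rw [Finset.sum_comm, Fintype.sum_prod_type]
  simp only [Fintype.sum_bool]
  simp only [if_true, Bool.false_eq_true, if_false, Nat.cast_zero, zero_mul, Finset.sum_const_zero, add_zero]
  rw [← Finset.sum_add_distrib]
  refine Finset.sum_congr rfl fun z _ => ?_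
  simp [this, add_mul, Finset.sum_add_distrib]

lemma degV (a : VV p) : ∑ b, (mm a b : ℝ) = 4 * p + 1 := by
  rw [sumV]
  rcases a with a | j | ⟨i, y⟩
  · simp [mm]
  · simp only [mm]
    have h := sumC' j (fun _ _ => 1)
    simp only [mul_one] at h
    rw [h]
    simp; ring
  · simp only [mm]
    have h := sumC i y (fun _ => 1)
    simp only [mul_one] at h
    rw [h]
    have h2 : ∑ i', ∑ y', ((if i = i' then mK y y' + mT y y' else 0 : ℕ) : ℝ)
        = ∑ y', (mK y y' : ℝ) + ∑ y', (mT y y' : ℝ) := by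
      rw [Finset.sum_comm, ← Finset.sum_add_distrib]
      refine Finset.sum_congr rfl fun z _ => ?_
      simp
    rw [h2, sumK1, sumT1]
    split_ifs <;> simp <;> ring

lemma cyc {n : ℕ} (P : ZMod n → Prop) (hn : Odd n) (h : ∀ x, P (x + 1) ↔ ¬ P x) : False := by
  have key : ∀ k : ℕ, P (k : ZMod n) ↔ (Even k ↔ P 0) := by
    intro k
    induction k with
    | zero => simp
    | succ k ih =>
      push_cast
      rw [h, ih, Nat.even_add_one]
      tauto
  have := key n
  rw [ZMod.natCast_self] at this
  have h2 : ¬ Even n := Nat.not_even_iff_odd.2 hn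
  tauto

lemma cyc2 {n : ℕ} [NeZero n] (P : ZMod n → Prop) (h : ∀ x, P x → P (x + 1)) {a : ZMod n} (ha : P a) (b : ZMod n) :
    P b := by
  have key : ∀ k : ℕ, P (a + (k : ZMod n)) := by
    intro k
    induction k with
    | zero => simpa using ha
    | succ k ih =>
      push_cast
      rw [← add_assoc]
      exact h _ ih
  have := key (b - a).val
  rw [ZMod.natCast_zmod_val] at this
  simpa using this

/-- indicator of the outer vertices -/
def oo (y : Y p) : ℝ := if y.1 = true then 1 else 0

lemma sum_oo : ∑ y : Y p, oo y = 2 * p := by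
  simp only [oo, Fintype.sum_prod_type, Fintype.sum_bool]
  simp
  ring

lemma anti_sum (ψ : Y p → Y p → ℝ) (anti : ∀ a b, ψ a b = - ψ b a) : ∑ y, ∑ y', ψ y y' = 0 := by
  have h : ∑ y, ∑ y', ψ y y' = - ∑ y, ∑ y', ψ y y' := by
    conv_lhs => rw [Finset.sum_comm]
    rw [← Finset.sum_neg_distrib]
    refine Finset.sum_congr rfl fun a _ => ?_
    rw [← Finset.sum_neg_distrib]
    exact Finset.sum_congr rfl fun b _ => anti _ _
  linarith

lemma piece (hodd : Odd p) (s : Y p → ℝ) (hs : ∀ y, s y = 1 ∨ s y = -1) (ψ : Y p → Y p → ℝ)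
    (anti : ∀ a b, ψ a b = - ψ b a) (bd : ∀ a b, |ψ a b| ≤ mK a b + mT a b)
    (A B : Y p → ℝ) (hA : ∀ y, |A y| ≤ oo y) (hB : ∀ y, |B y| ≤ oo y) (R α : ℝ)
    (net : ∀ y, ∑ y', ψ y y' + A y + B y = R * s y) (sA : ∑ y, A y = - α) (sB : ∑ y, B y = α) :
    2 * p * R - 4 * p ^ 2 - 4 * p + 2 ≤ α := by
  have hss : ∀ y, s y * s y = 1 := fun y => by rcases hs y with h | h <;> rw [h] <;> norm_num
  have e1 : ∑ y, s y * (R * s y) = 4 * p * R := by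
    have : ∀ y, s y * (R * s y) = R := fun y => by linear_combination R * hss y
    simp only [this, Finset.sum_const, Finset.card_univ, nsmul_eq_mul, cardY]
  have e2 : ∑ y, s y * (R * s y) = ∑ y, ∑ y', s y * ψ y y' + ∑ y, s y * (A y + B y) := by
    rw [← Finset.sum_add_distrib]
    refine Finset.sum_congr rfl fun y _ => ?_
    rw [← net, ← Finset.mul_sum]; ring
  have e3 : 2 * ∑ y, ∑ y', s y * ψ y y' = ∑ y, ∑ y', (s y - s y') * ψ y y' := by
    have h : ∑ y, ∑ y', s y' * ψ y y' = - ∑ y, ∑ y', s y * ψ y y' := by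
      rw [Finset.sum_comm, ← Finset.sum_neg_distrib]
      refine Finset.sum_congr rfl fun a _ => ?_
      rw [← Finset.sum_neg_distrib]
      refine Finset.sum_congr rfl fun b _ => ?_
      rw [anti b a]; ring
    simp only [sub_mul, Finset.sum_sub_distrib, h]
    ring
  have e4 : ∑ y, ∑ y', (s y - s y') * ψ y y' ≤ ∑ y, ∑ y', ((1 - s y * s y') + (mT y y' : ℝ) * (1 - s y * s y')) := by
    refine Finset.sum_le_sum fun y _ => Finset.sum_le_sum fun y' _ => ?_
    have h1 : |s y - s y'| = 1 - s y * s y' := by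
      rcases hs y with h | h <;> rcases hs y' with h' | h' <;> rw [h, h'] <;> norm_num
    have h2 : (mK y y' : ℝ) * (1 - s y * s y') = 1 - s y * s y' := by
      unfold mK
      split_ifs with h
      · subst h; rw [hss]; simp
      · simp
    calc (s y - s y') * ψ y y' ≤ |(s y - s y') * ψ y y'| := le_abs_self _
      _ = |s y - s y'| * |ψ y y'| := abs_mul _ _
      _ ≤ |s y - s y'| * (mK y y' + mT y y') := mul_le_mul_of_nonneg_left (bd _ _) (abs_nonneg _)
      _ = _ := by rw [h1]; linear_combination h2
  have e5 : ∑ y : Y p, ∑ y', (1 - s y * s y') ≤ 16 * p ^ 2 := by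
    have : ∑ y : Y p, ∑ y', (1 - s y * s y') = (4 * p) * (4 * p) - (∑ y, s y) * (∑ y, s y) := by
      simp only [Finset.sum_sub_distrib, ← Finset.mul_sum, ← Finset.sum_mul]
      simp only [Finset.sum_const, Finset.card_univ, nsmul_eq_mul, cardY]
      ring
    rw [this]; nlinarith [mul_self_nonneg (∑ y, s y)]
  have e6 : ∑ y : Y p, ∑ y', (mT y y' : ℝ) * (1 - s y * s y') ≤ 8 * p - 8 := by
    rw [sumT (fun y y' => 1 - s y * s y')]
    have hb : ∀ b, ∑ x : ZMod p, ((1 - s (false, b, x) * s (false, b, x + 1)) + (1 - s (false, b, x + 1) * s (false, b, x))) ≤ 4 * p - 4 := by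
      intro b
      obtain ⟨x0, hx0⟩ : ∃ x0 : ZMod p, s (false, b, x0 + 1) = s (false, b, x0) := by
        by_contra! hcon
        apply cyc (fun x : ZMod p => s (false, b, x) = 1) hodd
        intro x
        have h1 := hcon x
        rcases hs (false, b, x) with h | h <;> rcases hs (false, b, x + 1) with h' | h'
        · exact absurd (h'.trans h.symm) h1
        · simp only [h, h']; norm_num
        · simp only [h, h']; norm_num
        · exact absurd (h'.trans h.symm) h1
      have h4 : ∑ x : ZMod p, ((1 - s (false, b, x) * s (false, b, x + 1)) + (1 - s (false, b, x + 1) * s (false, b, x)))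
          ≤ ∑ x : ZMod p, (4 - if x = x0 then 4 else 0) := by
        refine Finset.sum_le_sum fun x _ => ?_
        split_ifs with hx
        · subst hx; rw [hx0, hss]; norm_num
        · rcases hs (false, b, x) with h | h <;> rcases hs (false, b, x + 1) with h' | h' <;>
          rw [h, h'] <;> norm_num
      refine h4.trans ?_
      rw [Finset.sum_sub_distrib]
      simp [ZMod.card]; linarith
    rw [Fintype.sum_bool]
    have h1 := hb true
    have h2 := hb false
    linarith
  have e7 : ∑ y, s y * (A y + B y) ≤ 4 * p + 2 * α := by
    have h : ∀ y, s y * (A y + B y) ≤ 2 * oo y - A y + B y := by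
      intro y
      have h1 := abs_le.1 (hA y)
      have h2 := abs_le.1 (hB y)
      rcases hs y with h | h <;> rw [h] <;> linarith [h1.1, h1.2, h2.1, h2.2]
    refine (Finset.sum_le_sum fun y _ => h y).trans ?_
    rw [Finset.sum_add_distrib, Finset.sum_sub_distrib, ← Finset.mul_sum, sum_oo, sA, sB]
    linarith
  simp only [Finset.sum_add_distrib] at e4
  linarith

lemma noflow (hp : 3 ≤ p) (hodd : Odd p) (s : VV p → ℤ) (φ : VV p → VV p → ℝ)
    (anti : ∀ a b, φ a b = - φ b a) (bd : ∀ a b, |φ a b| ≤ mm a b) (R : ℝ)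
    (hR : R = 2 * p + 1 - 1 / (2 * p + 1))
    (net : ∀ a, ∑ b, φ a b = R * s a) (hs : ∀ a, Odd (s a)) : False := by
  have hp' : (3 : ℝ) ≤ p := by exact_mod_cast hp
  have hRe : (2 * p + 1) * (2 * p + 1 - R) = 1 := by
    rw [hR]; field_simp; ring
  have hR1 : 2 * p + 1 - R > 0 := by
    by_contra hcon
    nlinarith
  have hR0 : 2 * (p : ℝ) < R := by nlinarith
  have hz : ∀ a b, mm a b = 0 → φ a b = 0 := by
    intro a b h
    have := bd a b
    rw [h] at this
    simpa using this
  have hs1 : ∀ a, s a = 1 ∨ s a = -1 := by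
    intro a
    have h1 : |R * s a| ≤ 4 * p + 1 := by
      rw [← net, ← degV a]
      exact (Finset.abs_sum_le_sum_abs _ _).trans (Finset.sum_le_sum fun b _ => bd a b)
    rw [abs_le] at h1
    have h2 : (s a : ℝ) < 3 := by
      by_contra hcon
      push Not at hcon
      nlinarith
    have h3 : -3 < (s a : ℝ) := by
      by_contra hcon
      push Not at hcon
      nlinarith
    have h2' : s a < 3 := by exact_mod_cast h2
    have h3' : -3 < s a := by exact_mod_cast h3
    obtain ⟨k, hk⟩ := hs a
    omega
  have hNe : ∀ i : ZMod (4 * p + 1), i ≠ i + 1 := by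
    have : Fact (1 < 4 * p + 1) := ⟨by omega⟩
    intro i h
    simp at h
  have hA : ∀ i y, |φ (vx i y) (vc i)| ≤ oo y := by
    intro i y
    refine (bd _ _).trans (le_of_eq ?_)
    simp only [mm, mC, oo]
    by_cases h : y.1 = true <;> simp [h, hNe i]
  have hB : ∀ i y, |φ (vx i y) (vc (i + 1))| ≤ oo y := by
    intro i y
    refine (bd _ _).trans (le_of_eq ?_)
    simp only [mm, mC, oo]
    by_cases h : y.1 = true <;> simp [h, (hNe i).symm]
  have netx : ∀ i y, ∑ y', φ (vx i y) (vx i y') + φ (vx i y) (vc i) + φ (vx i y) (vc (i + 1)) = R * s (vx i y) := by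
    intro i y
    rw [← net, sumV, hz _ vw rfl]
    have h1 : ∑ j, φ (vx i y) (vc j) = φ (vx i y) (vc i) + φ (vx i y) (vc (i + 1)) := by
      rw [← Finset.sum_pair (f := fun j => φ (vx i y) (vc j)) (hNe i)]
      symm
      apply Finset.sum_subset (Finset.subset_univ _)
      intro j _ hj
      apply hz
      simp at hj
      simp [mm, mC, hj]
    have h2 : ∑ i', ∑ y', φ (vx i y) (vx i' y') = ∑ y', φ (vx i y) (vx i y') := by
      apply Finset.sum_eq_single i
      · intro j _ hj
        refine Finset.sum_eq_zero fun y' _ => hz _ _ ?_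
        simp [mm, hj.symm]
      · simp
    rw [h1, h2]; ring
  have netc : ∀ i, - ∑ y, φ (vx (i + 1) y) (vc (i + 1)) - ∑ y, φ (vx i y) (vc (i + 1)) + φ (vc (i + 1)) vw = R * s (vc (i + 1)) := by
    intro i
    rw [← net, sumV]
    have h1 : ∑ j, φ (vc (i + 1)) (vc j) = 0 := Finset.sum_eq_zero fun j _ => hz _ _ rfl
    have h2 : ∑ i', ∑ y, φ (vc (i + 1)) (vx i' y) =
        ∑ y, φ (vc (i + 1)) (vx i y) + ∑ y, φ (vc (i + 1)) (vx (i + 1) y) := by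
      rw [← Finset.sum_pair (f := fun i' => ∑ y, φ (vc (i + 1)) (vx i' y)) (hNe i)]
      symm
      apply Finset.sum_subset (Finset.subset_univ _)
      intro j _ hj
      refine Finset.sum_eq_zero fun y _ => ?_
      apply hz
      simp at hj
      have h3 : ¬ (i + 1 = j) := fun h => hj.2 h.symm
      have h4 : ¬ (i = j) := fun h => hj.1 h.symm
      simp [mm, mC, h3, h4]
    rw [h1, h2, ← Finset.sum_neg_distrib]
    simp only [anti (vc (i + 1)) (vx _ _), Finset.sum_neg_distrib]
    ring
  have sB : ∀ i, ∑ y, φ (vx i y) (vc (i + 1)) = - ∑ y, φ (vx i y) (vc i) := by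
    intro i
    have h1 : ∑ y, φ (vx i y) (vc i) + ∑ y, φ (vx i y) (vc (i + 1)) = R * ((∑ y, s (vx i y) : ℤ) : ℝ) := by
      push_cast
      rw [Finset.mul_sum]
      simp only [← netx, Finset.sum_add_distrib]
      rw [anti_sum _ (fun a b => anti _ _)]; ring
    have h2 : |∑ y, φ (vx i y) (vc i)| ≤ 2 * p := by
      rw [← sum_oo]
      exact (Finset.abs_sum_le_sum_abs _ _).trans (Finset.sum_le_sum fun b _ => hA i b)
    have h3 : |∑ y, φ (vx i y) (vc (i + 1))| ≤ 2 * p := by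
      rw [← sum_oo]
      exact (Finset.abs_sum_le_sum_abs _ _).trans (Finset.sum_le_sum fun b _ => hB i b)
    have h4 : Even (∑ y, s (vx i y)) := by
      have : ∑ y, s (vx i y) = ∑ y : Y p, (s (vx i y) + 1) - (Fintype.card (Y p) : ℤ) := by
        simp [Finset.sum_add_distrib]
      rw [this]
      refine Even.sub (Finset.even_sum _ fun j _ => (hs _).add_odd odd_one) ?_
      simp [Fintype.card_prod]
    rw [abs_le] at h2 h3
    have h5 : ((∑ y, s (vx i y) : ℤ) : ℝ) < 2 := by
      by_contra hcon
      push Not at hcon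
      nlinarith
    have h6 : -2 < ((∑ y, s (vx i y) : ℤ) : ℝ) := by
      by_contra hcon
      push Not at hcon
      nlinarith
    have h5' : ∑ y, s (vx i y) < 2 := by exact_mod_cast h5
    have h6' : -2 < ∑ y, s (vx i y) := by exact_mod_cast h6
    have h7 : ∑ y, s (vx i y) = 0 := by
      obtain ⟨k, hk⟩ := h4
      omega
    rw [h7] at h1
    simp at h1
    linarith
  have hsR : ∀ a, (s a : ℝ) = 1 ∨ (s a : ℝ) = -1 := by
    intro a
    rcases hs1 a with h | h <;> rw [h] <;> simp
  have bdx : ∀ i a b, |φ (vx i a) (vx i b)| ≤ mK a b + mT a b := by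
    intro i a b
    refine (bd _ _).trans (le_of_eq ?_)
    simp [mm]
  set α : ZMod (4 * p + 1) → ℝ := fun i => ∑ y, φ (vx i y) (vc (i + 1)) with hα
  have lo : ∀ i, 2 * p * R - 4 * p ^ 2 - 4 * p + 2 ≤ α i := by
    intro i
    refine piece hodd (fun y => s (vx i y)) (fun y => hsR _) (fun y y' => φ (vx i y) (vx i y'))
      (fun a b => anti _ _) (bdx i) _ _ (hA i) (hB i) R (α i) (netx i) ?_ rfl
    simp only [hα, sB i, neg_neg]
  have hi : ∀ i, 2 * p * R - 4 * p ^ 2 - 4 * p + 2 ≤ - α i := by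
    intro i
    refine piece hodd (fun y => s (vx i y)) (fun y => hsR _) (fun y y' => φ (vx i y) (vx i y'))
      (fun a b => anti _ _) (bdx i) _ _ (hB i) (hA i) R (- α i) ?_ ?_ ?_
    · intro y
      rw [← netx i y]; ring
    · simp only [hα, neg_neg]
    · simp only [hα, sB i, neg_neg]
  have step : ∀ i, α (i + 1) - α i + φ (vc (i + 1)) vw = R * s (vc (i + 1)) := by
    intro i
    rw [← netc i]
    simp only [hα]
    rw [sB (i + 1)]
  have hω : ∀ j, |φ (vc j) vw| ≤ 1 := fun j => (bd _ _).trans (by simp [mm])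
  apply cyc (fun i : ZMod (4 * p + 1) => 0 ≤ α i) ⟨2 * p, by ring⟩
  intro i
  have hRl : 2 * p * R = 4 * p ^ 2 + 4 * p - R := by linear_combination -hRe
  have h1 := step i
  have h2 := abs_le.1 (hω (i + 1))
  have h3 := lo i
  have h4 := hi i
  have h5 := lo (i + 1)
  have h6 := hi (i + 1)
  constructor
  · intro ha hb
    rcases hsR (vc (i + 1)) with h | h <;> rw [h] at h1 <;> linarith [h2.1, h2.2]
  · intro hb
    by_contra ha
    push Not at ha hb
    rcases hsR (vc (i + 1)) with h | h <;> rw [h] at h1 <;> linarith [h2.1, h2.2]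

open Classical in
/-- indicator that two truth values differ -/
noncomputable def dd (a b : Prop) : ℝ := if ¬ (a ↔ b) then 1 else 0

lemma dd_nonneg (a b : Prop) : 0 ≤ dd a b := by unfold dd; split_ifs <;> norm_num
lemma dd_symm (a b : Prop) : dd a b = dd b a := by
  unfold dd; by_cases h : a <;> by_cases h' : b <;> simp [h, h']
lemma dd_one {a b : Prop} (h : ¬ (a ↔ b)) : dd a b = 1 := by unfold dd; rw [if_pos h]
lemma dd_tri {a b : Prop} (h : ¬ (a ↔ b)) (c : Prop) : 1 ≤ dd a c + dd b c := by
  by_cases h1 : (a ↔ c)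
  · have h2 : ¬ (b ↔ c) := by tauto
    rw [dd_one h2]; linarith [dd_nonneg a c]
  · rw [dd_one h1]; linarith [dd_nonneg b c]

/-- the contribution of one piece to a cut -/
noncomputable def PP (u : Y p → Prop) (g h : Prop) : ℝ :=
  2 * ∑ y, oo y * (dd (u y) g + dd (u y) h) + ∑ y, ∑ y', ((mK y y' : ℝ) + mT y y') * dd (u y) (u y')

lemma oo_nonneg (y : Y p) : 0 ≤ oo y := by unfold oo; split_ifs <;> norm_num

lemma PPa_nonneg (u : Y p → Prop) (g h : Prop) : 0 ≤ ∑ y, oo y * (dd (u y) g + dd (u y) h) :=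
  Finset.sum_nonneg fun y _ => mul_nonneg (oo_nonneg y) (add_nonneg (dd_nonneg _ _) (dd_nonneg _ _))

lemma PPb_nonneg (u : Y p → Prop) : 0 ≤ ∑ y, ∑ y', ((mK y y' : ℝ) + mT y y') * dd (u y) (u y') :=
  Finset.sum_nonneg fun y _ => Finset.sum_nonneg fun y' _ => mul_nonneg (by positivity) (dd_nonneg _ _)

lemma PP_nonneg (u : Y p → Prop) (g h : Prop) : 0 ≤ PP u g h := by
  have := PPa_nonneg u g h
  have := PPb_nonneg u
  unfold PP; linarith

lemma PP_diff (u : Y p → Prop) (g h : Prop) (hgh : ¬ (g ↔ h)) : 4 * p ≤ PP u g h := by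
  have h1 : ∑ y : Y p, oo y ≤ ∑ y, oo y * (dd (u y) g + dd (u y) h) := by
    refine Finset.sum_le_sum fun y _ => ?_
    have := dd_tri hgh (u y)
    rw [dd_symm g, dd_symm h] at this
    nlinarith [oo_nonneg y]
  rw [sum_oo] at h1
  have := PPb_nonneg u
  unfold PP; linarith

open Classical in
lemma PP_lone (hp : 3 ≤ p) (u : Y p → Prop) (g h : Prop) (v0 : Y p) (hv : ∀ y, y ≠ v0 → ¬ (u y ↔ u v0)) :
    8 * p + 2 ≤ PP u g h := by
  have hK0 : ∀ y : Y p, mK y y = 0 := fun y => by simp [mK]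
  have e1 : ∑ y, ∑ y', ((mK y y' : ℝ) + mT y y') * ((if y = v0 then 1 else 0) + (if y' = v0 then 1 else 0))
      ≤ ∑ y, ∑ y', ((mK y y' : ℝ) + mT y y') * dd (u y) (u y') := by
    refine Finset.sum_le_sum fun y _ => Finset.sum_le_sum fun y' _ => ?_
    by_cases h1 : y = v0 <;> by_cases h2 : y' = v0
    · subst h1; subst h2; simp [hK0, mT_self hp]
    · subst h1
      rw [dd_symm, dd_one (hv _ h2)]; simp [h2]
    · subst h2
      rw [dd_one (hv _ h1)]; simp [h1]
    · simp only [h1, h2, if_false, add_zero, mul_zero]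
      exact mul_nonneg (by positivity) (dd_nonneg _ _)
  have e2 : ∑ y, ∑ y', ((mK y y' : ℝ) + mT y y') * ((if y = v0 then 1 else 0) + (if y' = v0 then 1 else 0))
      = 2 * (∑ y', (mK v0 y' : ℝ) + ∑ y', (mT v0 y' : ℝ)) := by
    simp only [mul_add, Finset.sum_add_distrib, mul_ite, mul_one, mul_zero]
    have a1 : ∀ F : Y p → Y p → ℝ, ∑ y, ∑ y', (if y = v0 then F y y' else 0) = ∑ y', F v0 y' := by
      intro F; rw [Finset.sum_comm]; simp
    have a2 : ∀ F : Y p → Y p → ℝ, (∀ a b, F a b = F b a) → ∑ y, ∑ y', (if y' = v0 then F y y' else 0) = ∑ y', F v0 y' := by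
      intro F hF; simp [hF _ v0]
    rw [a1 (fun y y' => (mK y y' : ℝ) + mT y y'),
      a2 (fun y y' => (mK y y' : ℝ) + mT y y') (fun a b => by rw [mK_symm, mT_symm])]
    rw [Finset.sum_add_distrib]
    ring
  rw [e2, sumK1, sumT1] at e1
  have e3 := PPa_nonneg u g h
  by_cases ho : v0.1 = true
  · rw [if_pos ho] at e1
    obtain ⟨v1, hv1, hne⟩ : ∃ v1 : Y p, v1.1 = true ∧ v1 ≠ v0 := by
      obtain ⟨a, b, x⟩ := v0
      refine ⟨(true, !b, x), rfl, ?_⟩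
      intro hh
      simp at hh
    have h2 : ∑ y ∈ ({v1, v0} : Finset (Y p)), oo y * (dd (u y) g + dd (u y) h)
        ≤ ∑ y, oo y * (dd (u y) g + dd (u y) h) :=
      Finset.sum_le_sum_of_subset_of_nonneg (Finset.subset_univ _) fun y _ _ =>
        mul_nonneg (oo_nonneg y) (add_nonneg (dd_nonneg _ _) (dd_nonneg _ _))
    rw [Finset.sum_pair hne] at h2
    have o0 : oo v0 = 1 := by simp [oo, ho]
    have o1 : oo v1 = 1 := by simp [oo, hv1]
    rw [o0, o1] at h2
    have h3 := dd_tri (hv _ hne) g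
    have h4 := dd_tri (hv _ hne) h
    unfold PP; linarith
  · rw [if_neg ho] at e1
    unfold PP; linarith

open Classical in
lemma PP_nonconst (hp : 3 ≤ p) (u : Y p → Prop) (g h : Prop) (h1 : ∃ y, u y) (h2 : ∃ y, ¬ u y) :
    8 * p + 2 ≤ PP u g h := by
  set A := Finset.univ.filter u with hA
  set B := Finset.univ.filter (fun y => ¬ u y) with hB
  have hcard : A.card + B.card = 4 * p := by
    rw [hA, hB, Finset.card_filter_add_card_filter_not]
    have := cardY (p := p)
    rw [Finset.card_univ]
    exact_mod_cast this
  have hA1 : 0 < A.card := by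
    obtain ⟨y, hy⟩ := h1
    exact Finset.card_pos.2 ⟨y, by simp [hA, hy]⟩
  have hB1 : 0 < B.card := by
    obtain ⟨y, hy⟩ := h2
    exact Finset.card_pos.2 ⟨y, by simp [hB, hy]⟩
  by_cases a1 : A.card = 1
  · obtain ⟨v0, h0⟩ := Finset.card_eq_one.1 a1
    have hm : ∀ y, u y ↔ y = v0 := fun y => by
      have : y ∈ A ↔ y ∈ ({v0} : Finset (Y p)) := by rw [h0]
      simpa [hA] using this
    refine PP_lone hp u g h v0 fun y hy => ?_
    rw [hm, hm]; tauto
  by_cases b1 : B.card = 1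
  · obtain ⟨v0, h0⟩ := Finset.card_eq_one.1 b1
    have hm : ∀ y, ¬ u y ↔ y = v0 := fun y => by
      have : y ∈ B ↔ y ∈ ({v0} : Finset (Y p)) := by rw [h0]
      simpa [hB] using this
    refine PP_lone hp u g h v0 fun y hy => ?_
    have := hm y
    have := hm v0
    tauto
  have a2 : 2 ≤ A.card := by omega
  have b2 : 2 ≤ B.card := by omega
  have e1 : ∑ y, ∑ y', dd (u y) (u y') ≤ ∑ y, ∑ y', ((mK y y' : ℝ) + mT y y') * dd (u y) (u y') := by
    refine Finset.sum_le_sum fun y _ => Finset.sum_le_sum fun y' _ => ?_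
    by_cases hy : y = y'
    · subst hy; simp [dd]
    · have : (1 : ℝ) ≤ (mK y y' : ℝ) + mT y y' := by simp [mK, hy]
      nlinarith [dd_nonneg (u y) (u y')]
  have e2 : ∑ y, ∑ y', dd (u y) (u y') = 2 * (A.card * B.card) := by
    have hh : ∀ y y', dd (u y) (u y') = (if u y then (1 : ℝ) else 0) * (if ¬ u y' then 1 else 0)
        + (if ¬ u y then 1 else 0) * (if u y' then (1 : ℝ) else 0) := by
      intro y y'
      by_cases k1 : u y <;> by_cases k2 : u y' <;> simp [dd, k1, k2]
    simp only [hh, Finset.sum_add_distrib, ← Finset.mul_sum, ← Finset.sum_mul]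
    rw [← Finset.natCast_card_filter, ← Finset.natCast_card_filter, ← hA, ← hB]
    ring
  have hc : (A.card : ℝ) + B.card = 4 * p := by exact_mod_cast hcard
  have a2' : (2 : ℝ) ≤ A.card := by exact_mod_cast a2
  have b2' : (2 : ℝ) ≤ B.card := by exact_mod_cast b2
  have hp' : (3 : ℝ) ≤ p := by exact_mod_cast hp
  have e3 := PPa_nonneg u g h
  unfold PP
  nlinarith [mul_nonneg (sub_nonneg.2 a2') (sub_nonneg.2 b2')]

lemma expand (u : VV p → Prop) : ∑ a, ∑ b, (mm a b : ℝ) * dd (u a) (u b) =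
    2 * ∑ j, dd (u vw) (u (vc j)) + ∑ i, PP (fun y => u (vx i y)) (u (vc i)) (u (vc (i + 1))) := by
  rw [sumV]
  simp only [sumV, mm]
  have h1 : ∑ j, ∑ i, ∑ y, (mC i y j : ℝ) * dd (u (vc j)) (u (vx i y)) =
      ∑ i, ∑ y, oo y * (dd (u (vx i y)) (u (vc i)) + dd (u (vx i y)) (u (vc (i + 1)))) := by
    rw [Finset.sum_comm]
    refine Finset.sum_congr rfl fun i _ => ?_
    rw [Finset.sum_comm]
    refine Finset.sum_congr rfl fun y _ => ?_
    simp only [dd_symm (u (vc _))]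
    rw [sumC]
    unfold oo; split_ifs <;> simp
  have h2 : ∀ i y, ∑ j, (mC i y j : ℝ) * dd (u (vx i y)) (u (vc j)) =
      oo y * (dd (u (vx i y)) (u (vc i)) + dd (u (vx i y)) (u (vc (i + 1)))) := by
    intro i y
    rw [sumC]
    unfold oo; split_ifs <;> simp
  have h3 : ∀ i y, ∑ i', ∑ y', ((if i = i' then mK y y' + mT y y' else 0 : ℕ) : ℝ) * dd (u (vx i y)) (u (vx i' y'))
      = ∑ y', ((mK y y' : ℝ) + mT y y') * dd (u (vx i y)) (u (vx i y')) := by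
    intro i y
    rw [Finset.sum_comm]
    refine Finset.sum_congr rfl fun z _ => ?_
    simp
  simp only [h2, h3, Nat.cast_zero, zero_mul, Nat.cast_one, one_mul, Finset.sum_const_zero, add_zero, zero_add,
    Finset.sum_add_distrib, h1, PP, ← Finset.mul_sum, dd_symm (u (vc _)) (u vw)]
  ring

open Classical in
lemma oddcut (hp : 3 ≤ p) (u : VV p → Prop) (hu : Odd (∑ a, if u a then 1 else 0)) :
    2 * (4 * p + 1) ≤ ∑ a, ∑ b, (mm a b : ℝ) * dd (u a) (u b) := by
  rw [expand]
  have n1 : 0 ≤ ∑ j, dd (u vw) (u (vc j)) := Finset.sum_nonneg fun j _ => dd_nonneg _ _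
  by_cases hc : ∀ i, (∀ y, u (vx i y)) ∨ (∀ y, ¬ u (vx i y))
  · obtain ⟨j0, hj0⟩ : ∃ j, ¬ (u vw ↔ u (vc j)) := by
      by_contra! hcon
      rw [← Nat.not_even_iff_odd] at hu
      apply hu
      rw [Fintype.sum_sum_type, Fintype.sum_sum_type, Fintype.sum_prod_type, ← add_assoc]
      refine Even.add ?_ (Finset.even_sum _ fun i _ => ?_)
      · have : ∀ j, (if u (Sum.inr (Sum.inl j)) then 1 else 0) = if u vw then 1 else 0 := by
          intro j; simp only [← hcon j]
        simp only [this]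
        split_ifs <;> simp [ZMod.card, Nat.even_add_one, parity_simps]
      · have hE : Even (Fintype.card (Y p)) := by
          rw [Fintype.card_prod]; simp
        rcases hc i with h | h
        · simp only [h, if_true]
          simp
        · simp only [h, if_false]
          simp
    have n2 : ∀ s : Finset (ZMod (4 * p + 1)), ∑ i ∈ s, PP (fun y => u (vx i y)) (u (vc i)) (u (vc (i + 1))) ≤
       ∑ i, PP (fun y => u (vx i y)) (u (vc i)) (u (vc (i + 1))) := fun s =>
      Finset.sum_le_sum_of_subset_of_nonneg (Finset.subset_univ _) fun i _ _ => PP_nonneg _ _ _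
    by_cases hall : ∀ j, ¬ (u vw ↔ u (vc j))
    · have := n2 ∅
      have h1 : ∑ j, dd (u vw) (u (vc j)) = 4 * p + 1 := by
        simp only [dd_one (hall _)]
        simp [ZMod.card]
      rw [h1]
      simp at this
      linarith
    · push Not at hall
      obtain ⟨j1, hj1⟩ := hall
      have mixed : ∃ a b, u (vc a) ∧ ¬ u (vc b) := by
        by_cases hw : u vw
        · exact ⟨j1, j0, hj1.1 hw, fun h => hj0 ⟨fun _ => h, fun _ => hw⟩⟩
        · refine ⟨j0, j1, ?_, fun h => hw (hj1.2 h)⟩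
          by_contra h
          exact hj0 ⟨fun h' => absurd h' hw, fun h' => absurd h' h⟩
      obtain ⟨a, b, ha, hb⟩ := mixed
      obtain ⟨i, hi1, hi2⟩ : ∃ i, u (vc i) ∧ ¬ u (vc (i + 1)) := by
        by_contra! hcon
        exact hb (cyc2 (fun j => u (vc j)) hcon ha b)
      obtain ⟨j, hj1', hj2⟩ : ∃ j, ¬ u (vc j) ∧ u (vc (j + 1)) := by
        by_contra! hcon
        exact cyc2 (fun j => ¬ u (vc j)) hcon hb a ha
      have hij : i ≠ j := by
        rintro rfl; exact hj1' hi1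
      have h1 := n2 {i, j}
      rw [Finset.sum_pair hij] at h1
      have h2 := PP_diff (fun y => u (vx i y)) (u (vc i)) (u (vc (i + 1))) (by tauto)
      have h3 := PP_diff (fun y => u (vx j y)) (u (vc j)) (u (vc (j + 1))) (by tauto)
      have h4 : dd (u vw) (u (vc j0)) ≤ ∑ j, dd (u vw) (u (vc j)) :=
        Finset.single_le_sum (f := fun j => dd (u vw) (u (vc j))) (fun j _ => dd_nonneg _ _) (Finset.mem_univ j0)
      rw [dd_one hj0] at h4
      linarith
  · push Not at hc
    obtain ⟨i, ⟨y1, hy1⟩, ⟨y2, hy2⟩⟩ := hc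
    have h1 := PP_nonconst hp (fun y => u (vx i y)) (u (vc i)) (u (vc (i + 1))) ⟨y2, hy2⟩ ⟨y1, hy1⟩
    have h2 := Finset.single_le_sum (f := fun i => PP (fun y => u (vx i y)) (u (vc i)) (u (vc (i + 1))))
      (fun i _ => PP_nonneg _ _ _) (Finset.mem_univ i)
    linarith

end concrete

lemma mono (G : Multigraph) {r r' : ℝ} (h : r ≤ r') (hf : G.HasNZFlow r) : G.HasNZFlow r' := by
  obtain ⟨f, h1, h2⟩ := hf
  exact ⟨f, fun e => ⟨(h1 e).1, (h1 e).2.trans (by linarith)⟩, h2⟩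

end Ring

/-- For every odd integer `p ≥ 3`, with `k = 2p`, there exists a
`(2k+1)`-graph `G` with `φ_c(G) > 2 + 2/k`.  (In particular the conjecture that
every `(2t+1)`-graph has circular flow number at most `2 + 2/t` is false.) -/
theorem statement_6 (p : ℕ) (hp : 3 ≤ p) (hodd : Odd p) :
    ∃ G : Multigraph, G.IsRGraph (2 * (2 * p) + 1) ∧
      ((2 + 2 / (2 * (p : ℝ)) : ℝ) : EReal) < G.flowNumber := by
  have hz : NeZero p := ⟨by omega⟩
  have hp' : (3 : ℝ) ≤ p := by exact_mod_cast hp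
  let lo : LinearOrder (Ring.VV p) :=
    LinearOrder.lift' (Fintype.equivFin (Ring.VV p)) (Equiv.injective _)
  refine ⟨Ring.mkG (Ring.VV p) Ring.mm, ⟨?_, ?_⟩, ?_⟩
  · intro v
    have h := Ring.degE (m := Ring.mm) Ring.mm_symm (Ring.mm_self hp) v
    have h := h.trans (Ring.degV (p := p) v)
    have h2 : ((Ring.mkG (Ring.VV p) Ring.mm).degree v : ℝ) = ((2 * (2 * p) + 1 : ℕ) : ℝ) := by
      rw [h]; push_cast; ring
    exact_mod_cast h2
  · intro (X : Set (Ring.VV p)) hX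
    have h := Ring.cutE (m := Ring.mm) Ring.mm_symm (Ring.mm_self hp) X
    classical
    have h1 := Ring.oddcut hp (fun a => a ∈ X) (by
      have : X.ncard = ∑ a : Ring.VV p, if a ∈ X then 1 else 0 := by
        rw [Finset.sum_boole]
        rw [Set.ncard_eq_toFinset_card']
        simp
      replace hX : Odd (X.ncard) := hX
      rw [this] at hX
      convert hX)
    have h2 : 2 * (4 * (p : ℝ) + 1) ≤ 2 * (((Ring.mkG (Ring.VV p) Ring.mm).cut X).ncard : ℝ) := by
      rw [h]
      refine h1.trans (le_of_eq ?_)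
      refine Finset.sum_congr rfl fun a _ => Finset.sum_congr rfl fun b _ => ?_
      unfold Ring.dd
      split_ifs <;> first | simp | (exfalso; tauto)
    have h3 : ((2 * (2 * p) + 1 : ℕ) : ℝ) ≤ (((Ring.mkG (Ring.VV p) Ring.mm).cut X).ncard : ℝ) := by
      push_cast; linarith
    exact_mod_cast h3
  · set R : ℝ := 2 * p + 1 - 1 / (2 * p + 1) with hR
    have hR1 : 1 / (2 * (p : ℝ) + 1) < 1 := by
      rw [div_lt_one (by linarith)]; linarith
    have hR0 : 0 < 1 / (2 * (p : ℝ) + 1) := by positivity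
    have key : ¬ (Ring.mkG (Ring.VV p) Ring.mm).HasNZFlow (2 + 2 / (R - 1)) := by
      intro hf
      obtain ⟨s, φ, anti, bd, net, par⟩ := Ring.flowE (R := R) (m := Ring.mm) (hR := by linarith) (hf := hf)
      refine Ring.noflow hp hodd s φ anti (fun a b => bd a b (Ring.mm_symm a b)) R hR net ?_
      intro a
      have h1 := par a (fun b => Ring.mm_symm a b) (Ring.mm_self hp a)
      have h2 : ∑ b, (Ring.mm a b : ℤ) = 4 * p + 1 := by
        have := Ring.degV a
        exact_mod_cast this
      rw [h2] at h1
      rw [← Int.not_even_iff_odd]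
      intro h3
      obtain ⟨k, hk⟩ := h1
      obtain ⟨l, hl⟩ := h3
      omega
    have hlt : 2 + 2 / (2 * (p : ℝ)) < 2 + 2 / (R - 1) := by
      have : 2 / (2 * (p : ℝ)) < 2 / (R - 1) := by
        apply div_lt_div_of_pos_left <;> linarith
      linarith
    refine lt_of_lt_of_le (EReal.coe_lt_coe_iff.2 hlt) ?_
    refine le_sInf ?_
    rintro x ⟨r, rfl, _, hf⟩
    rw [EReal.coe_le_coe_iff]
    by_contra hcon
    push Not at hcon
    exact key (Ring.mono _ hcon.le hf)
end

section
/- Let {G_n : n ∈ ℕ} be a family of bridgeless cubic class 2 graphs such that for each n: G_n has an r_n-bipartition (B_n, W_n) with r_n ∈ (4,5), and G_n has a perfect matching M_n such that G_n has the M_n-class-2 property and every edge of M_n has one end in B_n and the other in W_n. If lim_{n→∞} r_n = 4, then for every integer t ≥ 1, inf{ φ_c(G) : G is a bridgeless (2t+1)-regular class 2 multigraph } = 2 + 2/(2t−1). -/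
set_option linter.unusedSectionVars false

open Classical in
/-- divergence -/
noncomputable def dvg {V E : Type} [Fintype E] (p q : E → V) (h : E → ℝ) (v : V) : ℝ :=
  ∑ e, h e * ((if p e = v then (1:ℝ) else 0) - (if q e = v then 1 else 0))

section
variable {V E : Type} [Fintype V] [Fintype E]

open Classical in
theorem sum_dvg (p q : E → V) (h : E → ℝ) (X : Finset V) :
    ∑ v ∈ X, dvg p q h v
      = ∑ e, h e * ((if p e ∈ X then (1:ℝ) else 0) - (if q e ∈ X then 1 else 0)) := by
  unfold dvg
  rw [Finset.sum_comm]
  refine Finset.sum_congr rfl fun e _ => ?_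
  rw [← Finset.mul_sum, Finset.sum_sub_distrib, Finset.sum_ite_eq, Finset.sum_ite_eq]

theorem dvg_add (p q : E → V) (h z : E → ℝ) (a : ℝ) (v : V) :
    dvg p q (fun e => h e + a * z e) v = dvg p q h v + a * dvg p q z v := by
  unfold dvg
  rw [Finset.mul_sum, ← Finset.sum_add_distrib]
  refine Finset.sum_congr rfl fun e _ => ?_
  ring

theorem dvg_continuous (p q : E → V) (v : V) : Continuous (fun h : E → ℝ => dvg p q h v) := by
  unfold dvg
  fun_prop

open Classical in
theorem dvg_single (p q : E → V) (e : E) (v : V) :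
    dvg p q (fun e' => if e' = e then 1 else 0) v
     = (if p e = v then (1:ℝ) else 0) - (if q e = v then 1 else 0) := by
  unfold dvg
  simp

open Classical in
theorem feasible (p q : E → V) (b : V → ℝ) (c : ℝ) (hc : 0 ≤ c)
    (H : ∀ X : Finset V, |∑ v ∈ X, b v| ≤
      c * ((Finset.univ.filter (fun e => ¬ (p e ∈ X ↔ q e ∈ X))).card : ℝ)) :
    ∃ h : E → ℝ, (∀ e, |h e| ≤ c) ∧ ∀ v, dvg p q h v = b v := by
  have hK : IsCompact (Set.pi Set.univ (fun _ : E => Set.Icc (-c) c)) :=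
    isCompact_univ_pi fun _ => isCompact_Icc
  have hKn : (Set.pi Set.univ (fun _ : E => Set.Icc (-c) c)).Nonempty :=
    ⟨fun _ => 0, fun e _ => ⟨by linarith, hc⟩⟩
  obtain ⟨h, hh, hmin⟩ := hK.exists_isMinOn hKn
    (f := fun h : E → ℝ => ∑ v, (b v - dvg p q h v) ^ 2)
    (Continuous.continuousOn (continuous_finsetSum _ fun v _ =>
      ((continuous_const.sub (dvg_continuous p q v)).pow 2)))
  have hb : ∀ e, -c ≤ h e ∧ h e ≤ c := fun e => hh e trivial
  set y : V → ℝ := fun v => b v - dvg p q h v with hy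
  have key : ∀ e η, -c ≤ h e + η → h e + η ≤ c → η * (y (p e) - y (q e)) ≤ η ^ 2 := by
    intro e η h1 h2
    have hmem : (fun e' => h e' + η * (if e' = e then (1:ℝ) else 0)) ∈
        (Set.pi Set.univ (fun _ : E => Set.Icc (-c) c)) := by
      intro e' _
      by_cases he : e' = e
      · subst he; simp; constructor <;> linarith
      · simp [he]; exact hb e'
    have h3 := hmin hmem
    simp only [Set.mem_ofPred_eq, dvg_add, dvg_single] at h3
    set a : V → ℝ := fun v => (if p e = v then (1:ℝ) else 0) - (if q e = v then 1 else 0) with ha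
    have e1 : ∑ v, (b v - (dvg p q h v + η * a v)) ^ 2
        = ∑ v, (b v - dvg p q h v)^2 - 2 * η * ∑ v, y v * a v + η ^ 2 * ∑ v, a v ^ 2 := by
      rw [Finset.mul_sum, Finset.mul_sum, ← Finset.sum_sub_distrib, ← Finset.sum_add_distrib]
      refine Finset.sum_congr rfl fun v _ => ?_
      simp only [hy]; ring
    have e2 : ∑ v, y v * a v = y (p e) - y (q e) := by
      simp [ha, mul_sub, Finset.sum_sub_distrib]
    have e3 : ∑ v, a v ^ 2 ≤ 2 := by
      have : ∑ v, a v ^ 2 ≤ ∑ v, ((if p e = v then (1:ℝ) else 0) + (if q e = v then 1 else 0)) := by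
        refine Finset.sum_le_sum fun v _ => ?_
        simp only [ha]; split_ifs <;> norm_num
      refine this.trans ?_
      rw [Finset.sum_add_distrib]
      simp; norm_num
    have h4 : ∑ v, (b v - dvg p q h v)^2 ≤ ∑ v, (b v - (dvg p q h v + η * a v)) ^ 2 := h3
    rw [e1, e2] at h4
    nlinarith [sq_nonneg η]
  have up : ∀ e, y (q e) < y (p e) → h e = c := by
    intro e he
    by_contra hne
    have hlt : h e < c := lt_of_le_of_ne (hb e).2 hne
    have hpos : 0 < min (c - h e) ((y (p e) - y (q e)) / 2) := lt_min (by linarith) (by linarith)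
    have m1 := min_le_left (c - h e) ((y (p e) - y (q e)) / 2)
    have m2 := min_le_right (c - h e) ((y (p e) - y (q e)) / 2)
    have := key e (min (c - h e) ((y (p e) - y (q e)) / 2)) (by linarith [(hb e).1]) (by linarith)
    nlinarith
  have dn : ∀ e, y (p e) < y (q e) → h e = -c := by
    intro e he
    by_contra hne
    have hlt : -c < h e := lt_of_le_of_ne (hb e).1 (Ne.symm hne)
    have hpos : 0 < min (h e + c) ((y (q e) - y (p e)) / 2) := lt_min (by linarith) (by linarith)
    have m1 := min_le_left (h e + c) ((y (q e) - y (p e)) / 2)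
    have m2 := min_le_right (h e + c) ((y (q e) - y (p e)) / 2)
    have := key e (-min (h e + c) ((y (q e) - y (p e)) / 2)) (by linarith) (by linarith [(hb e).2])
    nlinarith
  have ysum : ∀ X : Finset V, ∑ v ∈ X, y v = ∑ v ∈ X, b v - ∑ v ∈ X, dvg p q h v := by
    intro X; rw [← Finset.sum_sub_distrib]
  have hle : ∀ v, y v ≤ 0 := by
    by_contra hcon
    push Not at hcon
    obtain ⟨v0, hv0⟩ := hcon
    set X : Finset V := Finset.univ.filter (fun v => 0 < y v) with hX
    have hXm : ∀ v, v ∈ X ↔ 0 < y v := by intro v; simp [hX]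
    have hpos : 0 < ∑ v ∈ X, y v :=
      Finset.sum_pos (fun v hv => (hXm v).1 hv) ⟨v0, (hXm v0).2 hv0⟩
    have hd : ∑ v ∈ X, dvg p q h v =
        c * ((Finset.univ.filter (fun e => ¬ (p e ∈ X ↔ q e ∈ X))).card : ℝ) := by
      rw [sum_dvg, Finset.card_filter, Nat.cast_sum, Finset.mul_sum]
      refine Finset.sum_congr rfl fun e _ => ?_
      by_cases h1 : p e ∈ X <;> by_cases h2 : q e ∈ X <;> simp only [h1, h2] <;> simp
      · apply up; rw [hXm] at h1 h2; linarith
      · rw [dn e]; · ring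
        rw [hXm] at h1 h2; linarith
    have := H X
    rw [ysum, hd] at hpos
    have := (abs_le.1 this).2
    linarith
  have hz : ∑ v, y v = 0 := by
    rw [ysum, sum_dvg]
    have := H Finset.univ
    simp at this
    simp [this]
  have hz' := (Finset.sum_eq_zero_iff_of_nonpos (fun v _ => hle v)).1 hz
  refine ⟨h, fun e => abs_le.2 (hb e), fun v => ?_⟩
  have := hz' v (Finset.mem_univ v)
  simp only [hy] at this
  linarith

theorem sum_pm {E : Type} (S : Finset E) (g : E → ℝ) (hg : ∀ e ∈ S, g e = 1 ∨ g e = -1) :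
    ∃ m : ℤ, ∑ e ∈ S, g e = S.card + 2 * m := by
  classical
  induction S using Finset.induction_on with
  | empty => exact ⟨0, by simp⟩
  | insert a S ha ih =>
    obtain ⟨m, hm⟩ := ih fun e he => hg e (Finset.mem_insert_of_mem he)
    rw [Finset.sum_insert ha, Finset.card_insert_of_notMem ha, hm]
    rcases hg a (Finset.mem_insert_self _ _) with h | h
    · exact ⟨m, by rw [h]; push_cast; ring⟩
    · exact ⟨m - 1, by rw [h]; push_cast; ring⟩

open Classical in
theorem rounding (p q : E → V) (hpq : ∀ e, p e ≠ q e) (b : V → ℝ)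
    (hb : ∀ v, b v = 1 ∨ b v = -1)
    (hodd : ∀ v, Odd (Finset.univ.filter (fun e => p e = v ∨ q e = v)).card)
    (h0 : E → ℝ) (h0b : ∀ e, |h0 e| ≤ 1) (h0d : ∀ v, dvg p q h0 v = b v) :
    ∃ D : E → ℝ, (∀ e, D e = 1 ∨ D e = -1) ∧ ∀ v, dvg p q D v = b v := by
  set K : Set (E → ℝ) := Set.pi Set.univ (fun _ : E => Set.Icc (-1) 1) ∩
    {h | ∀ v, dvg p q h v = b v} with hKdef
  have hK : IsCompact K := by
    apply (isCompact_univ_pi fun _ => isCompact_Icc).inter_right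
    have : {h : E → ℝ | ∀ v, dvg p q h v = b v} = ⋂ v, {h | dvg p q h v = b v} := by
      ext; simp
    rw [this]
    exact isClosed_iInter fun v => isClosed_eq (dvg_continuous p q v) continuous_const
  have hKn : K.Nonempty := ⟨h0, fun e _ => abs_le.1 (h0b e), h0d⟩
  obtain ⟨h, ⟨hh, hd⟩, hmax⟩ := hK.exists_isMaxOn hKn
    (f := fun h : E → ℝ => ∑ e, (h e) ^ 2) (by fun_prop)
  have hbd : ∀ e, -1 ≤ h e ∧ h e ≤ 1 := fun e => hh e trivial
  simp only [Set.mem_ofPred_eq] at hd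
  refine ⟨h, ?_, hd⟩
  by_contra hcon
  push Not at hcon
  obtain ⟨e0, he0⟩ := hcon
  set F : Finset E := Finset.univ.filter (fun e => h e ≠ 1 ∧ h e ≠ -1) with hF
  have hFm : ∀ e, e ∈ F ↔ h e ≠ 1 ∧ h e ≠ -1 := by intro e; simp [hF]
  set VF : Finset V := Finset.univ.filter (fun v => ∃ e ∈ F, p e = v ∨ q e = v) with hVF
  have hVFm : ∀ v, v ∈ VF ↔ ∃ e ∈ F, p e = v ∨ q e = v := by intro v; simp [hVF]
  -- each vertex of VF has at least two fractional edges
  have htwo : ∀ v ∈ VF, 2 ≤ (F.filter (fun e => p e = v ∨ q e = v)).card := by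
    intro v hv
    obtain ⟨e1, he1, he1v⟩ := (hVFm v).1 hv
    by_contra hlt
    have hcard : (F.filter (fun e => p e = v ∨ q e = v)).card ≤ 1 := by omega
    have huniq : ∀ e, e ∈ F → (p e = v ∨ q e = v) → e = e1 := fun e h1 h2 =>
      Finset.card_le_one.1 hcard e (Finset.mem_filter.2 ⟨h1, h2⟩) e1
        (Finset.mem_filter.2 ⟨he1, he1v⟩)
    set S : Finset E := Finset.univ.filter (fun e => p e = v ∨ q e = v) with hS
    have he1S : e1 ∈ S := by simp [hS, he1v]
    set g : E → ℝ := fun e => h e * ((if p e = v then (1:ℝ) else 0) - (if q e = v then 1 else 0))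
      with hg
    have hsum : ∑ e ∈ S, g e = b v := by
      rw [← hd v]; unfold dvg
      apply Finset.sum_subset (Finset.subset_univ _)
      intro e _ he
      simp only [hS, Finset.mem_filter, Finset.mem_univ, true_and, not_or] at he
      simp [hg, he.1, he.2]
    rw [← Finset.add_sum_erase _ _ he1S] at hsum
    obtain ⟨m, hm⟩ := sum_pm (S.erase e1) g (by
      intro e he
      rw [Finset.mem_erase] at he
      have hes : p e = v ∨ q e = v := by simpa [hS] using he.2
      have hnF : e ∉ F := fun hf => he.1 (huniq e hf hes)
      rw [hFm] at hnF
      have hv1 : h e = 1 ∨ h e = -1 := by tauto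
      have hne := hpq e
      show h e * ((if p e = v then (1:ℝ) else 0) - (if q e = v then 1 else 0)) = 1 ∨
        h e * ((if p e = v then (1:ℝ) else 0) - (if q e = v then 1 else 0)) = -1
      rcases hes with h1 | h1
      · have h2 : q e ≠ v := fun h2 => hne (h1.trans h2.symm)
        simpa [h1, h2] using hv1
      · have h2 : p e ≠ v := fun h2 => hne (h2.trans h1.symm)
        simp only [h1, h2]
        rcases hv1 with h3 | h3 <;> simp [h3])
    have hev : ∃ k : ℕ, (S.erase e1).card = 2 * k := by
      obtain ⟨k, hk⟩ := hodd v
      exact ⟨k, by rw [Finset.card_erase_of_mem he1S]; simp only [hS]; omega⟩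
    obtain ⟨k, hk⟩ := hev
    rw [hm, hk] at hsum
    have hg1 : |g e1| < 1 := by
      have : |h e1| < 1 := by
        rw [hFm] at he1
        rw [abs_lt]
        exact ⟨lt_of_le_of_ne (hbd e1).1 (Ne.symm he1.2), lt_of_le_of_ne (hbd e1).2 he1.1⟩
      simp only [hg, abs_mul]
      refine lt_of_le_of_lt ?_ this
      apply mul_le_of_le_one_right (abs_nonneg _)
      split_ifs <;> norm_num
    rw [abs_lt] at hg1
    push_cast at hsum
    rcases hb v with h1 | h1
    · have a1 : ((2 * k + 2 * m : ℤ) : ℝ) < ((2:ℤ):ℝ) := by push_cast; linarith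
      have a2 : ((0 : ℤ) : ℝ) < ((2 * k + 2 * m : ℤ) : ℝ) := by push_cast; linarith
      have a1 := Int.cast_lt.1 a1
      have a2 := Int.cast_lt.1 a2
      omega
    · have a1 : ((2 * k + 2 * m : ℤ) : ℝ) < ((0:ℤ):ℝ) := by push_cast; linarith
      have a2 : ((-2 : ℤ) : ℝ) < ((2 * k + 2 * m : ℤ) : ℝ) := by push_cast; linarith
      have a1 := Int.cast_lt.1 a1
      have a2 := Int.cast_lt.1 a2
      omega
  have hcard : VF.card ≤ F.card := by
    have h1 : ∑ v ∈ VF, 2 ≤ ∑ v ∈ VF, (F.filter (fun e => p e = v ∨ q e = v)).card :=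
      Finset.sum_le_sum htwo
    have h2 : ∑ v ∈ VF, (F.filter (fun e => p e = v ∨ q e = v)).card ≤ ∑ e ∈ F, 2 := by
      simp_rw [Finset.card_filter]
      rw [Finset.sum_comm]
      refine Finset.sum_le_sum fun e _ => ?_
      rw [← Finset.card_filter]
      refine (Finset.card_le_card (t := {p e, q e}) ?_).trans Finset.card_le_two
      intro v hv
      simp only [Finset.mem_filter] at hv
      simp only [Finset.mem_insert, Finset.mem_singleton]
      rcases hv.2 with h | h
      · exact Or.inl h.symm
      · exact Or.inr h.symm
    simp at h1 h2
    omega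
  -- a nonzero circulation supported on F
  have hz : ∃ z : E → ℝ, z ≠ 0 ∧ (∀ e, e ∉ F → z e = 0) ∧ ∀ v, dvg p q z v = 0 := by
    have he0F : e0 ∈ F := (hFm e0).2 he0
    have hv0 : p e0 ∈ VF := (hVFm _).2 ⟨e0, he0F, Or.inl rfl⟩
    let ext : (F → ℝ) →ₗ[ℝ] (E → ℝ) :=
      { toFun := fun z e => if he : e ∈ F then z ⟨e, he⟩ else 0
        map_add' := by intro x y; ext e; by_cases he : e ∈ F <;> simp [he]
        map_smul' := by intro a x; ext e; by_cases he : e ∈ F <;> simp [he] }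
    let L : (F → ℝ) →ₗ[ℝ] ((VF.erase (p e0) : Finset V) → ℝ) :=
      { toFun := fun z v => dvg p q (ext z) v
        map_add' := by
          intro x y; ext v
          have := dvg_add p q (ext x) (ext y) 1 v
          simp only [one_mul] at this
          rw [map_add]; exact this
        map_smul' := by
          intro a x; ext v
          have := dvg_add p q 0 (ext x) a v
          have h0 : dvg p q 0 (v : V) = 0 := by simp [dvg]
          rw [h0] at this
          simp only [Pi.zero_apply, zero_add] at this
          rw [map_smul]; exact this }
    have hlt : Module.finrank ℝ ((VF.erase (p e0) : Finset V) → ℝ) < Module.finrank ℝ (F → ℝ) := by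
      rw [Module.finrank_fintype_fun_eq_card, Module.finrank_fintype_fun_eq_card,
        Fintype.card_coe, Fintype.card_coe]
      exact lt_of_lt_of_le (Finset.card_erase_lt_of_mem hv0) hcard
    have hker := LinearMap.ker_ne_bot_of_finrank_lt (f := L) hlt
    obtain ⟨z, hzk, hzne⟩ := (Submodule.ne_bot_iff _).1 hker
    have hsupp : ∀ e, e ∉ F → ext z e = 0 := by
      intro e he; simp [ext, he]
    have hne : ∀ v, v ≠ p e0 → dvg p q (ext z) v = 0 := by
      intro v hv
      by_cases hvF : v ∈ VF
      · exact congrFun (LinearMap.mem_ker.1 hzk) ⟨v, Finset.mem_erase.2 ⟨hv, hvF⟩⟩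
      · unfold dvg
        refine Finset.sum_eq_zero fun e _ => ?_
        by_cases he : e ∈ F
        · have h1 : p e ≠ v := fun h => hvF ((hVFm v).2 ⟨e, he, Or.inl h⟩)
          have h2 : q e ≠ v := fun h => hvF ((hVFm v).2 ⟨e, he, Or.inr h⟩)
          simp [h1, h2]
        · rw [hsupp e he, zero_mul]
    refine ⟨ext z, ?_, hsupp, ?_⟩
    · intro h
      apply hzne
      ext e
      have := congrFun h e.1
      simpa [ext] using this
    · intro v
      by_cases hv : v = p e0
      · have hs := sum_dvg p q (ext z) Finset.univ
        rw [Finset.sum_eq_single (p e0) (fun v _ hv => hne v hv) (by simp)] at hs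
        rw [hv, hs]; simp
      · exact hne v hv
  obtain ⟨z, hzne, hzs, hzd⟩ := hz
  have hε : ∃ ε : ℝ, 0 < ε ∧ ∀ e, |ε * z e| ≤ 1 - |h e| := by
    have hlt : ∀ e ∈ F, 0 < 1 - |h e| := by
      intro e he
      have he := (hFm e).1 he
      have : |h e| < 1 := abs_lt.2
        ⟨lt_of_le_of_ne (hbd e).1 (Ne.symm he.2), lt_of_le_of_ne (hbd e).2 he.1⟩
      linarith
    have hev : ∀ᶠ ε in nhdsWithin (0:ℝ) (Set.Ioi 0), ∀ e ∈ F, |ε * z e| ≤ 1 - |h e| := by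
      rw [Filter.eventually_all_finset]
      intro e he
      have ht : Filter.Tendsto (fun ε : ℝ => |ε * z e|) (nhdsWithin 0 (Set.Ioi 0)) (nhds 0) := by
        have : Continuous (fun ε : ℝ => |ε * z e|) := by fun_prop
        have := this.tendsto 0
        simp only [zero_mul, abs_zero] at this
        exact this.mono_left nhdsWithin_le_nhds
      exact (ht.eventually (gt_mem_nhds (hlt e he))).mono fun _ h => le_of_lt h
    obtain ⟨ε, h1, h2⟩ := (hev.and self_mem_nhdsWithin).exists
    refine ⟨ε, h2, fun e => ?_⟩
    by_cases he : e ∈ F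
    · exact h1 e he
    · rw [hzs e he]
      have := abs_le.2 (hbd e)
      simpa using this
  obtain ⟨ε, hεp, hεb⟩ := hε
  have hmem : ∀ a : ℝ, |a| = ε → (fun e => h e + a * z e) ∈ K := by
    intro a ha
    refine ⟨fun e _ => ?_, fun v => ?_⟩
    · have h1 := hεb e
      rw [abs_mul, abs_of_pos hεp, ← ha, ← abs_mul] at h1
      exact abs_le.1 ((abs_add_le _ _).trans (by linarith))
    · rw [dvg_add, hzd, hd]; ring
  have m1 : ∑ e, (h e + ε * z e) ^ 2 ≤ ∑ e, h e ^ 2 := hmax (hmem ε (abs_of_pos hεp))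
  have m2 : ∑ e, (h e + (-ε) * z e) ^ 2 ≤ ∑ e, h e ^ 2 :=
    hmax (hmem (-ε) (by rw [abs_neg, abs_of_pos hεp]))
  have e1 : ∑ e, (h e + ε * z e) ^ 2 + ∑ e, (h e + (-ε) * z e) ^ 2
      = 2 * ∑ e, h e ^ 2 + 2 * ε ^ 2 * ∑ e, z e ^ 2 := by
    rw [Finset.mul_sum, Finset.mul_sum, ← Finset.sum_add_distrib, ← Finset.sum_add_distrib]
    refine Finset.sum_congr rfl fun e _ => ?_
    ring
  have hzpos : 0 < ∑ e, z e ^ 2 := by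
    obtain ⟨e, he⟩ := Function.ne_iff.1 hzne
    exact Finset.sum_pos' (fun _ _ => sq_nonneg _) ⟨e, Finset.mem_univ _, by have : z e ≠ 0 := he; positivity⟩
  have : 0 < 2 * ε ^ 2 * ∑ e, z e ^ 2 := by positivity
  linarith
end
section
open Classical in
theorem konig_aux {A B E : Type} [Fintype A] [Fintype B] [Fintype E] (p : E → A) (q : E → B)
    (k : ℕ) : ∀ S : Finset E, (∀ a, (S.filter (fun e => p e = a)).card = k) →
      (∀ b, (S.filter (fun e => q e = b)).card = k) →
      ∃ c : E → ℕ, (∀ e ∈ S, c e < k) ∧ ∀ e ∈ S, ∀ e' ∈ S, e ≠ e' → (p e = p e' ∨ q e = q e') →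
        c e ≠ c e' := by
  induction k with
  | zero =>
    intro S hA _
    have hS : S = ∅ := by
      by_contra hne
      obtain ⟨e, he⟩ := Finset.nonempty_iff_ne_empty.2 hne
      have h1 : e ∈ S.filter (fun e' => p e' = p e) := by simp [he]
      rw [Finset.card_eq_zero.1 (hA (p e))] at h1
      simp at h1
    subst hS
    exact ⟨fun _ => 0, by simp, by simp⟩
  | succ k ih =>
    intro S hA hB
    have hcA : S.card = Fintype.card A * (k + 1) := by
      rw [Finset.card_eq_sum_card_fiberwise (f := p) (t := Finset.univ) (by simp)]
      simp [hA]
    have hcB : S.card = Fintype.card B * (k + 1) := by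
      rw [Finset.card_eq_sum_card_fiberwise (f := q) (t := Finset.univ) (by simp)]
      simp [hB]
    have hcAB : Fintype.card A = Fintype.card B :=
      Nat.eq_of_mul_eq_mul_right (Nat.succ_pos k) (hcA.symm.trans hcB)
    let N : A → Finset B := fun a => (S.filter (fun e => p e = a)).image q
    have hall : ∀ s : Finset A, s.card ≤ (s.biUnion N).card := by
      intro s
      have h1 : (S.filter (fun e => p e ∈ s)).card = s.card * (k + 1) := by
        rw [Finset.card_eq_sum_card_fiberwise (f := p) (t := s)
          (by intro e he; simpa using (Finset.mem_filter.1 he).2)]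
        rw [Finset.sum_const_nat (m := k + 1)]
        intro a ha
        rw [← hA a, Finset.filter_filter]
        congr 1
        ext e
        simp only [Finset.mem_filter]
        constructor
        · rintro ⟨h, _, h2⟩; exact ⟨h, h2⟩
        · rintro ⟨h, h2⟩; exact ⟨h, h2 ▸ ha, h2⟩
      have h2 : (S.filter (fun e => p e ∈ s)).card ≤ (s.biUnion N).card * (k + 1) := by
        rw [Finset.card_eq_sum_card_fiberwise (f := q) (t := s.biUnion N)]
        · rw [← smul_eq_mul]
          apply Finset.sum_le_card_nsmul
          intro b _
          rw [← hB b]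
          apply Finset.card_le_card
          intro e he
          simp only [Finset.mem_filter] at he ⊢
          exact ⟨he.1.1, he.2⟩
        · intro e he
          have he := Finset.mem_filter.1 he
          simp only [Finset.coe_biUnion, Set.mem_iUnion, N]
          exact ⟨p e, he.2, by
            simp only [Finset.coe_image, Set.mem_image, Finset.coe_filter, Set.mem_ofPred_eq]
            exact ⟨e, ⟨he.1, rfl⟩, rfl⟩⟩
      rw [h1] at h2
      exact Nat.le_of_mul_le_mul_right h2 (Nat.succ_pos k)
    obtain ⟨f, hfinj, hf⟩ := (Finset.all_card_le_biUnion_card_iff_exists_injective N).1 hall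
    have hfbij : Function.Bijective f :=
      (Fintype.bijective_iff_injective_and_card f).2 ⟨hfinj, hcAB⟩
    have hch : ∀ a, ∃ e ∈ S, p e = a ∧ q e = f a := by
      intro a
      have := hf a
      simp only [N, Finset.mem_image, Finset.mem_filter] at this
      obtain ⟨e, ⟨h1, h2⟩, h3⟩ := this
      exact ⟨e, h1, h2, h3⟩
    choose m hmS hmp hmq using hch
    let T : Finset E := S.filter (fun e => e ≠ m (p e))
    have hTA : ∀ a, (T.filter (fun e => p e = a)).card = k := by
      intro a
      have : T.filter (fun e => p e = a) = (S.filter (fun e => p e = a)).erase (m a) := by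
        ext e
        simp only [T, Finset.mem_filter, Finset.mem_erase]
        constructor
        · rintro ⟨⟨h1, h2⟩, h3⟩; subst h3; exact ⟨h2, h1, rfl⟩
        · rintro ⟨h2, h1, h3⟩; subst h3; exact ⟨⟨h1, h2⟩, rfl⟩
      rw [this, Finset.card_erase_of_mem (by simp [hmS, hmp]), hA]; rfl
    have hTB : ∀ b, (T.filter (fun e => q e = b)).card = k := by
      intro b
      obtain ⟨a, rfl⟩ := hfbij.2 b
      have : T.filter (fun e => q e = f a) = (S.filter (fun e => q e = f a)).erase (m a) := by
        ext e
        simp only [T, Finset.mem_filter, Finset.mem_erase]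
        constructor
        · rintro ⟨⟨h1, h2⟩, h3⟩
          refine ⟨?_, h1, h3⟩
          rintro rfl
          rw [hmp] at h2; exact h2 rfl
        · rintro ⟨h2, h1, h3⟩
          refine ⟨⟨h1, ?_⟩, h3⟩
          intro h4
          have h5 : q e = f (p e) := by rw [h4, hmp]; exact hmq _
          have h6 : p e = a := hfinj (h5.symm.trans h3)
          rw [h6] at h4; exact h2 h4
      rw [this, Finset.card_erase_of_mem (by simp [hmS, hmq]), hB]; rfl
    obtain ⟨c, hc1, hc2⟩ := ih T hTA hTB
    have hMm : ∀ e e', e = m (p e) → e' = m (p e') → (p e = p e' ∨ q e = q e') → e = e' := by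
      intro e e' h1 h2 h3
      have h4 : p e = p e' := by
        rcases h3 with h3 | h3
        · exact h3
        · rw [h1, h2, hmq, hmq] at h3; exact hfinj h3
      rw [h1, h2, h4]
    refine ⟨fun e => if e = m (p e) then k else c e, ?_, ?_⟩
    · intro e he
      by_cases h : e = m (p e)
      · simp [← h]
      · simp only [h, if_false]
        have := hc1 e (Finset.mem_filter.2 ⟨he, h⟩)
        omega
    · intro e he e' he' hne hadj
      beta_reduce
      by_cases h : e = m (p e) <;> by_cases h' : e' = m (p e')
      · exact absurd (hMm e e' h h' hadj) hne
      · have := hc1 e' (Finset.mem_filter.2 ⟨he', h'⟩)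
        rw [if_pos h, if_neg h']; omega
      · have := hc1 e (Finset.mem_filter.2 ⟨he, h⟩)
        rw [if_neg h, if_pos h']; omega
      · rw [if_neg h, if_neg h']
        exact hc2 e (Finset.mem_filter.2 ⟨he, h⟩) e' (Finset.mem_filter.2 ⟨he', h'⟩) hne hadj
end

namespace Multigraph

theorem bipartite_class1 (H : Multigraph) (k : ℕ) (hreg : H.IsRegular k) (hb : H.IsBipartite) :
    H.IsClass1 := by
  classical
  have := Fintype.ofFinite H.V
  have := Fintype.ofFinite H.E
  obtain ⟨s, hs⟩ := hb
  have hdeg : ∀ v, (Finset.univ.filter (fun e => H.Inc v e)).card = k := by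
    intro v
    rw [← hreg v, degree, Nat.card_eq_fintype_card, Fintype.card_subtype]
  unfold IsClass1
  rcases isEmpty_or_nonempty H.V with hV | hV
  · have hE : IsEmpty H.E := ⟨fun e => hV.elim (H.tail e)⟩
    have h1 : H.maxDegree = 0 := by
      unfold maxDegree; rw [Set.range_eq_empty]; simp
    rw [h1]
    unfold chromaticIndex
    apply Nat.sInf_eq_zero.2
    left
    exact ⟨fun e => hE.elim e, fun e => hE.elim e⟩
  have h1 : H.maxDegree = k := by
    unfold maxDegree
    have : H.degree = fun _ => k := funext hreg
    rw [this, Set.range_const]; simp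
  rw [h1]
  apply le_antisymm
  · apply Nat.sInf_le
    let p : H.E → {v // v ∈ s} := fun e =>
      if h : H.tail e ∈ s then ⟨H.tail e, h⟩ else ⟨H.head e, by have := hs e; tauto⟩
    let q : H.E → {v // v ∉ s} := fun e =>
      if h : H.tail e ∈ s then ⟨H.head e, by have := hs e; tauto⟩ else ⟨H.tail e, h⟩
    have hp : ∀ e (a : {v // v ∈ s}), p e = a ↔ H.Inc a e := by
      rintro e ⟨a, ha⟩
      have := hs e
      simp only [p, Inc]
      split_ifs with h
      · rw [Subtype.mk.injEq]
        constructor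
        · exact Or.inl
        · rintro (h1 | h1)
          · exact h1
          · subst h1; tauto
      · rw [Subtype.mk.injEq]
        constructor
        · exact Or.inr
        · rintro (h1 | h1)
          · subst h1; tauto
          · exact h1
    have hq : ∀ e (a : {v // v ∉ s}), q e = a ↔ H.Inc a e := by
      rintro e ⟨a, ha⟩
      have := hs e
      simp only [q, Inc]
      split_ifs with h
      · rw [Subtype.mk.injEq]
        constructor
        · exact Or.inr
        · rintro (h1 | h1)
          · subst h1; tauto
          · exact h1
      · rw [Subtype.mk.injEq]
        constructor
        · exact Or.inl
        · rintro (h1 | h1)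
          · exact h1
          · subst h1; tauto
    obtain ⟨c, hc1, hc2⟩ := konig_aux p q k Finset.univ
      (by intro a; rw [← hdeg a.1]; simp only [hp])
      (by intro a; rw [← hdeg a.1]; simp only [hq])
    refine ⟨fun e => ⟨c e, hc1 e (Finset.mem_univ _)⟩, ?_⟩
    rintro e e' ⟨hne, v, hv, hv'⟩ heq
    refine hc2 e (Finset.mem_univ _) e' (Finset.mem_univ _) hne ?_ (by simpa using heq)
    by_cases h : v ∈ s
    · left; rw [(hp e ⟨v, h⟩).2 hv, (hp e' ⟨v, h⟩).2 hv']
    · right; rw [(hq e ⟨v, h⟩).2 hv, (hq e' ⟨v, h⟩).2 hv']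
  · have hne : {k | ∃ c : H.E → Fin k, H.IsProperEdgeColoring c}.Nonempty := by
      refine ⟨Fintype.card H.E, Fintype.equivFin H.E, ?_⟩
      rintro e e' ⟨h, _⟩ heq
      exact h ((Fintype.equivFin H.E).injective heq)
    obtain ⟨c, hc⟩ := Nat.sInf_mem hne
    obtain ⟨v⟩ := hV
    have := Finset.card_le_card_of_injOn (s := Finset.univ.filter (fun e => H.Inc v e))
      (t := Finset.univ) c (by simp) (by
        intro e he e' he' heq
        by_contra hne
        simp only [Finset.coe_filter, Finset.mem_univ, true_and, Set.mem_ofPred_eq] at he he'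
        exact hc e e' ⟨hne, v, he, he'⟩ heq)
    rw [hdeg v, Finset.card_univ, Fintype.card_fin] at this
    exact this

end Multigraph
section
open Classical in
theorem local_aux {E : Type} (S : Finset E) (t : ℕ) (ht : 1 ≤ t) (hS : S.card = 2 * t + 1)
    (g : E → ℝ) (R : ℝ) (hR : (2 * (t:ℝ) - 1) * R < 2 * t + 1)
    (hg : ∀ e ∈ S, 1 ≤ |g e| ∧ |g e| ≤ R) (h0 : ∑ e ∈ S, g e = 0)
    (hlt : (S.filter (fun e => ¬ 0 < g e)).card < (S.filter (fun e => 0 < g e)).card) :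
    ∀ e ∈ S, (0 < g e → (2 * (t:ℝ) - 1) * g e < 2 * t) ∧
      (g e < 0 → 2 * (t:ℝ) ≤ (2 * (t:ℝ) - 1) * (- g e)) := by
  set P := S.filter (fun e => 0 < g e) with hP
  set N := S.filter (fun e => ¬ 0 < g e) with hN
  have hPm : ∀ e, e ∈ P → 1 ≤ g e ∧ g e ≤ R := by
    intro e he
    have h1 := Finset.mem_filter.1 he
    have h2 := hg e h1.1
    rwa [abs_of_pos h1.2] at h2
  have hNm : ∀ e, e ∈ N → 1 ≤ - g e ∧ - g e ≤ R := by
    intro e he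
    have h1 := Finset.mem_filter.1 he
    have h2 := hg e h1.1
    rwa [abs_of_nonpos (not_lt.1 h1.2)] at h2
  have hcard : P.card + N.card = 2 * t + 1 := by
    rw [← hS]; exact Finset.card_filter_add_card_filter_not _
  have hsum : ∑ e ∈ P, g e = ∑ e ∈ N, - g e := by
    have := Finset.sum_filter_add_sum_filter_not S (fun e => 0 < g e) g
    rw [h0] at this
    rw [Finset.sum_neg_distrib]
    linarith
  have hT : (1:ℝ) ≤ t := by exact_mod_cast ht
  have hPl : (P.card : ℝ) ≤ ∑ e ∈ P, g e := by
    have := Finset.card_nsmul_le_sum P g 1 (fun e he => (hPm e he).1)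
    simpa using this
  have hNu : ∑ e ∈ N, - g e ≤ N.card * R := by
    have := Finset.sum_le_card_nsmul N (fun e => - g e) R (fun e he => (hNm e he).2)
    simpa using this
  have hcR : (P.card : ℝ) + N.card = 2 * t + 1 := by exact_mod_cast hcard
  have hNt : N.card = t := by
    have hle : N.card ≤ t := by omega
    by_contra hne
    have hle' : N.card + 1 ≤ t := by omega
    have hle2 : (N.card : ℝ) + 1 ≤ t := by exact_mod_cast hle'
    have h1 : (P.card : ℝ) ≤ N.card * R := by linarith
    have h2 : (2 * (t:ℝ) - 1) * P.card ≤ N.card * (2 * t + 1) := by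
      have h3 : (2 * (t:ℝ) - 1) * P.card ≤ (2 * (t:ℝ) - 1) * (N.card * R) :=
        mul_le_mul_of_nonneg_left h1 (by linarith)
      have h4 : (N.card : ℝ) * ((2 * (t:ℝ) - 1) * R) ≤ N.card * (2 * t + 1) :=
        mul_le_mul_of_nonneg_left hR.le (Nat.cast_nonneg _)
      linarith
    have h5 : (P.card : ℝ) = 2 * t + 1 - N.card := by linarith
    rw [h5] at h2
    nlinarith
  have hPt : P.card = t + 1 := by omega
  rw [hNt] at hNu
  intro e he
  constructor
  · intro hpos
    have heP : e ∈ P := Finset.mem_filter.2 ⟨he, hpos⟩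
    have h1 := Finset.card_nsmul_le_sum (P.erase e) g 1
      (fun e' he' => (hPm e' (Finset.mem_of_mem_erase he')).1)
    rw [Finset.card_erase_of_mem heP, hPt] at h1
    have h2 := Finset.add_sum_erase P g heP
    simp at h1
    have h3 : g e ≤ t * R - t := by linarith
    have h4 : (2 * (t:ℝ) - 1) * g e ≤ (2 * (t:ℝ) - 1) * (t * R - t) :=
      mul_le_mul_of_nonneg_left h3 (by linarith)
    nlinarith
  · intro hneg
    have heN : e ∈ N := Finset.mem_filter.2 ⟨he, not_lt.2 hneg.le⟩
    have h1 := Finset.sum_le_card_nsmul (N.erase e) (fun e => - g e) R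
      (fun e' he' => (hNm e' (Finset.mem_of_mem_erase he')).2)
    rw [Finset.card_erase_of_mem heN, hNt] at h1
    have h2 := Finset.add_sum_erase N (fun e => - g e) heN
    simp only [nsmul_eq_mul, Nat.cast_sub ht, Nat.cast_one] at h1
    rw [hPt] at hPl
    push_cast at hPl
    have h3 : (t:ℝ) + 1 - (t - 1) * R ≤ - g e := by linarith
    have h4 : (2 * (t:ℝ) - 1) * ((t:ℝ) + 1 - (t - 1) * R) ≤ (2 * (t:ℝ) - 1) * (- g e) :=
      mul_le_mul_of_nonneg_left h3 (by linarith)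
    nlinarith

theorem local_lem {E : Type} (S : Finset E) (t : ℕ) (ht : 1 ≤ t) (hS : S.card = 2 * t + 1)
    (g : E → ℝ) (R : ℝ) (hR : (2 * (t:ℝ) - 1) * R < 2 * t + 1)
    (hg : ∀ e ∈ S, 1 ≤ |g e| ∧ |g e| ≤ R) (h0 : ∑ e ∈ S, g e = 0) :
    (∀ e ∈ S, (0 < g e → (2 * (t:ℝ) - 1) * g e < 2 * t) ∧
      (g e < 0 → 2 * (t:ℝ) ≤ (2 * (t:ℝ) - 1) * (- g e))) ∨
    (∀ e ∈ S, (0 < g e → 2 * (t:ℝ) ≤ (2 * (t:ℝ) - 1) * g e) ∧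
      (g e < 0 → (2 * (t:ℝ) - 1) * (- g e) < 2 * t)) := by
  classical
  have hc : (S.filter (fun e => 0 < g e)).card + (S.filter (fun e => ¬ 0 < g e)).card
      = 2 * t + 1 := by
    rw [← hS]; exact Finset.card_filter_add_card_filter_not _
  by_cases hlt : (S.filter (fun e => ¬ 0 < g e)).card < (S.filter (fun e => 0 < g e)).card
  · exact Or.inl (local_aux S t ht hS g R hR hg h0 hlt)
  · right
    have hne : ∀ e ∈ S, g e ≠ 0 := by
      intro e he h
      have := (hg e he).1
      rw [h] at this; norm_num at this
    have e1 : S.filter (fun e => 0 < - g e) = S.filter (fun e => ¬ 0 < g e) := by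
      apply Finset.filter_congr
      intro e he
      have := hne e he
      constructor
      · intro h; linarith
      · intro h; have := lt_of_le_of_ne (not_lt.1 h) this; linarith
    have e2 : S.filter (fun e => ¬ 0 < - g e) = S.filter (fun e => 0 < g e) := by
      apply Finset.filter_congr
      intro e he
      have := hne e he
      constructor
      · intro h; exact lt_of_le_of_ne (by linarith) (Ne.symm this)
      · intro h; linarith
    have := local_aux S t ht hS (fun e => - g e) R hR (by simpa using hg)
      (by rw [Finset.sum_neg_distrib, h0, neg_zero]) (by rw [e1, e2]; omega)
    intro e he
    obtain ⟨h1, h2⟩ := this e he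
    refine ⟨fun h => ?_, fun h => h1 (by linarith)⟩
    have := h2 (by linarith)
    simpa using this
end

namespace Multigraph

theorem flow_iff_dvg (H : Multigraph) [Fintype H.E] (f : H.E → ℝ) (v : H.V) :
    (∑ᶠ e ∈ {e | H.tail e = v}, f e = ∑ᶠ e ∈ {e | H.head e = v}, f e) ↔
      dvg H.tail H.head f v = 0 := by
  classical
  rw [finsum_mem_def, finsum_mem_def, finsum_eq_sum_of_fintype, finsum_eq_sum_of_fintype,
    ← sub_eq_zero, ← Finset.sum_sub_distrib]
  unfold dvg
  have : ∀ e, Set.indicator {e | H.tail e = v} (fun e => f e) e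
      - Set.indicator {e | H.head e = v} (fun e => f e) e =
      f e * ((if H.tail e = v then (1:ℝ) else 0) - (if H.head e = v then 1 else 0)) := by
    intro e
    simp only [Set.indicator, Set.mem_ofPred_eq]
    split_ifs <;> simp
  simp only [this]

theorem lower (H : Multigraph) (t : ℕ) (ht : 1 ≤ t) (hreg : H.IsRegular (2 * t + 1)) (r : ℝ)
    (hr : r < 2 + 2 / (2 * (t:ℝ) - 1)) (hf : H.HasNZFlow r) : H.IsBipartite := by
  classical
  have := Fintype.ofFinite H.V
  have := Fintype.ofFinite H.E
  have hT : (1:ℝ) ≤ t := by exact_mod_cast ht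
  obtain ⟨f, hfb, hfl⟩ := hf
  have hdeg : ∀ v, (Finset.univ.filter (fun e => H.Inc v e)).card = 2 * t + 1 := by
    intro v
    rw [← hreg v, degree, Nat.card_eq_fintype_card, Fintype.card_subtype]
  have hR : (2 * (t:ℝ) - 1) * (r - 1) < 2 * t + 1 := by
    have hp : 0 < 2 * (t:ℝ) - 1 := by linarith
    have : (2 * (t:ℝ) - 1) * (r - 1) < (2 * (t:ℝ) - 1) * (1 + 2 / (2 * (t:ℝ) - 1)) :=
      mul_lt_mul_of_pos_left (by linarith) hp
    have h2 : (2 * (t:ℝ) - 1) * (1 + 2 / (2 * (t:ℝ) - 1)) = 2 * t + 1 := by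
      field_simp; ring
    linarith
  let g : H.V → H.E → ℝ := fun v e =>
    f e * ((if H.tail e = v then (1:ℝ) else 0) - (if H.head e = v then 1 else 0))
  have hnl : ∀ e, H.tail e ≠ H.head e := H.no_loop
  have gt : ∀ e, g (H.tail e) e = f e := by
    intro e; simp [g, (hnl e).symm]
  have gh : ∀ e, g (H.head e) e = - f e := by
    intro e; simp [g, hnl e]
  have hloc := fun v => local_lem (Finset.univ.filter (fun e => H.Inc v e)) t ht (hdeg v) (g v)
    (r - 1) hR (by
      intro e he
      have he : H.Inc v e := by simpa using he
      rcases he with rfl | rfl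
      · rw [gt]; exact hfb e
      · rw [gh, abs_neg]; exact hfb e) (by
      have h1 := (H.flow_iff_dvg f v).1 (hfl v)
      rw [← h1]
      unfold dvg
      apply Finset.sum_subset (Finset.subset_univ _)
      intro e _ he
      simp only [Finset.mem_filter, Finset.mem_univ, true_and] at he
      unfold Inc at he
      rw [not_or] at he
      simp [g, he.1, he.2])
  let P : H.V → Prop := fun v => ∀ e ∈ Finset.univ.filter (fun e => H.Inc v e),
    (0 < g v e → (2 * (t:ℝ) - 1) * g v e < 2 * t) ∧
      (g v e < 0 → 2 * (t:ℝ) ≤ (2 * (t:ℝ) - 1) * (- g v e))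
  refine ⟨{v | P v}, fun e he => ?_⟩
  simp only [Set.mem_ofPred_eq] at he
  have ht1 : e ∈ Finset.univ.filter (fun e' => H.Inc (H.tail e) e') :=
    Finset.mem_filter.2 ⟨Finset.mem_univ _, Or.inl rfl⟩
  have hh1 : e ∈ Finset.univ.filter (fun e' => H.Inc (H.head e) e') :=
    Finset.mem_filter.2 ⟨Finset.mem_univ _, Or.inr rfl⟩
  have hne : f e ≠ 0 := by
    intro h
    have := (hfb e).1
    rw [h] at this; norm_num at this
  by_cases hp : P (H.tail e)
  · have a1 := hp e ht1
    have a2 := (he.1 hp) e hh1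
    rw [gt] at a1
    rw [gh] at a2
    rcases lt_or_gt_of_ne hne with h | h
    · have := a1.2 h
      have := a2.1 (by linarith)
      linarith
    · have := a1.1 h
      have := a2.2 (by linarith)
      rw [neg_neg] at this
      linarith
  · have a1 := ((hloc (H.tail e)).resolve_left hp) e ht1
    have a2 := ((hloc (H.head e)).resolve_left (fun h => hp (he.2 h))) e hh1
    rw [gt] at a1
    rw [gh] at a2
    rcases lt_or_gt_of_ne hne with h | h
    · have := a1.2 h
      have := a2.1 (by linarith)
      linarith
    · have := a1.1 h
      have := a2.2 (by linarith)
      rw [neg_neg] at this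
      linarith

open Classical in
theorem flow_of_cut (H : Multigraph) [Fintype H.V] [Fintype H.E] (b : H.V → ℝ)
    (hb : ∀ v, b v = 1 ∨ b v = -1) (k : ℕ) (hk : Odd k) (hreg : H.IsRegular k)
    (l : ℝ) (hl : 1 < l)
    (hcut : ∀ X : Finset H.V, l * |∑ v ∈ X, b v| ≤
      ((Finset.univ.filter (fun e => ¬ (H.tail e ∈ X ↔ H.head e ∈ X))).card : ℝ)) :
    H.HasNZFlow (2 * l / (l - 1)) := by
  have hl0 : 0 < l := by linarith
  have hl1 : 0 < l - 1 := by linarith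
  obtain ⟨h, hh, hd⟩ := feasible H.tail H.head b (1 / l) (by positivity) (by
    intro X
    have := hcut X
    rw [div_mul_eq_mul_div, one_mul, le_div_iff₀ hl0]
    linarith)
  obtain ⟨D, hD, hDd⟩ := rounding H.tail H.head H.no_loop b hb (by
    intro v
    have : (Finset.univ.filter (fun e => H.tail e = v ∨ H.head e = v)).card = k := by
      rw [← hreg v, degree, Nat.card_eq_fintype_card, Fintype.card_subtype]
      congr 1
      ext e
      simp only [Finset.mem_filter, Finset.mem_univ, true_and]
      rfl
    rw [this]; exact hk) h
    (fun e => (hh e).trans (by rw [div_le_one hl0]; exact hl.le)) hd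
  refine ⟨fun e => 0 + (l / (l - 1)) * (D e + (-1) * h e), fun e => ?_, fun v => ?_⟩
  · have h1 := abs_le.1 (hh e)
    have h2 : l * h e ≤ 1 := by
      have := mul_le_mul_of_nonneg_left h1.2 hl0.le
      rwa [mul_one_div_cancel hl0.ne'] at this
    have h3 : -1 ≤ l * h e := by
      have := mul_le_mul_of_nonneg_left h1.1 hl0.le
      rwa [mul_neg, mul_one_div_cancel hl0.ne'] at this
    have e1 : 0 + (l / (l - 1)) * (D e + (-1) * h e) = (l * D e - l * h e) / (l - 1) := by
      field_simp; ring
    have e2 : 2 * l / (l - 1) - 1 = (l + 1) / (l - 1) := by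
      field_simp; ring
    beta_reduce
    rw [e1, e2, abs_div, abs_of_pos hl1, le_div_iff₀ hl1, div_le_div_iff_of_pos_right hl1]
    rcases hD e with h4 | h4
    · rw [h4, abs_of_nonneg (by linarith)]; constructor <;> linarith
    · rw [h4, abs_of_nonpos (by linarith)]; constructor <;> linarith
  · rw [flow_iff_dvg, dvg_add H.tail H.head (fun _ => 0), dvg_add, hd, hDd]
    simp [dvg]

end Multigraph
namespace Multigraph

theorem addCopies_bridgeless (G : Multigraph) (M : Set G.E) (k : ℕ) (hG : G.Bridgeless) :
    (G.addCopies M k).Bridgeless := by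
  rintro (e | ⟨i, e⟩) hbr
  · apply hG e
    intro hreach
    apply hbr
    refine Relation.ReflTransGen.mono (r := (G.deleteEdges {e}).VAdj) ?_ _ _ hreach
    rintro u v ⟨⟨e', he'⟩, h⟩
    refine ⟨⟨Sum.inl e', ?_⟩, h⟩
    intro h'
    exact he' (Sum.inl.inj h')
  · apply hbr
    apply Relation.ReflTransGen.single
    refine ⟨⟨Sum.inl e.1, ?_⟩, Or.inl rfl⟩
    intro h'
    cases h'

theorem addCopies_regular (G : Multigraph) (M : Set G.E) (k d : ℕ) (hG : G.IsRegular d)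
    (hM : G.IsPerfectMatching M) : (G.addCopies M k).IsRegular (d + k) := by
  intro v
  have e1 : {e : (G.addCopies M k).E // (G.addCopies M k).Inc v e} ≃
      {e : G.E // G.Inc v e} ⊕ {x : (_ : Fin k) × M // G.Inc v x.2.1} :=
    Equiv.subtypeSum
  have e2 : {x : (_ : Fin k) × M // G.Inc v x.2.1} ≃ Fin k := by
    choose m hm hu using hM v
    refine ⟨fun x => x.1.1, fun i => ⟨⟨i, ⟨m, hm.1⟩⟩, hm.2⟩, ?_, ?_⟩
    · rintro ⟨⟨i, ⟨e, he⟩⟩, h⟩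
      have := hu e ⟨he, h⟩
      subst this; rfl
    · intro i; rfl
  unfold degree
  rw [Nat.card_congr e1, Nat.card_sum, Nat.card_congr e2, Nat.card_fin]
  congr 1
  exact hG v

open Classical in
theorem matching_bound (G : Multigraph) [Fintype G.V] [Fintype G.E] (M : Set G.E)
    (hM : G.IsPerfectMatching M) (b : G.V → ℝ) (hb : ∀ v, b v = 1 ∨ b v = -1)
    (hp : ∀ e ∈ M, b (G.tail e) = - b (G.head e)) (X : Finset G.V) :
    |∑ v ∈ X, b v| ≤
      ((Finset.univ.filter (fun e : M => ¬ (G.tail e ∈ X ↔ G.head e ∈ X))).card : ℝ) := by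
  have h1 : ∀ v, b v = ∑ e : M, ((if G.tail e = v then b v else 0)
      + (if G.head e = v then b v else 0)) := by
    intro v
    obtain ⟨m, ⟨hm, hmv⟩, hu⟩ := hM v
    rw [Finset.sum_eq_single (⟨m, hm⟩ : M)]
    · have hne : G.tail m ≠ G.head m := G.no_loop m
      rcases hmv with h | h
      · have : G.head m ≠ v := fun h' => hne (h.trans h'.symm)
        simp [h, this]
      · have : G.tail m ≠ v := fun h' => hne (h'.trans h.symm)
        simp [h, this]
    · rintro ⟨e, he⟩ _ hne
      have h1 : G.tail e ≠ v := fun h => hne (Subtype.ext (hu e ⟨he, Or.inl h⟩))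
      have h2 : G.head e ≠ v := fun h => hne (Subtype.ext (hu e ⟨he, Or.inr h⟩))
      simp [h1, h2]
    · simp
  have h2 : ∑ v ∈ X, b v = ∑ e : M, ((if G.tail e ∈ X then b (G.tail e) else 0)
      + (if G.head e ∈ X then b (G.head e) else 0)) := by
    rw [Finset.sum_congr rfl (fun v _ => h1 v), Finset.sum_comm]
    refine Finset.sum_congr rfl fun e _ => ?_
    rw [Finset.sum_add_distrib, Finset.sum_ite_eq, Finset.sum_ite_eq]
  rw [h2, Finset.card_filter, Nat.cast_sum]
  refine (Finset.abs_sum_le_sum_abs _ _).trans (Finset.sum_le_sum fun e _ => ?_)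
  have hab : ∀ v, |b v| ≤ 1 := by
    intro v; rcases hb v with h | h <;> simp [h]
  have := hp e.1 e.2
  by_cases h3 : G.tail e ∈ X <;> by_cases h4 : G.head e ∈ X
  · simp [h3, h4, this]
  · simpa [h3, h4] using hab _
  · simpa [h3, h4] using hab _
  · simp [h3, h4]

theorem upper (G : Multigraph) (r : ℝ) (hr : 4 < r) (B W : Set G.V) (M : Set G.E)
    (hcubic : G.IsRegular 3) (hbip : G.IsRBipartition r B W) (hM : G.IsPerfectMatching M)
    (hpair : ∀ e ∈ M, (G.tail e ∈ B ∧ G.head e ∈ W) ∨ (G.tail e ∈ W ∧ G.head e ∈ B))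
    (k j : ℕ) (hk : k = 2 * j) :
    (G.addCopies M k).HasNZFlow
      (2 * (r / (r - 2) + k) / (r / (r - 2) + k - 1)) := by
  classical
  have := Fintype.ofFinite G.V
  have := Fintype.ofFinite G.E
  obtain ⟨hU, hI, hbip⟩ := hbip
  have hBW : ∀ v, v ∈ W ↔ v ∉ B := by
    intro v
    have h1 : v ∈ B ∪ W := hU ▸ Set.mem_univ v
    have h2 : ¬ v ∈ B ∩ W := by rw [hI]; simp
    constructor
    · intro h h'; exact h2 ⟨h', h⟩
    · intro h; exact h1.resolve_left h
  let b : G.V → ℝ := fun v => if v ∈ B then 1 else -1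
  have hb : ∀ v, b v = 1 ∨ b v = -1 := by
    intro v; simp only [b]; split_ifs <;> simp
  have hp : ∀ e ∈ M, b (G.tail e) = - b (G.head e) := by
    intro e he
    simp only [b]
    rcases hpair e he with ⟨h1, h2⟩ | ⟨h1, h2⟩
    · rw [hBW] at h2; simp [h1, h2]
    · rw [hBW] at h1; simp [h1, h2]
  have hsum : ∀ X : Finset G.V, ∑ v ∈ X, b v =
      (((X : Set G.V) ∩ B).ncard : ℝ) - (((X : Set G.V) ∩ W).ncard : ℝ) := by
    intro X
    have hB : ((X : Set G.V) ∩ B) = ((X.filter (fun v => v ∈ B) : Finset G.V) : Set G.V) := by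
      ext; simp
    have hW : ((X : Set G.V) ∩ W) = ((X.filter (fun v => ¬ v ∈ B) : Finset G.V) : Set G.V) := by
      ext v; simp [hBW]
    rw [hB, hW, Set.ncard_coe_finset, Set.ncard_coe_finset]
    simp only [b]
    rw [Finset.sum_ite]
    simp
    ring
  have hl : 1 < r / (r - 2) := by rw [one_lt_div (by linarith)]; linarith
  let e0 : Fintype (G.addCopies M k).V := inferInstanceAs (Fintype G.V)
  let e1 : Fintype (G.addCopies M k).E := Fintype.ofFinite _
  refine flow_of_cut (G.addCopies M k) b hb (3 + k) ⟨j + 1, by omega⟩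
    (addCopies_regular G M k 3 hcubic hM) _ (by
      have : (0:ℝ) ≤ k := Nat.cast_nonneg k
      linarith) ?_
  intro (X : Finset G.V)
  have c1 := hbip (X : Set G.V)
  rw [← hsum X] at c1
  have c2 := matching_bound G M hM b hb hp X
  have c3 : ((Finset.univ.filter (fun e : (G.addCopies M k).E =>
      ¬ ((G.addCopies M k).tail e ∈ X ↔ (G.addCopies M k).head e ∈ X))).card) =
      (G.cut (X : Set G.V)).ncard +
      k * (Finset.univ.filter (fun e : M => ¬ (G.tail e ∈ X ↔ G.head e ∈ X))).card := by
    have f1 : {e : (G.addCopies M k).E // ¬ ((G.addCopies M k).tail e ∈ X ↔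
        (G.addCopies M k).head e ∈ X)} ≃
      {e : G.E // ¬ (G.tail e ∈ X ↔ G.head e ∈ X)} ⊕
      {x : (_ : Fin k) × M // ¬ (G.tail x.2.1 ∈ X ↔ G.head x.2.1 ∈ X)} := Equiv.subtypeSum
    have f2 : {x : (_ : Fin k) × M // ¬ (G.tail x.2.1 ∈ X ↔ G.head x.2.1 ∈ X)} ≃
        Fin k × {e : M // ¬ (G.tail e ∈ X ↔ G.head e ∈ X)} :=
      ⟨fun x => (x.1.1, ⟨x.1.2, x.2⟩), fun y => ⟨⟨y.1, y.2.1⟩, y.2.2⟩,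
        fun _ => rfl, fun _ => rfl⟩
    rw [← Fintype.card_subtype, ← Nat.card_eq_fintype_card, Nat.card_congr f1, Nat.card_sum,
      Nat.card_congr f2, Nat.card_prod, Nat.card_fin, Nat.card_eq_fintype_card (α := {e : M // _}),
      Fintype.card_subtype]
    rfl
  have : (0:ℝ) ≤ k := Nat.cast_nonneg k
  have c4 := mul_le_mul_of_nonneg_left c2 this
  have c5 : (r / (r - 2) + k) * |∑ v ∈ X, b v| ≤ (((G.cut (X : Set G.V)).ncard +
      k * (Finset.univ.filter (fun e : M => ¬ (G.tail e ∈ X ↔ G.head e ∈ X))).card : ℕ) : ℝ) := by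
    push_cast
    calc (r / (r - 2) + k) * |∑ v ∈ X, b v|
        = r / (r - 2) * |∑ v ∈ X, b v| + k * |∑ v ∈ X, b v| := by ring
      _ ≤ _ := add_le_add c1 c4
  refine le_of_le_of_eq c5 (congrArg Nat.cast (c3.symm.trans ?_))
  congr

end Multigraph


/-- if there is a family of bridgeless cubic class 2 graphs `G n`
with `r n`-bipartitions (`r n ∈ (4,5)`, `r n → 4`) and perfect matchings `M n`
having the `M n`-class-2 property and pairing the two color classes, then for
every `t ≥ 1` the infimum of the circular flow numbers of bridgeless
`(2t+1)`-regular class 2 multigraphs is `2 + 2/(2t-1)`. -/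
theorem statement_8 (G : ℕ → Multigraph) (r : ℕ → ℝ)
    (B W : (n : ℕ) → Set (G n).V) (M : (n : ℕ) → Set (G n).E)
    (hbl : ∀ n, (G n).Bridgeless) (hcubic : ∀ n, (G n).IsRegular 3)
    (hclass2 : ∀ n, (G n).IsClass2)
    (hr : ∀ n, r n ∈ Set.Ioo (4 : ℝ) 5)
    (hbip : ∀ n, (G n).IsRBipartition (r n) (B n) (W n))
    (hM : ∀ n, (G n).IsPerfectMatching (M n))
    (hMc : ∀ n, (G n).MClass2Property (M n))
    (hpair : ∀ n, ∀ e ∈ M n,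
      ((G n).tail e ∈ B n ∧ (G n).head e ∈ W n) ∨
      ((G n).tail e ∈ W n ∧ (G n).head e ∈ B n))
    (hlim : Filter.Tendsto r Filter.atTop (nhds 4)) :
    ∀ t : ℕ, 1 ≤ t →
      sInf {x : EReal | ∃ H : Multigraph,
          H.Bridgeless ∧ H.IsRegular (2 * t + 1) ∧ H.IsClass2 ∧ H.flowNumber = x}
        = ((2 + 2 / (2 * (t : ℝ) - 1) : ℝ) : EReal) := by
  intro t ht
  have hT : (1:ℝ) ≤ t := by exact_mod_cast ht
  apply le_antisymm
  · have hlim1 : Filter.Tendsto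
        (fun n => 2 * (r n / (r n - 2) + ((2 * t - 2 : ℕ) : ℝ))
          / (r n / (r n - 2) + ((2 * t - 2 : ℕ) : ℝ) - 1))
        Filter.atTop (nhds (2 + 2 / (2 * (t : ℝ) - 1))) := by
      have hc : ((2 * t - 2 : ℕ) : ℝ) = 2 * t - 2 := by
        rw [Nat.cast_sub (by omega)]; push_cast; ring
      rw [hc]
      have h1 : Filter.Tendsto (fun n => r n / (r n - 2) + (2 * (t:ℝ) - 2)) Filter.atTop
          (nhds (4 / (4 - 2) + (2 * (t:ℝ) - 2))) :=
        (hlim.div (hlim.sub_const 2) (by norm_num)).add_const _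
      have h2 := (h1.const_mul 2).div (h1.sub_const 1) (by norm_num; linarith)
      have e : 2 * (4 / (4 - 2) + (2 * (t:ℝ) - 2)) / (4 / (4 - 2) + (2 * (t:ℝ) - 2) - 1)
          = 2 + 2 / (2 * (t : ℝ) - 1) := by
        have h3 : 2 * (t:ℝ) - 1 ≠ 0 := by linarith
        have h4 : (4:ℝ) / (4 - 2) + (2 * (t:ℝ) - 2) = 2 * t := by norm_num
        rw [h4]
        field_simp
        ring
      rw [e] at h2
      exact h2
    have hlim2 := (continuous_coe_real_ereal.tendsto _).comp hlim1
    refine ge_of_tendsto' hlim2 fun n => ?_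
    refine sInf_le_of_le ⟨(G n).addCopies (M n) (2 * t - 2),
        Multigraph.addCopies_bridgeless _ _ _ (hbl n), ?_, hMc n t ht, rfl⟩ ?_
    · have := Multigraph.addCopies_regular (G n) (M n) (2 * t - 2) 3 (hcubic n) (hM n)
      have e : 3 + (2 * t - 2) = 2 * t + 1 := by omega
      rwa [e] at this
    · refine sInf_le ⟨_, rfl, ?_, Multigraph.upper (G n) (r n) (hr n).1 (B n) (W n) (M n)
        (hcubic n) (hbip n) (hM n) (hpair n) (2 * t - 2) (t - 1) (by omega)⟩
      have h4 := (hr n).1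
      have h1 : 1 < r n / (r n - 2) := by rw [one_lt_div (by linarith)]; linarith
      have h2 : (0:ℝ) ≤ ((2 * t - 2 : ℕ) : ℝ) := Nat.cast_nonneg _
      rw [le_div_iff₀ (by linarith)]
      linarith
  · refine le_sInf ?_
    rintro x ⟨H, _, hreg, hc2, rfl⟩
    refine le_sInf ?_
    rintro _ ⟨s, rfl, _, hf⟩
    rw [EReal.coe_le_coe_iff]
    by_contra hlt
    exact hc2 (H.bipartite_class1 _ hreg (H.lower t ht hreg s (not_le.1 hlt) hf))
end
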